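/- Fix δ ≥ 0, a symbol a of order 0, and the bump β. There exists ε₀ > 0 such that for every ε ∈ (0, ε₀] the following holds. Let η ∈ C_c^∞(ℝ) be supported in [π−2ε, π+2ε] with η = 1 on [π−ε, π+ε]. For j ≥ 1 define the kernel K̃^j(x,y) = 2^{−j(3/2+δ)} b(2^j, |x−y|) e^{i 2^j |x−y|} 1_{[0,π]}(|θ₁−θ₂|), where b(2^j, r) = β(r)(2^{−j}+r)^{−3/2−δ} a(2^j r), and set T̃^j f(r₁,θ₁) = ∫₀^∞ ∫₀^{2π} K̃^j(x,y) η(θ₁−θ₂) f(r₂,θ₂) dθ₂ r₂ dr₂. Then, for all f supported in {(r₂,θ₂) : r₂ ∈ (0,∞), θ₂ ∈ [0,ε)}: (i) ‖T̃^j f‖_{L²(ℝ²)} ≤ C 2^{−j(3/2+δ)} 2^{−j/2} ‖f‖_{L²(ℝ²)}; (ii) for every p > 4, ‖T̃^j f‖_{L^p(ℝ²)} ≤ C 2^{−j(3/2+δ)} 2^{−2j/p} ‖f‖_{L^p(ℝ²)}; the constants C are independent of j and f. -/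

import Mathlib

open MeasureTheory Real Set
open scoped ENNReal NNReal

noncomputable section

/-- Distance between planar points with polar coordinates, as a function of
`r₁, r₂` and the angle difference. -/
def dG (r₁ r₂ θ : ℝ) : ℝ := Real.sqrt (r₁ ^ 2 + r₂ ^ 2 - 2 * r₁ * r₂ * Real.cos θ)

/-- A symbol of order `0` on `(0, ∞)`. -/
def IsSymbol0 (a : ℝ → ℂ) : Prop :=
  ContDiffOn ℝ (⊤ : ℕ∞) a (Set.Ioi 0) ∧ (∃ M : ℝ, ∀ r > (0 : ℝ), ‖a r‖ ≤ M) ∧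
    ∀ N : ℕ, ∃ C : ℝ, ∀ r > (0 : ℝ),
      ‖iteratedDerivWithin N a (Set.Ioi 0) r‖ ≤ C * r ^ (-(N : ℝ))

/-- The `L^p(ℝ²)` norm of a function written in polar coordinates. -/
def polarLp (p : ℝ) (g : ℝ → ℝ → ℂ) : ℝ≥0∞ :=
  (∫⁻ r in Set.Ioi (0 : ℝ),
      (∫⁻ θ in Set.Ico (0 : ℝ) (2 * Real.pi), (‖g r θ‖₊ : ℝ≥0∞) ^ p) *
        ENNReal.ofReal r) ^ (1 / p)

/-- `b(2^j, r) = β(r) (2^{-j} + r)^{-3/2-δ} a(2^j r)`. -/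
def bfun (δ : ℝ) (a : ℝ → ℂ) (β : ℝ → ℝ) (j : ℕ) (r : ℝ) : ℂ :=
  ((β r : ℝ) : ℂ) * ((((2 : ℝ) ^ (-(j : ℝ)) + r) ^ (-(3 / 2 + δ)) : ℝ) : ℂ) *
    a ((2 : ℝ) ^ (j : ℝ) * r)

/-- The rescaled kernel `K̃^j`. -/
def Ktil (δ : ℝ) (a : ℝ → ℂ) (β : ℝ → ℝ) (j : ℕ) (r₁ θ₁ r₂ θ₂ : ℝ) : ℂ :=
  (((2 : ℝ) ^ (-(j : ℝ) * (3 / 2 + δ)) : ℝ) : ℂ) * bfun δ a β j (dG r₁ r₂ (θ₁ - θ₂)) *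
    Complex.exp (Complex.I * (((2 : ℝ) ^ (j : ℝ) * dG r₁ r₂ (θ₁ - θ₂) : ℝ) : ℂ)) *
    Set.indicator (Set.Icc (0 : ℝ) Real.pi) (fun _ => (1 : ℂ)) |θ₁ - θ₂|

/-- The operator `T̃^j` with the angular cutoff `η(θ₁ - θ₂)`. -/
def Ttil (δ : ℝ) (a : ℝ → ℂ) (β η : ℝ → ℝ) (j : ℕ) (f : ℝ → ℝ → ℂ) (r₁ θ₁ : ℝ) : ℂ :=
  ∫ r₂ in Set.Ioi (0 : ℝ),
    (∫ θ₂ in Set.Ico (0 : ℝ) (2 * Real.pi),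
      Ktil δ a β j r₁ θ₁ r₂ θ₂ * ((η (θ₁ - θ₂) : ℝ) : ℂ) * f r₂ θ₂) * (r₂ : ℂ)



/-- Jensen / Hölder. -/
lemma jensen_lintegral {α : Type*} [MeasurableSpace α] (μ : Measure α) {p : ℝ} (hp : 1 < p)
    {f : α → ℝ≥0∞} (hf : AEMeasurable f μ) :
    (∫⁻ x, f x ∂μ) ^ p ≤ (μ univ) ^ (p - 1) * ∫⁻ x, f x ^ p ∂μ := by
  have hpq := Real.HolderConjugate.conjExponent hp
  have h := ENNReal.lintegral_mul_le_Lp_mul_Lq μ hpq hf (aemeasurable_const (b := (1:ℝ≥0∞)))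
  have h0 : (0:ℝ) < p := by linarith
  simp only [Pi.mul_apply, mul_one, ENNReal.one_rpow, lintegral_const, one_mul] at h
  calc (∫⁻ x, f x ∂μ) ^ p
      ≤ ((∫⁻ x, f x ^ p ∂μ) ^ (1 / p) * (μ univ) ^ (1 / p.conjExponent)) ^ p := by
        gcongr
    _ = (μ univ) ^ (p - 1) * ∫⁻ x, f x ^ p ∂μ := by
        rw [ENNReal.mul_rpow_of_nonneg _ _ h0.le, ← ENNReal.rpow_mul, ← ENNReal.rpow_mul,
          one_div_mul_cancel h0.ne', ENNReal.rpow_one, mul_comm]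
        congr 2
        have : p - 1 ≠ 0 := by linarith
        unfold Real.conjExponent
        field_simp

lemma jensen_tsum {ι : Type*} [MeasurableSpace ι] [MeasurableSingletonClass ι] [Countable ι]
    {p : ℝ} (hp : 1 < p) (w b : ι → ℝ≥0∞) :
    (∑' i, w i * b i) ^ p ≤ (∑' i, w i) ^ (p - 1) * ∑' i, w i * b i ^ p := by
  have hm : ∀ f : ι → ℝ≥0∞, Measurable f := fun f => measurable_of_countable f
  have h := jensen_lintegral (Measure.count.withDensity w) hp (hm b).aemeasurable
  rw [lintegral_withDensity_eq_lintegral_mul _ (hm w) (hm _),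
    lintegral_withDensity_eq_lintegral_mul _ (hm w) (hm _), lintegral_count, lintegral_count,
    withDensity_apply _ MeasurableSet.univ, Measure.restrict_univ, lintegral_count] at h
  simpa using h

/-- Schur test bound. -/
lemma schur_bound {Z : Type*} [MeasurableSpace Z] (ν : Measure Z) [SFinite ν]
    (h : Z → ℝ≥0∞) (hh : AEMeasurable h ν) (K : Z → Z → ℝ≥0∞)
    (hK : Measurable (Function.uncurry K)) (hs : ∀ z z', K z z' = K z' z) (B : ℝ≥0∞)
    (hB : ∀ᵐ z ∂ν, ∫⁻ z', K z z' ∂ν ≤ B) :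
    ∫⁻ z, ∫⁻ z', h z * h z' * K z z' ∂ν ∂ν ≤ B * ∫⁻ z, h z ^ 2 ∂ν := by
  have amgm : ∀ x y : ℝ≥0∞, x * y ≤ (x ^ 2 + y ^ 2) / 2 := by
    intro x y
    rw [ENNReal.le_div_iff_mul_le (by simp) (by simp)]
    rcases eq_or_ne x ⊤ with rfl | hx
    · simp
    rcases eq_or_ne y ⊤ with rfl | hy
    · simp
    lift x to ℝ≥0 using hx
    lift y to ℝ≥0 using hy
    norm_cast
    rw [← NNReal.coe_le_coe]
    push_cast
    nlinarith [sq_nonneg ((x:ℝ) - y)]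
  have hK2 : AEMeasurable (Function.uncurry fun z z' => h z ^ 2 * K z z') (ν.prod ν) := by
    have : AEMeasurable (fun q : Z × Z => h q.1) (ν.prod ν) := hh.comp_quasiMeasurePreserving Measure.quasiMeasurePreserving_fst
    exact (this.pow_const 2).mul hK.aemeasurable
  have hK3 : AEMeasurable (Function.uncurry fun z z' => h z' ^ 2 * K z z') (ν.prod ν) := by
    have : AEMeasurable (fun q : Z × Z => h q.2) (ν.prod ν) := hh.comp_quasiMeasurePreserving Measure.quasiMeasurePreserving_snd
    exact (this.pow_const 2).mul hK.aemeasurable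
  have e1 : ∫⁻ z, ∫⁻ z', h z ^ 2 * K z z' ∂ν ∂ν ≤ B * ∫⁻ z, h z ^ 2 ∂ν := by
    rw [← lintegral_const_mul'' _ (hh.pow_const 2)]
    apply lintegral_mono_ae
    filter_upwards [hB] with z hz
    have hKz : Measurable (K z) := hK.of_uncurry_left
    rw [lintegral_const_mul _ hKz, mul_comm]
    gcongr
  have e2 : ∫⁻ z, ∫⁻ z', h z' ^ 2 * K z z' ∂ν ∂ν = ∫⁻ z, ∫⁻ z', h z ^ 2 * K z z' ∂ν ∂ν := by
    rw [lintegral_lintegral_swap hK3]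
    simp_rw [hs]
  have hK4 : AEMeasurable (fun q : Z × Z => h q.1 ^ 2 * K q.1 q.2 + h q.2 ^ 2 * K q.1 q.2) (ν.prod ν) :=
    hK2.add hK3
  have hK5 : AEMeasurable (fun q : Z × Z => (1/2) * (h q.1 ^ 2 * K q.1 q.2 + h q.2 ^ 2 * K q.1 q.2)) (ν.prod ν) :=
    hK4.const_mul _
  have hK2' : AEMeasurable (fun q : Z × Z => h q.1 ^ 2 * K q.1 q.2) (ν.prod ν) := hK2
  have hK3' : AEMeasurable (fun q : Z × Z => h q.2 ^ 2 * K q.1 q.2) (ν.prod ν) := hK3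
  calc ∫⁻ z, ∫⁻ z', h z * h z' * K z z' ∂ν ∂ν
      ≤ ∫⁻ z, ∫⁻ z', (1/2) * (h z ^ 2 * K z z' + h z' ^ 2 * K z z') ∂ν ∂ν := by
        refine lintegral_mono fun z => lintegral_mono fun z' => ?_
        show h z * h z' * K z z' ≤ (1/2) * (h z ^ 2 * K z z' + h z' ^ 2 * K z z')
        rw [← add_mul, ← mul_assoc]
        refine mul_le_mul_left ?_ _
        rw [one_div, mul_comm _ (_ + _), ← div_eq_mul_inv]
        exact amgm _ _
    _ = ∫⁻ q : Z × Z, (1/2) * (h q.1 ^ 2 * K q.1 q.2 + h q.2 ^ 2 * K q.1 q.2) ∂(ν.prod ν) := by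
        rw [lintegral_prod _ hK5]
    _ = (1/2) * ((∫⁻ z, ∫⁻ z', h z ^ 2 * K z z' ∂ν ∂ν) + ∫⁻ z, ∫⁻ z', h z' ^ 2 * K z z' ∂ν ∂ν) := by
        rw [lintegral_const_mul'' _ hK4, lintegral_add_left' hK2', lintegral_prod _ hK2',
          lintegral_prod _ hK3']
    _ = ∫⁻ z, ∫⁻ z', h z ^ 2 * K z z' ∂ν ∂ν := by
        rw [e2, ← two_mul, ← mul_assoc, one_div, ENNReal.inv_mul_cancel (by simp) (by simp), one_mul]
    _ ≤ _ := e1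

/-- `T T*` lemma. -/
lemma TT_bound {X Z : Type*} [MeasurableSpace X] [MeasurableSpace Z] (ξ : Measure X)
    [IsFiniteMeasure ξ] (ν : Measure Z) [SFinite ν]
    (e : X → Z → ℂ) (he : Measurable (Function.uncurry e)) (he1 : ∀ x z, ‖e x z‖ ≤ 1)
    (h : Z → ℂ) (hh : Integrable h ν) (K : Z → Z → ℝ≥0∞)
    (hK : Measurable (Function.uncurry K)) (hs : ∀ z z', K z z' = K z' z) (B : ℝ≥0∞)
    (hB : ∀ᵐ z ∂ν, ∫⁻ z', K z z' ∂ν ≤ B)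
    (hI : ∀ᵐ z ∂ν, ∀ᵐ z' ∂ν, ‖∫ x, e x z * (starRingEnd ℂ) (e x z') ∂ξ‖ₑ ≤ K z z') :
    ∫⁻ x, ‖∫ z, e x z * h z ∂ν‖ₑ ^ 2 ∂ξ ≤ B * ∫⁻ z, ‖h z‖ₑ ^ 2 ∂ν := by
  -- big product integrability
  have hbig : Integrable (fun q : X × (Z × Z) => (e q.1 q.2.1 * h q.2.1) * (starRingEnd ℂ) (e q.1 q.2.2 * h q.2.2))
      (ξ.prod (ν.prod ν)) := by
    have h1 : Integrable (fun q : Z × Z => h q.1 * (starRingEnd ℂ) (h q.2)) (ν.prod ν) :=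
      hh.mul_prod (by simpa using (Complex.conjCLE.toContinuousLinearMap.integrable_comp hh))
    have h2 : Integrable (fun q : X × (Z × Z) => (1:ℂ) * (h q.2.1 * (starRingEnd ℂ) (h q.2.2))) (ξ.prod (ν.prod ν)) :=
      (integrable_const (1:ℂ)).mul_prod h1
    have hm : Measurable (fun q : X × (Z × Z) => e q.1 q.2.1 * (starRingEnd ℂ) (e q.1 q.2.2)) := by
      have m1 : Measurable (fun q : X × (Z × Z) => e q.1 q.2.1) :=
        he.comp (measurable_fst.prodMk (measurable_fst.comp measurable_snd))
      have m2 : Measurable (fun q : X × (Z × Z) => e q.1 q.2.2) :=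
        he.comp (measurable_fst.prodMk (measurable_snd.comp measurable_snd))
      exact m1.mul (Complex.continuous_conj.measurable.comp m2)
    refine (h2.bdd_mul (c := 1) hm.aestronglyMeasurable (ae_of_all _ fun q => ?_)).congr (ae_of_all _ fun q => ?_)
    · rw [norm_mul, RCLike.norm_conj]
      exact mul_le_one₀ (he1 _ _) (norm_nonneg _) (he1 _ _)
    · simp only [map_mul]; ring
  have key : ∫ x, ((‖∫ z, e x z * h z ∂ν‖ ^ 2 : ℝ) : ℂ) ∂ξ
      = ∫ z, ∫ z', h z * (starRingEnd ℂ) (h z') * ∫ x, e x z * (starRingEnd ℂ) (e x z') ∂ξ ∂ν ∂ν := by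
    calc ∫ x, ((‖∫ z, e x z * h z ∂ν‖ ^ 2 : ℝ) : ℂ) ∂ξ
        = ∫ x, ∫ q : Z × Z, (e x q.1 * h q.1) * (starRingEnd ℂ) (e x q.2 * h q.2) ∂(ν.prod ν) ∂ξ := by
          refine integral_congr_ae (ae_of_all _ fun x => ?_)
          simp only
          rw [integral_prod_mul (fun z => e x z * h z) (fun z => (starRingEnd ℂ) (e x z * h z)),
            integral_conj, Complex.mul_conj, Complex.normSq_eq_norm_sq]
      _ = ∫ q : Z × Z, ∫ x, (e x q.1 * h q.1) * (starRingEnd ℂ) (e x q.2 * h q.2) ∂ξ ∂(ν.prod ν) :=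
          integral_integral_swap (f := fun x (q : Z × Z) => (e x q.1 * h q.1) * (starRingEnd ℂ) (e x q.2 * h q.2)) hbig
      _ = ∫ z, ∫ z', ∫ x, (e x z * h z) * (starRingEnd ℂ) (e x z' * h z') ∂ξ ∂ν ∂ν := by
          rw [integral_prod _ hbig.integral_prod_right]
      _ = _ := by
          refine integral_congr_ae (ae_of_all _ fun z => integral_congr_ae (ae_of_all _ fun z' => ?_))
          simp only
          rw [← integral_const_mul]
          refine integral_congr_ae (ae_of_all _ fun x => ?_)
          simp only [map_mul]; ring
  have hinteg : Integrable (fun x => ‖∫ z, e x z * h z ∂ν‖ ^ 2) ξ := by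
    refine Integrable.of_bound (C := (∫ z, ‖h z‖ ∂ν) ^ 2) ?_ (ae_of_all _ fun x => ?_)
    · have : AEStronglyMeasurable (fun q : X × Z => e q.1 q.2 * h q.2) (ξ.prod ν) :=
        he.aestronglyMeasurable.mul hh.1.comp_snd
      exact (this.integral_prod_right'.norm.pow 2)
    · rw [norm_pow, norm_norm]
      gcongr
      refine norm_integral_le_of_norm_le hh.norm (ae_of_all _ fun z => ?_)
      rw [norm_mul]
      exact mul_le_of_le_one_left (norm_nonneg _) (he1 _ _)
  calc ∫⁻ x, ‖∫ z, e x z * h z ∂ν‖ₑ ^ 2 ∂ξ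
      = ∫⁻ x, ‖((‖∫ z, e x z * h z ∂ν‖ ^ 2 : ℝ) : ℂ)‖ₑ ∂ξ := by
        congr 1; ext x
        rw [← ofReal_norm_eq_enorm, ← ofReal_norm_eq_enorm, Complex.norm_real, ← ENNReal.ofReal_pow (norm_nonneg _),
          Real.norm_of_nonneg (by positivity)]
    _ = ENNReal.ofReal (∫ x, ‖∫ z, e x z * h z ∂ν‖ ^ 2 ∂ξ) := by
        rw [ofReal_integral_eq_lintegral_ofReal hinteg (ae_of_all _ fun x => by positivity)]
        congr 1; ext x
        rw [← ofReal_norm_eq_enorm]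
        simp
    _ = ‖∫ x, ((‖∫ z, e x z * h z ∂ν‖ ^ 2 : ℝ) : ℂ) ∂ξ‖ₑ := by
        rw [integral_complex_ofReal, ← ofReal_norm_eq_enorm, Complex.norm_real, Real.norm_of_nonneg]
        exact integral_nonneg fun x => by positivity
    _ ≤ ∫⁻ z, ∫⁻ z', ‖h z‖ₑ * ‖h z'‖ₑ * K z z' ∂ν ∂ν := by
        rw [key]
        refine (enorm_integral_le_lintegral_enorm _).trans ?_
        apply lintegral_mono_ae
        filter_upwards [hI] with z hz
        refine (enorm_integral_le_lintegral_enorm _).trans ?_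
        apply lintegral_mono_ae
        filter_upwards [hz] with z' hz'
        rw [enorm_mul, enorm_mul, RCLike.enorm_conj]
        gcongr
    _ ≤ _ := schur_bound ν _ hh.1.enorm K hK hs B hB


set_option linter.unusedVariables false
set_option linter.unusedSimpArgs false

lemma ibp1 {a b Λ : ℝ} (hab : a ≤ b) (hΛ : 0 < Λ) {ψ ψ1 w w1 χ χ1 : ℝ → ℝ}
    (hψ : ∀ x ∈ Icc a b, HasDerivAt ψ (ψ1 x) x) (hw : ∀ x ∈ Icc a b, HasDerivAt w (w1 x) x)
    (hχ : ∀ x ∈ Icc a b, HasDerivAt χ (χ1 x) x) (hww : ∀ x ∈ Icc a b, ψ1 x * w x = Λ)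
    (cw1 : ContinuousOn w1 (Icc a b)) (cχ1 : ContinuousOn χ1 (Icc a b))
    (ha : χ a = 0) (hb : χ b = 0) :
    ‖∫ x in a..b, Complex.exp (Complex.I * (ψ x : ℂ)) * (χ x : ℂ)‖ ≤
      Λ⁻¹ * ‖∫ x in a..b, Complex.exp (Complex.I * (ψ x : ℂ)) * ((χ1 x * w x + χ x * w1 x : ℝ) : ℂ)‖ := by
  have cψ : ContinuousOn ψ (Icc a b) := fun x hx => (hψ x hx).continuousAt.continuousWithinAt
  have cw : ContinuousOn w (Icc a b) := fun x hx => (hw x hx).continuousAt.continuousWithinAt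
  have cχ : ContinuousOn χ (Icc a b) := fun x hx => (hχ x hx).continuousAt.continuousWithinAt
  have hu : uIcc a b = Icc a b := uIcc_of_le hab
  have ce : ContinuousOn (fun x => Complex.exp (Complex.I * (ψ x : ℂ))) (Icc a b) := by fun_prop
  have i1 : IntervalIntegrable (fun x => Complex.exp (Complex.I * (ψ x : ℂ)) * (χ x : ℂ)) volume a b := by
    apply ContinuousOn.intervalIntegrable
    rw [hu]; fun_prop
  have i2 : IntervalIntegrable (fun x => Complex.exp (Complex.I * (ψ x : ℂ)) * ((χ1 x * w x + χ x * w1 x : ℝ) : ℂ)) volume a b := by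
    apply ContinuousOn.intervalIntegrable
    rw [hu]; fun_prop
  have hd : ∀ x ∈ uIcc a b, HasDerivAt (fun x => Complex.exp (Complex.I * (ψ x : ℂ)) * ((χ x * w x : ℝ) : ℂ))
      (Complex.I * Λ * (Complex.exp (Complex.I * (ψ x : ℂ)) * (χ x : ℂ)) +
        Complex.exp (Complex.I * (ψ x : ℂ)) * ((χ1 x * w x + χ x * w1 x : ℝ) : ℂ)) x := by
    intro x hx
    rw [hu] at hx
    have h1 := (((hψ x hx).ofReal_comp).const_mul Complex.I).cexp
    have h2 := ((hχ x hx).mul (hw x hx)).ofReal_comp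
    refine HasDerivAt.congr_deriv (h1.mul h2) ?_
    have : (Λ : ℂ) = ψ1 x * w x := by exact_mod_cast (hww x hx).symm
    rw [this]
    push_cast [Pi.mul_apply]
    ring
  have hinteg := intervalIntegral.integral_eq_sub_of_hasDerivAt hd ((i1.const_mul _).add i2)
  rw [intervalIntegral.integral_add (i1.const_mul _) i2, intervalIntegral.integral_const_mul] at hinteg
  simp only [ha, hb, zero_mul, Complex.ofReal_zero, mul_zero, sub_zero] at hinteg
  have h3 := eq_neg_of_add_eq_zero_left hinteg
  have h4 := congrArg norm h3
  rw [norm_neg, norm_mul, norm_mul, Complex.norm_I, Complex.norm_real, Real.norm_of_nonneg hΛ.le, one_mul] at h4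
  rw [← h4, inv_mul_cancel_left₀ hΛ.ne']

lemma ibp3 {a b Λ W X : ℝ} (hab : a ≤ b) (hΛ : 0 < Λ) (hW : 0 ≤ W) (hX : 0 ≤ X)
    {ψ ψ1 w w1 w2 w3 χ χ1 χ2 χ3 : ℝ → ℝ}
    (hψ : ∀ x ∈ Icc a b, HasDerivAt ψ (ψ1 x) x) (hww : ∀ x ∈ Icc a b, ψ1 x * w x = Λ)
    (hw : ∀ x ∈ Icc a b, HasDerivAt w (w1 x) x)
    (hw1 : ∀ x ∈ Icc a b, HasDerivAt w1 (w2 x) x)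
    (hw2 : ∀ x ∈ Icc a b, HasDerivAt w2 (w3 x) x) (cw3 : ContinuousOn w3 (Icc a b))
    (hχ : ∀ x ∈ Icc a b, HasDerivAt χ (χ1 x) x)
    (hχ1 : ∀ x ∈ Icc a b, HasDerivAt χ1 (χ2 x) x)
    (hχ2 : ∀ x ∈ Icc a b, HasDerivAt χ2 (χ3 x) x) (cχ3 : ContinuousOn χ3 (Icc a b))
    (ha : χ a = 0) (hb : χ b = 0) (ha1 : χ1 a = 0) (hb1 : χ1 b = 0) (ha2 : χ2 a = 0) (hb2 : χ2 b = 0)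
    (bw : ∀ x ∈ Icc a b, |w x| ≤ W ∧ |w1 x| ≤ W ∧ |w2 x| ≤ W ∧ |w3 x| ≤ W)
    (bχ : ∀ x ∈ Icc a b, |χ x| ≤ X ∧ |χ1 x| ≤ X ∧ |χ2 x| ≤ X ∧ |χ3 x| ≤ X) :
    ‖∫ x in a..b, Complex.exp (Complex.I * (ψ x : ℂ)) * (χ x : ℂ)‖ ≤
      Λ⁻¹ ^ 3 * (24 * X * W ^ 3 * (b - a)) := by
  have cw1 : ContinuousOn w1 (Icc a b) := fun x hx => (hw1 x hx).continuousAt.continuousWithinAt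
  have cw2 : ContinuousOn w2 (Icc a b) := fun x hx => (hw2 x hx).continuousAt.continuousWithinAt
  have cw : ContinuousOn w (Icc a b) := fun x hx => (hw x hx).continuousAt.continuousWithinAt
  have cχ : ContinuousOn χ (Icc a b) := fun x hx => (hχ x hx).continuousAt.continuousWithinAt
  have cχ1 : ContinuousOn χ1 (Icc a b) := fun x hx => (hχ1 x hx).continuousAt.continuousWithinAt
  have cχ2 : ContinuousOn χ2 (Icc a b) := fun x hx => (hχ2 x hx).continuousAt.continuousWithinAt
  have s1 := ibp1 hab hΛ hψ hw hχ hww cw1 cχ1 ha hb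
  have hA : ∀ x ∈ Icc a b, HasDerivAt (fun x => χ1 x * w x + χ x * w1 x)
      (χ2 x * w x + 2 * (χ1 x * w1 x) + χ x * w2 x) x := by
    intro x hx
    refine HasDerivAt.congr_deriv (((hχ1 x hx).mul (hw x hx)).add ((hχ x hx).mul (hw1 x hx))) ?_
    ring
  have hA1 : ∀ x ∈ Icc a b, HasDerivAt (fun x => χ2 x * w x + 2 * (χ1 x * w1 x) + χ x * w2 x)
      (χ3 x * w x + 3 * (χ2 x * w1 x) + 3 * (χ1 x * w2 x) + χ x * w3 x) x := by
    intro x hx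
    refine HasDerivAt.congr_deriv ((((hχ2 x hx).mul (hw x hx)).add (((hχ1 x hx).mul (hw1 x hx)).const_mul 2)).add
      ((hχ x hx).mul (hw2 x hx))) ?_
    ring
  have s2 := ibp1 hab hΛ hψ hw hA hww cw1 (by fun_prop) (by simp [ha, ha1]) (by simp [hb, hb1])
  have hB : ∀ x ∈ Icc a b, HasDerivAt (fun x => (χ2 x * w x + 2 * (χ1 x * w1 x) + χ x * w2 x) * w x +
      (χ1 x * w x + χ x * w1 x) * w1 x)
      ((χ3 x * w x + 3 * (χ2 x * w1 x) + 3 * (χ1 x * w2 x) + χ x * w3 x) * w x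
        + 2 * ((χ2 x * w x + 2 * (χ1 x * w1 x) + χ x * w2 x) * w1 x)
        + (χ1 x * w x + χ x * w1 x) * w2 x) x := by
    intro x hx
    refine HasDerivAt.congr_deriv (((hA1 x hx).mul (hw x hx)).add ((hA x hx).mul (hw1 x hx))) ?_
    ring
  have s3 := ibp1 hab hΛ hψ hw hB hww cw1 (by fun_prop) (by simp [ha, ha1, ha2]) (by simp [hb, hb1, hb2])
  have hΛi : 0 ≤ Λ⁻¹ := by positivity
  refine s1.trans ?_
  rw [pow_succ', mul_assoc]
  refine mul_le_mul_of_nonneg_left (s2.trans ?_) hΛi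
  rw [pow_succ', mul_assoc]
  refine mul_le_mul_of_nonneg_left (s3.trans ?_) hΛi
  rw [pow_one]
  refine mul_le_mul_of_nonneg_left ?_ hΛi
  have hba : |b - a| = b - a := abs_of_nonneg (by linarith)
  rw [← hba]
  refine intervalIntegral.norm_integral_le_of_norm_le_const fun x hx => ?_
  rw [uIoc_of_le hab] at hx
  have hx' : x ∈ Icc a b := ⟨hx.1.le, hx.2⟩
  obtain ⟨w0, w1', w2', w3'⟩ := bw x hx'
  obtain ⟨x0, x1, x2, x3⟩ := bχ x hx'
  rw [norm_mul, mul_comm Complex.I, Complex.norm_exp_ofReal_mul_I, one_mul, Complex.norm_real, Real.norm_eq_abs]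
  have P : ∀ {p q A B : ℝ}, |p| ≤ A → |q| ≤ B → |p * q| ≤ A * B := by
    intro p q A B hp hq
    rw [abs_mul]
    exact mul_le_mul hp hq (abs_nonneg _) ((abs_nonneg _).trans hp)
  have S : ∀ {p q A B : ℝ}, |p| ≤ A → |q| ≤ B → |p + q| ≤ A + B := fun hp hq =>
    (abs_add_le _ _).trans (add_le_add hp hq)
  have M : ∀ {p A : ℝ} (k : ℝ), 0 ≤ k → |p| ≤ A → |k * p| ≤ k * A := by
    intro p A k hk hp
    rw [abs_mul, abs_of_nonneg hk]
    exact mul_le_mul_of_nonneg_left hp hk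
  have a0 := S (P x1 w0) (P x0 w1')
  have a1 := S (S (P x2 w0) (M 2 (by norm_num) (P x1 w1'))) (P x0 w2')
  have a2 := S (S (S (P x3 w0) (M 3 (by norm_num) (P x2 w1'))) (M 3 (by norm_num) (P x1 w2'))) (P x0 w3')
  have b0 := S (P a1 w0) (P a0 w1')
  have b1 := S (S (P a2 w0) (M 2 (by norm_num) (P a1 w1'))) (P a0 w2')
  have c0 := S (P b1 w0) (P b0 w1')
  refine c0.trans (le_of_eq ?_)
  ring

/-- bound for the inverse of a function -/
def WK (c K : ℝ) : ℝ := 1 / c + K / c ^ 2 + (K / c ^ 2 + 2 * K ^ 2 / c ^ 3) +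
  (K / c ^ 2 + 6 * K ^ 2 / c ^ 3 + 6 * K ^ 3 / c ^ 4)

lemma ibp3q {a b Λ c K X : ℝ} (hab : a ≤ b) (hΛ : 0 < Λ) (hc : 0 < c) (hK : 0 ≤ K) (hX : 0 ≤ X)
    {ψ q q1 q2 q3 χ χ1 χ2 χ3 : ℝ → ℝ}
    (hψ : ∀ x ∈ Icc a b, HasDerivAt ψ (Λ * q x) x)
    (hq : ∀ x ∈ Icc a b, HasDerivAt q (q1 x) x)
    (hq1 : ∀ x ∈ Icc a b, HasDerivAt q1 (q2 x) x)
    (hq2 : ∀ x ∈ Icc a b, HasDerivAt q2 (q3 x) x) (cq3 : ContinuousOn q3 (Icc a b))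
    (hχ : ∀ x ∈ Icc a b, HasDerivAt χ (χ1 x) x)
    (hχ1 : ∀ x ∈ Icc a b, HasDerivAt χ1 (χ2 x) x)
    (hχ2 : ∀ x ∈ Icc a b, HasDerivAt χ2 (χ3 x) x) (cχ3 : ContinuousOn χ3 (Icc a b))
    (ha : χ a = 0) (hb : χ b = 0) (ha1 : χ1 a = 0) (hb1 : χ1 b = 0) (ha2 : χ2 a = 0) (hb2 : χ2 b = 0)
    (bq : ∀ x ∈ Icc a b, c ≤ |q x| ∧ |q1 x| ≤ K ∧ |q2 x| ≤ K ∧ |q3 x| ≤ K)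
    (bχ : ∀ x ∈ Icc a b, |χ x| ≤ X ∧ |χ1 x| ≤ X ∧ |χ2 x| ≤ X ∧ |χ3 x| ≤ X) :
    ‖∫ x in a..b, Complex.exp (Complex.I * (ψ x : ℂ)) * (χ x : ℂ)‖ ≤
      Λ⁻¹ ^ 3 * (24 * X * WK c K ^ 3 * (b - a)) := by
  have hq0 : ∀ x ∈ Icc a b, q x ≠ 0 := fun x hx h0 => by
    have := (bq x hx).1
    rw [h0, abs_zero] at this
    linarith
  have cq : ContinuousOn q (Icc a b) := fun x hx => (hq x hx).continuousAt.continuousWithinAt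
  have cq1 : ContinuousOn q1 (Icc a b) := fun x hx => (hq1 x hx).continuousAt.continuousWithinAt
  have cq2 : ContinuousOn q2 (Icc a b) := fun x hx => (hq2 x hx).continuousAt.continuousWithinAt
  have hW : 0 ≤ WK c K := by unfold WK; positivity
  refine ibp3 (ψ1 := fun x => Λ * q x) (w := fun x => (q x)⁻¹) (w1 := fun x => - q1 x / q x ^ 2)
    (w2 := fun x => - q2 x / q x ^ 2 + 2 * q1 x ^ 2 / q x ^ 3)
    (w3 := fun x => - q3 x / q x ^ 2 + 6 * q1 x * q2 x / q x ^ 3 - 6 * q1 x ^ 3 / q x ^ 4)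
    hab hΛ hW hX hψ ?_ ?_ ?_ ?_ ?_ hχ hχ1 hχ2 cχ3 ha hb ha1 hb1 ha2 hb2 ?_ bχ
  · intro x hx
    try simp only
    rw [mul_assoc, mul_inv_cancel₀ (hq0 x hx), mul_one]
  · intro x hx
    exact (hq x hx).inv (hq0 x hx)
  · intro x hx
    have h0 := hq0 x hx
    refine HasDerivAt.congr_deriv ((hq1 x hx).neg.div ((hq x hx).pow 2) (pow_ne_zero 2 h0)) ?_
    try simp only [Pi.pow_apply, Pi.neg_apply]
    field_simp
    ring
  · intro x hx
    have h0 := hq0 x hx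
    refine HasDerivAt.congr_deriv (((hq2 x hx).neg.div ((hq x hx).pow 2) (pow_ne_zero 2 h0)).add
      ((((hq1 x hx).pow 2).const_mul 2).div ((hq x hx).pow 3) (pow_ne_zero 3 h0))) ?_
    try simp only [Pi.pow_apply, Pi.neg_apply]
    field_simp
    ring
  · have n2 : ∀ x ∈ Icc a b, q x ^ 2 ≠ 0 := fun x hx => pow_ne_zero _ (hq0 x hx)
    have n3 : ∀ x ∈ Icc a b, q x ^ 3 ≠ 0 := fun x hx => pow_ne_zero _ (hq0 x hx)
    have n4 : ∀ x ∈ Icc a b, q x ^ 4 ≠ 0 := fun x hx => pow_ne_zero _ (hq0 x hx)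
    exact ((cq3.neg.div (cq.pow 2) n2).add (((cq1.const_mul 6).mul cq2).div (cq.pow 3) n3)).sub
      (((cq1.pow 3).const_mul 6).div (cq.pow 4) n4)
  · intro x hx
    obtain ⟨b0, b1, b2, b3⟩ := bq x hx
    have t : ∀ (n : ℕ) (p A : ℝ), |p| ≤ A → |p / q x ^ n| ≤ A / c ^ n := by
      intro n p A hp
      rw [abs_div, abs_pow]
      exact div_le_div₀ ((abs_nonneg _).trans hp) hp (by positivity) (by gcongr)
    have e0 : |(q x)⁻¹| ≤ 1 / c := by
      rw [abs_inv, ← one_div]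
      exact one_div_le_one_div_of_le hc b0
    have e1 : |- q1 x / q x ^ 2| ≤ K / c ^ 2 := t 2 _ _ (by rwa [abs_neg])
    have e2 : |- q2 x / q x ^ 2| ≤ K / c ^ 2 := t 2 _ _ (by rwa [abs_neg])
    have e3 : |- q3 x / q x ^ 2| ≤ K / c ^ 2 := t 2 _ _ (by rwa [abs_neg])
    have e4 : |2 * q1 x ^ 2 / q x ^ 3| ≤ 2 * K ^ 2 / c ^ 3 := t 3 _ _ (by
      rw [abs_mul, abs_pow, abs_two]; gcongr)
    have e5 : |6 * q1 x * q2 x / q x ^ 3| ≤ 6 * K ^ 2 / c ^ 3 := t 3 _ _ (by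
      rw [abs_mul, abs_mul, abs_of_nonneg (by norm_num : (0:ℝ) ≤ 6), sq, mul_assoc]; gcongr)
    have e6 : |6 * q1 x ^ 3 / q x ^ 4| ≤ 6 * K ^ 3 / c ^ 4 := t 4 _ _ (by
      rw [abs_mul, abs_pow, abs_of_nonneg (by norm_num : (0:ℝ) ≤ 6)]; gcongr)
    have p1 : 0 ≤ 1 / c := by positivity
    have p2 : 0 ≤ K / c ^ 2 := by positivity
    have p3 : 0 ≤ 2 * K ^ 2 / c ^ 3 := by positivity
    have p4 : 0 ≤ 6 * K ^ 2 / c ^ 3 := by positivity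
    have p5 : 0 ≤ 6 * K ^ 3 / c ^ 4 := by positivity
    unfold WK
    refine ⟨by linarith, by linarith, ?_, ?_⟩
    · have := abs_add_le (- q2 x / q x ^ 2) (2 * q1 x ^ 2 / q x ^ 3)
      linarith
    · have h1 := abs_sub (- q3 x / q x ^ 2 + 6 * q1 x * q2 x / q x ^ 3) (6 * q1 x ^ 3 / q x ^ 4)
      have h2 := abs_add_le (- q3 x / q x ^ 2) (6 * q1 x * q2 x / q x ^ 3)
      linarith



structure Cutoff (a b : ℝ) where
  χ : ℝ → ℝ
  χ1 : ℝ → ℝ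
  χ2 : ℝ → ℝ
  χ3 : ℝ → ℝ
  X : ℝ
  hX : 0 ≤ X
  h0 : ∀ x, HasDerivAt χ (χ1 x) x
  h1 : ∀ x, HasDerivAt χ1 (χ2 x) x
  h2 : ∀ x, HasDerivAt χ2 (χ3 x) x
  c3 : Continuous χ3
  ha : χ a = 0
  hb : χ b = 0
  ha1 : χ1 a = 0
  hb1 : χ1 b = 0
  ha2 : χ2 a = 0
  hb2 : χ2 b = 0
  bd : ∀ x ∈ Icc a b, |χ x| ≤ X ∧ |χ1 x| ≤ X ∧ |χ2 x| ≤ X ∧ |χ3 x| ≤ X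
  le : ∀ x ∈ Icc a b, 0 ≤ χ x ∧ χ x ≤ 1
  pos : ∀ a' b', a < a' → b' < b → ∃ m > 0, ∀ x ∈ Icc a' b', m ≤ χ x

lemma Cutoff.cont {a b : ℝ} (χ : Cutoff a b) : Continuous χ.χ :=
  continuous_iff_continuousAt.2 fun x => (χ.h0 x).continuousAt

lemma exists_cutoff {a b : ℝ} (hab : a < b) : Nonempty (Cutoff a b) := by
  obtain ⟨t, ht⟩ : ∃ t : ℝ → ℝ, t = fun x => 4 * ((x - a) * (b - x)) / (b - a) ^ 2 := ⟨_, rfl⟩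
  obtain ⟨t1, ht1⟩ : ∃ t : ℝ → ℝ, t = fun x => 4 * ((b - x) - (x - a)) / (b - a) ^ 2 := ⟨_, rfl⟩
  obtain ⟨t2, ht2⟩ : ∃ t : ℝ, t = 4 * (-2) / (b - a) ^ 2 := ⟨_, rfl⟩
  have hba : 0 < b - a := by linarith
  have d0 : ∀ x, HasDerivAt t (t1 x) x := by
    intro x
    rw [ht, ht1]
    refine HasDerivAt.congr_deriv (((((hasDerivAt_id x).sub_const a).mul ((hasDerivAt_id x).const_sub b)).const_mul 4).div_const _) ?_
    simp; ring
  have d1 : ∀ x, HasDerivAt t1 t2 x := by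
    intro x
    rw [ht2, ht1]
    refine HasDerivAt.congr_deriv (((((hasDerivAt_id x).const_sub b).sub ((hasDerivAt_id x).sub_const a)).const_mul 4).div_const _) ?_
    ring
  have c0 : Continuous t := continuous_iff_continuousAt.2 fun x => (d0 x).continuousAt
  have c1 : Continuous t1 := continuous_iff_continuousAt.2 fun x => (d1 x).continuousAt
  have ta : t a = 0 := by rw [ht]; simp
  have tb : t b = 0 := by rw [ht]; simp
  let χ0 : ℝ → ℝ := fun x => t x ^ 3
  let χ1 : ℝ → ℝ := fun x => 3 * (t x ^ 2 * t1 x)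
  let χ2 : ℝ → ℝ := fun x => 6 * (t x * t1 x ^ 2) + 3 * t2 * t x ^ 2
  let χ3 : ℝ → ℝ := fun x => 6 * t1 x ^ 3 + 18 * t2 * (t x * t1 x)
  have e0 : Continuous χ0 := by fun_prop
  have e1 : Continuous χ1 := by fun_prop
  have e2 : Continuous χ2 := by fun_prop
  have e3 : Continuous χ3 := by fun_prop
  obtain ⟨X, hX⟩ := (isCompact_Icc (a := a) (b := b)).exists_bound_of_continuousOn
    (f := fun x => (χ0 x, χ1 x, χ2 x, χ3 x)) (by fun_prop)
  refine ⟨⟨χ0, χ1, χ2, χ3, X, ?_, ?_, ?_, ?_, e3, ?_, ?_, ?_, ?_, ?_, ?_, ?_, ?_, ?_⟩⟩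
  · exact (norm_nonneg _).trans (hX a ⟨le_rfl, hab.le⟩)
  · intro x
    refine HasDerivAt.congr_deriv ((d0 x).pow 3) ?_
    simp [χ1]; ring
  · intro x
    refine HasDerivAt.congr_deriv ((((d0 x).pow 2).mul (d1 x)).const_mul 3) ?_
    simp [χ2]; ring
  · intro x
    refine HasDerivAt.congr_deriv ((((d0 x).mul ((d1 x).pow 2)).const_mul 6).add (((d0 x).pow 2).const_mul (3*t2))) ?_
    simp [χ3]; ring
  · simp [χ0, ta]
  · simp [χ0, tb]
  · simp [χ1, ta]
  · simp [χ1, tb]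
  · simp [χ2, ta]
  · simp [χ2, tb]
  · intro x hx
    have := hX x hx
    simp only [Prod.norm_def, sup_le_iff, Real.norm_eq_abs] at this
    exact ⟨this.1, this.2.1, this.2.2.1, this.2.2.2⟩
  · intro x hx
    have h0 : 0 ≤ t x := by
      rw [ht]
      have := mul_nonneg (sub_nonneg.2 hx.1) (sub_nonneg.2 hx.2)
      positivity
    have h1 : t x ≤ 1 := by
      rw [ht]
      simp only
      rw [div_le_one (by positivity)]
      nlinarith [sq_nonneg ((x - a) - (b - x))]
    exact ⟨by positivity, pow_le_one₀ h0 h1⟩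
  · intro a' b' h1 h2
    refine ⟨(4 * ((a' - a) * (b - b')) / (b - a) ^ 2) ^ 3, ?_, ?_⟩
    · have := mul_pos (sub_pos.2 h1) (sub_pos.2 h2)
      positivity
    · intro x hx
      simp only [χ0, ht]
      have := mul_pos (sub_pos.2 h1) (sub_pos.2 h2)
      have h3 : (a' - a) * (b - b') ≤ (x - a) * (b - x) :=
        mul_le_mul (by linarith [hx.1]) (by linarith [hx.2]) (by linarith) (by linarith [hx.1])
      gcongr

/-- second difference bounds: upper -/
lemma second_diff {F G H : ℝ → ℝ} {J : Set ℝ} (hJ : Convex ℝ J)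
    (hF : ∀ t ∈ J, HasDerivAt F (G t) t) (hG : ∀ t ∈ J, HasDerivAt G (H t) t)
    {y d y' d' : ℝ} (h1 : y ∈ J) (h2 : y + d ∈ J) (h3 : y' ∈ J) (h4 : y' + d' ∈ J) (h5 : y + d' ∈ J) :
    ∃ s ∈ J, ∃ t ∈ J, F (y + d) - F y - F (y' + d') + F y' = (d - d') * G s + (y - y') * d' * H t := by
  have mvt : ∀ (f f' : ℝ → ℝ), (∀ t ∈ J, HasDerivAt f (f' t) t) → ∀ p ∈ J, ∀ q ∈ J,
      ∃ s ∈ J, f q - f p = (q - p) * f' s := by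
    intro f f' hf
    have main : ∀ p ∈ J, ∀ q ∈ J, p < q → ∃ s ∈ J, f q - f p = (q - p) * f' s := by
      intro p hp q hq hpq
      have hsub : Icc p q ⊆ J := hJ.ordConnected.out hp hq
      obtain ⟨s, hs, hs'⟩ := exists_hasDerivAt_eq_slope f f' hpq
        (fun t ht => (hf t (hsub ht)).continuousAt.continuousWithinAt)
        (fun t ht => hf t (hsub ⟨ht.1.le, ht.2.le⟩))
      refine ⟨s, hsub ⟨hs.1.le, hs.2.le⟩, ?_⟩
      rw [hs', mul_div_cancel₀]
      linarith
    intro p hp q hq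
    rcases lt_trichotomy p q with h | h | h
    · exact main p hp q hq h
    · exact ⟨p, hp, by simp [h]⟩
    · obtain ⟨s, hs, h'⟩ := main q hq p hp h
      exact ⟨s, hs, by linarith⟩
  obtain ⟨s, hs, hs'⟩ := mvt F G hF _ h5 _ h2
  -- function h(t) = F (t+d') - F t on J ∩ (J - d')
  have hJ2 : Convex ℝ (J ∩ {t | t + d' ∈ J}) := by
    refine hJ.inter ?_
    have := hJ.translate_preimage_right d'
    simpa [preimage, add_comm] using this
  have mvt2 : ∃ t ∈ J, (F (y + d') - F y) - (F (y' + d') - F y') = (y - y') * (G (t + d') - G t) ∧ t + d' ∈ J := by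
    have main : ∀ p q, p ∈ J → q ∈ J → p + d' ∈ J → q + d' ∈ J → p < q →
        ∃ t ∈ J, (F (q + d') - F q) - (F (p + d') - F p) = (q - p) * (G (t + d') - G t) ∧ t + d' ∈ J := by
      intro p q hp hq hp' hq' hpq
      have hsub : Icc p q ⊆ J := hJ.ordConnected.out hp hq
      have hsub2 : ∀ t ∈ Icc p q, t + d' ∈ J := fun t ht =>
        hJ.ordConnected.out hp' hq' ⟨by linarith [ht.1], by linarith [ht.2]⟩
      have hd : ∀ t ∈ Icc p q, HasDerivAt (fun t => F (t + d') - F t) (G (t + d') - G t) t := fun t ht =>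
        ((hF _ (hsub2 t ht)).comp_add_const t d').sub (hF t (hsub ht))
      obtain ⟨t, ht, ht'⟩ := exists_hasDerivAt_eq_slope (fun t => F (t + d') - F t) (fun t => G (t + d') - G t) hpq
        (fun t ht => (hd t ht).continuousAt.continuousWithinAt)
        (fun t ht => hd t ⟨ht.1.le, ht.2.le⟩)
      refine ⟨t, hsub ⟨ht.1.le, ht.2.le⟩, ?_, hsub2 t ⟨ht.1.le, ht.2.le⟩⟩
      rw [ht', mul_div_cancel₀]
      linarith
    rcases lt_trichotomy y y' with h | h | h
    · obtain ⟨t, ht, h', h''⟩ := main y y' h1 h3 h5 h4 h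
      exact ⟨t, ht, by linarith, h''⟩
    · subst h
      exact ⟨y, h1, by simp, h5⟩
    · exact main y' y h3 h1 h4 h5 h
  obtain ⟨t, ht, ht', ht''⟩ := mvt2
  obtain ⟨τ, hτ, hτ'⟩ := mvt G H hG _ ht _ ht''
  refine ⟨s, hs, τ, hτ, ?_⟩
  rw [hτ'] at ht'
  have e1 : y + d - (y + d') = d - d' := by ring
  have e2 : t + d' - t = d' := by ring
  rw [e1] at hs'
  rw [e2] at ht'
  linarith

structure DirData (a b : ℝ) (J : Set ℝ) (K μ : ℝ) (P : ℝ → ℝ → ℝ) (κ : ℝ → ℝ)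
    (F G H : ℕ → ℝ → ℝ → ℝ) : Prop where
  hP : ∀ x ∈ Icc a b, ∀ t ∈ J, HasDerivAt (fun x => P x t) (κ x + μ * F 0 x t) x
  hx : ∀ k ≤ 2, ∀ x ∈ Icc a b, ∀ t ∈ J, HasDerivAt (fun x => F k x t) (F (k + 1) x t) x
  c3 : ∀ t ∈ J, ContinuousOn (fun x => F 3 x t) (Icc a b)
  hF : ∀ k ≤ 3, ∀ x ∈ Icc a b, ∀ t ∈ J, HasDerivAt (fun t => F k x t) (G k x t) t
  hG : ∀ k ≤ 3, ∀ x ∈ Icc a b, ∀ t ∈ J, HasDerivAt (fun t => G k x t) (H k x t) t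
  bG : ∀ k ≤ 3, ∀ x ∈ Icc a b, ∀ t ∈ J, |G k x t| ≤ K
  bH : ∀ k ≤ 3, ∀ x ∈ Icc a b, ∀ t ∈ J, |H k x t| ≤ K

lemma DirData.decay {a b : ℝ} {J : Set ℝ} {K μ : ℝ} {P : ℝ → ℝ → ℝ} {κ : ℝ → ℝ}
    {F G H : ℕ → ℝ → ℝ → ℝ} (hD : DirData a b J K μ P κ F G H) (hJ : Convex ℝ J) (hab : a ≤ b)
    (χ : Cutoff a b) (hμ : 0 < μ) (hK : 0 ≤ K) {M : ℝ} (hM : 0 < M)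
    {y d y' d' : ℝ} (h1 : y ∈ J) (h2 : y + d ∈ J) (h3 : y' ∈ J) (h4 : y' + d' ∈ J) (h5 : y + d' ∈ J)
    {D c : ℝ} (hDD : D = |d - d'| + |y - y'| * |d'|) (hD0 : 0 < D) (hc : 0 < c)
    (hlow : ∀ x ∈ Icc a b, c * D ≤ |F 0 x (y + d) - F 0 x y - F 0 x (y' + d') + F 0 x y'|) :
    ‖∫ x in a..b, Complex.exp (Complex.I * ((M * (P x (y + d) - P x y - P x (y' + d') + P x y') : ℝ) : ℂ)) * (χ.χ x : ℂ)‖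
      ≤ (M * μ * D)⁻¹ ^ 3 * (24 * χ.X * WK c K ^ 3 * (b - a)) := by
  obtain ⟨q, hq⟩ : ∃ q : ℕ → ℝ → ℝ, q = fun k x => (F k x (y + d) - F k x y - F k x (y' + d') + F k x y') / D := ⟨_, rfl⟩
  have hqd : ∀ k ≤ 2, ∀ x ∈ Icc a b, HasDerivAt (q k) (q (k+1) x) x := by
    intro k hk x hx
    rw [hq]
    exact ((((hD.hx k hk x hx _ h2).sub (hD.hx k hk x hx _ h1)).sub (hD.hx k hk x hx _ h4)).add (hD.hx k hk x hx _ h3)).div_const D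
  have hqb : ∀ k ≤ 3, ∀ x ∈ Icc a b, |q k x| ≤ K := by
    intro k hk x hx
    obtain ⟨s, hs, t, ht, e⟩ := second_diff hJ (hD.hF k hk x hx) (hD.hG k hk x hx) h1 h2 h3 h4 h5
    simp only [hq]
    rw [abs_div, abs_of_pos hD0, div_le_iff₀ hD0, e, hDD]
    refine (abs_add_le _ _).trans ?_
    rw [abs_mul, abs_mul, abs_mul, mul_add, mul_comm K, mul_comm K]
    gcongr
    · exact hD.bG k hk x hx s hs
    · exact hD.bH k hk x hx t ht
  refine ibp3q (q := q 0) (q1 := q 1) (q2 := q 2) (q3 := q 3) (χ1 := χ.χ1) (χ2 := χ.χ2) (χ3 := χ.χ3) (c := c) (K := K) hab (by positivity) hc hK χ.hX ?_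
    (hqd 0 (by norm_num)) (hqd 1 (by norm_num)) (hqd 2 (by norm_num)) ?_ (fun x _ => χ.h0 x)
    (fun x _ => χ.h1 x) (fun x _ => χ.h2 x) χ.c3.continuousOn χ.ha χ.hb χ.ha1 χ.hb1 χ.ha2 χ.hb2 ?_ χ.bd
  · intro x hx
    refine HasDerivAt.congr_deriv (((((hD.hP x hx _ h2).sub (hD.hP x hx _ h1)).sub (hD.hP x hx _ h4)).add (hD.hP x hx _ h3)).const_mul M) ?_
    rw [hq]
    field_simp
    ring
  · rw [hq]
    exact ((((hD.c3 _ h2).sub (hD.c3 _ h1)).sub (hD.c3 _ h4)).add (hD.c3 _ h3)).div_const D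
  · intro x hx
    refine ⟨?_, hqb 1 (by norm_num) x hx, hqb 2 (by norm_num) x hx, hqb 3 (by norm_num) x hx⟩
    simp only [hq]
    rw [abs_div, abs_of_pos hD0, le_div_iff₀ hD0]
    exact hlow x hx

/-- lower bound, type 2 (first derivative dominates) and type 1 (second derivative dominates). -/
lemma low2 {F G H : ℝ → ℝ} {J : Set ℝ} (hJ : Convex ℝ J)
    (hF : ∀ t ∈ J, HasDerivAt F (G t) t) (hG : ∀ t ∈ J, HasDerivAt G (H t) t)
    {y d y' d' : ℝ} (h1 : y ∈ J) (h2 : y + d ∈ J) (h3 : y' ∈ J) (h4 : y' + d' ∈ J) (h5 : y + d' ∈ J)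
    {D c : ℝ} (hDD : D = |d - d'| + |y - y'| * |d'|) (hc : 0 < c)
    (hcase : |y - y'| * |d'| ≤ |d - d'|) (bG : ∀ t ∈ J, c ≤ |G t|) (bH : ∀ t ∈ J, |H t| ≤ c / 4) :
    c / 4 * D ≤ |F (y + d) - F y - F (y' + d') + F y'| := by
  obtain ⟨s, hs, t, ht, e⟩ := second_diff hJ hF hG h1 h2 h3 h4 h5
  rw [e, hDD]
  have g1 : |d - d'| * c ≤ |(d - d') * G s| := by
    rw [abs_mul]; exact mul_le_mul_of_nonneg_left (bG s hs) (abs_nonneg _)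
  have g2 : |(y - y') * d' * H t| ≤ |y - y'| * |d'| * (c / 4) := by
    rw [abs_mul, abs_mul]; exact mul_le_mul_of_nonneg_left (bH t ht) (by positivity)
  have g3 := abs_sub_abs_le_abs_add ((d - d') * G s) ((y - y') * d' * H t)
  have g4 := mul_le_mul_of_nonneg_left hcase hc.le
  have g5 := mul_nonneg hc.le (abs_nonneg (d - d'))
  have g6 := mul_nonneg hc.le (mul_nonneg (abs_nonneg (y - y')) (abs_nonneg d'))
  nlinarith only [g1, g2, g3, g4, g5, g6]

lemma low1 {F G H : ℝ → ℝ} {J : Set ℝ} (hJ : Convex ℝ J)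
    (hF : ∀ t ∈ J, HasDerivAt F (G t) t) (hG : ∀ t ∈ J, HasDerivAt G (H t) t)
    {y d y' d' : ℝ} (h1 : y ∈ J) (h2 : y + d ∈ J) (h3 : y' ∈ J) (h4 : y' + d' ∈ J) (h5 : y + d' ∈ J)
    {D c : ℝ} (hDD : D = |d - d'| + |y - y'| * |d'|) (hc : 0 < c)
    (hcase : |d - d'| ≤ |y - y'| * |d'|) (bG : ∀ t ∈ J, c ≤ |H t|) (bH : ∀ t ∈ J, |G t| ≤ c / 4) :
    c / 4 * D ≤ |F (y + d) - F y - F (y' + d') + F y'| := by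
  obtain ⟨s, hs, t, ht, e⟩ := second_diff hJ hF hG h1 h2 h3 h4 h5
  rw [e, hDD]
  have g1 : |(d - d') * G s| ≤ |d - d'| * (c / 4) := by
    rw [abs_mul]; exact mul_le_mul_of_nonneg_left (bH s hs) (abs_nonneg _)
  have g2 : |y - y'| * |d'| * c ≤ |(y - y') * d' * H t| := by
    rw [abs_mul, abs_mul]; exact mul_le_mul_of_nonneg_left (bG t ht) (by positivity)
  have g3 := abs_sub_abs_le_abs_add ((y - y') * d' * H t) ((d - d') * G s)
  rw [add_comm ((y - y') * d' * H t)] at g3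
  have g4 := mul_le_mul_of_nonneg_left hcase hc.le
  have g5 := mul_nonneg hc.le (abs_nonneg (d - d'))
  have g6 := mul_nonneg hc.le (mul_nonneg (abs_nonneg (y - y')) (abs_nonneg d'))
  nlinarith only [g1, g2, g3, g4, g5, g6]



structure Chart (a₁ b₁ a₂ b₂ : ℝ) (J : Set ℝ) (c K μ : ℝ) (P : ℝ → ℝ → ℝ → ℝ) : Prop where
  cont : Continuous (fun q : ℝ × ℝ × ℝ => P q.1 q.2.1 q.2.2)
  dir1 : ∀ x₂ ∈ Icc a₂ b₂, ∃ (μ' : ℝ) (κ : ℝ → ℝ) (F G H : ℕ → ℝ → ℝ → ℝ), μ ≤ μ' ∧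
    DirData a₁ b₁ J K μ' (fun x t => P x x₂ t) κ F G H ∧
    (∀ x ∈ Icc a₁ b₁, ∀ t ∈ J, c ≤ |H 0 x t|) ∧ (∀ x ∈ Icc a₁ b₁, ∀ t ∈ J, |G 0 x t| ≤ c / 4)
  dir2 : ∀ x₁ ∈ Icc a₁ b₁, ∃ (μ' : ℝ) (κ : ℝ → ℝ) (F G H : ℕ → ℝ → ℝ → ℝ), μ ≤ μ' ∧
    DirData a₂ b₂ J K μ' (fun x t => P x₁ x t) κ F G H ∧
    (∀ x ∈ Icc a₂ b₂, ∀ t ∈ J, c ≤ |G 0 x t|) ∧ (∀ x ∈ Icc a₂ b₂, ∀ t ∈ J, |H 0 x t| ≤ c / 4)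

lemma Chart.kernel {a₁ b₁ a₂ b₂ : ℝ} {J : Set ℝ} {c K μ : ℝ} {P : ℝ → ℝ → ℝ → ℝ}
    (hC : Chart a₁ b₁ a₂ b₂ J c K μ P) (h1 : a₁ < b₁) (h2 : a₂ < b₂) (hJ : Convex ℝ J)
    (hc : 0 < c) (hK : 0 ≤ K) (hμ : 0 < μ) (χ₁ : Cutoff a₁ b₁) (χ₂ : Cutoff a₂ b₂)
    {M : ℝ} (hM : 0 < M)
    {y d y' d' : ℝ} (g1 : y ∈ J) (g2 : y + d ∈ J) (g3 : y' ∈ J) (g4 : y' + d' ∈ J) (g5 : y + d' ∈ J)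
    {D : ℝ} (hDD : D = |d - d'| + |y - y'| * |d'|) (hD0 : 0 < D) :
    ‖∫ x : ℝ × ℝ, Complex.exp (Complex.I * ((M * (P x.1 x.2 (y + d) - P x.1 x.2 y - P x.1 x.2 (y' + d') + P x.1 x.2 y') : ℝ) : ℂ)) *
      ((χ₁.χ x.1 * χ₂.χ x.2 : ℝ) : ℂ) ∂((volume.restrict (Icc a₁ b₁)).prod (volume.restrict (Icc a₂ b₂)))‖
      ≤ (M * μ * D)⁻¹ ^ 3 * (24 * (χ₁.X + χ₂.X) * WK (c / 4) K ^ 3 * ((b₁ - a₁) * (b₂ - a₂))) := by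
  have hW : 0 ≤ WK (c / 4) K := by unfold WK; positivity
  have hcP := hC.cont
  have hX1 := χ₁.hX
  have hX2 := χ₂.hX
  have cχ1 := χ₁.cont
  have cχ2 := χ₂.cont
  have ct : ∀ t, Continuous (fun x : ℝ × ℝ => P x.1 x.2 t) := fun t =>
    hcP.comp (continuous_fst.prodMk (continuous_snd.prodMk continuous_const))
  have hcont : Continuous (fun x : ℝ × ℝ => Complex.exp (Complex.I * ((M * (P x.1 x.2 (y + d) - P x.1 x.2 y - P x.1 x.2 (y' + d') + P x.1 x.2 y') : ℝ) : ℂ)) *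
      ((χ₁.χ x.1 * χ₂.χ x.2 : ℝ) : ℂ)) := by
    have := ct (y+d)
    have := ct y
    have := ct (y'+d')
    have := ct y'
    fun_prop
  have hinteg : Integrable (fun x : ℝ × ℝ => Complex.exp (Complex.I * ((M * (P x.1 x.2 (y + d) - P x.1 x.2 y - P x.1 x.2 (y' + d') + P x.1 x.2 y') : ℝ) : ℂ)) *
      ((χ₁.χ x.1 * χ₂.χ x.2 : ℝ) : ℂ)) ((volume.restrict (Icc a₁ b₁)).prod (volume.restrict (Icc a₂ b₂))) := by
    rw [Measure.prod_restrict]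
    exact hcont.continuousOn.integrableOn_compact (isCompact_Icc.prod isCompact_Icc)
  have mono : ∀ μ' X L : ℝ, μ ≤ μ' → 0 ≤ X → X ≤ χ₁.X + χ₂.X → 0 ≤ L →
      (M * μ' * D)⁻¹ ^ 3 * (24 * X * WK (c / 4) K ^ 3 * L) ≤
      (M * μ * D)⁻¹ ^ 3 * (24 * (χ₁.X + χ₂.X) * WK (c / 4) K ^ 3 * L) := by
    intro μ' X L hμ' hX hX' hL
    have hμ0 : 0 < μ' := hμ.trans_le hμ'
    have : 0 ≤ (M * μ' * D)⁻¹ := by positivity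
    gcongr
  rcases le_total (|y - y'| * |d'|) |d - d'| with hcase | hcase
  · rw [integral_prod _ hinteg]
    have : ∀ x₁ ∈ Icc a₁ b₁, ‖∫ x₂, Complex.exp (Complex.I * ((M * (P x₁ x₂ (y + d) - P x₁ x₂ y - P x₁ x₂ (y' + d') + P x₁ x₂ y') : ℝ) : ℂ)) *
        ((χ₁.χ x₁ * χ₂.χ x₂ : ℝ) : ℂ) ∂(volume.restrict (Icc a₂ b₂))‖ ≤
        (M * μ * D)⁻¹ ^ 3 * (24 * (χ₁.X + χ₂.X) * WK (c / 4) K ^ 3 * (b₂ - a₂)) := by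
      intro x₁ hx₁
      obtain ⟨μ', κ, F, G, H, hμ', hDir, hl, hu⟩ := hC.dir2 x₁ hx₁
      have key := hDir.decay hJ h2.le χ₂ (hμ.trans_le hμ') hK hM g1 g2 g3 g4 g5 hDD hD0 (c := c / 4) (by positivity)
        (fun x hx => low2 hJ (hDir.hF 0 (by norm_num) x hx) (hDir.hG 0 (by norm_num) x hx) g1 g2 g3 g4 g5 hDD hc hcase
          (hl x hx) (hu x hx))
      rw [integral_Icc_eq_integral_Ioc, ← intervalIntegral.integral_of_le h2.le]
      have e : ∀ x₂, Complex.exp (Complex.I * ((M * (P x₁ x₂ (y + d) - P x₁ x₂ y - P x₁ x₂ (y' + d') + P x₁ x₂ y') : ℝ) : ℂ)) *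
        ((χ₁.χ x₁ * χ₂.χ x₂ : ℝ) : ℂ) = (χ₁.χ x₁ : ℂ) * (Complex.exp (Complex.I * ((M * (P x₁ x₂ (y + d) - P x₁ x₂ y - P x₁ x₂ (y' + d') + P x₁ x₂ y') : ℝ) : ℂ)) *
        (χ₂.χ x₂ : ℂ)) := by intro x₂; push_cast; ring
      simp_rw [e]
      rw [intervalIntegral.integral_const_mul, norm_mul, Complex.norm_real, Real.norm_of_nonneg (χ₁.le x₁ hx₁).1]
      refine (mul_le_of_le_one_left (norm_nonneg _) (χ₁.le x₁ hx₁).2).trans (key.trans ?_)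
      exact mono μ' _ _ hμ' hX2 (by linarith) (by linarith)
    have h3 := norm_setIntegral_le_of_norm_le_const (μ := volume) (s := Icc a₁ b₁) (by simp) this
    refine h3.trans (le_of_eq ?_)
    simp only [Measure.real, Real.volume_Icc]
    rw [ENNReal.toReal_ofReal (by linarith)]
    ring
  · rw [integral_prod_symm _ hinteg]
    have : ∀ x₂ ∈ Icc a₂ b₂, ‖∫ x₁, Complex.exp (Complex.I * ((M * (P x₁ x₂ (y + d) - P x₁ x₂ y - P x₁ x₂ (y' + d') + P x₁ x₂ y') : ℝ) : ℂ)) *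
        ((χ₁.χ x₁ * χ₂.χ x₂ : ℝ) : ℂ) ∂(volume.restrict (Icc a₁ b₁))‖ ≤
        (M * μ * D)⁻¹ ^ 3 * (24 * (χ₁.X + χ₂.X) * WK (c / 4) K ^ 3 * (b₁ - a₁)) := by
      intro x₂ hx₂
      obtain ⟨μ', κ, F, G, H, hμ', hDir, hl, hu⟩ := hC.dir1 x₂ hx₂
      have key := hDir.decay hJ h1.le χ₁ (hμ.trans_le hμ') hK hM g1 g2 g3 g4 g5 hDD hD0 (c := c / 4) (by positivity)
        (fun x hx => low1 hJ (hDir.hF 0 (by norm_num) x hx) (hDir.hG 0 (by norm_num) x hx) g1 g2 g3 g4 g5 hDD hc hcase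
          (hl x hx) (hu x hx))
      rw [integral_Icc_eq_integral_Ioc, ← intervalIntegral.integral_of_le h1.le]
      have e : ∀ x₁, Complex.exp (Complex.I * ((M * (P x₁ x₂ (y + d) - P x₁ x₂ y - P x₁ x₂ (y' + d') + P x₁ x₂ y') : ℝ) : ℂ)) *
        ((χ₁.χ x₁ * χ₂.χ x₂ : ℝ) : ℂ) = (χ₂.χ x₂ : ℂ) * (Complex.exp (Complex.I * ((M * (P x₁ x₂ (y + d) - P x₁ x₂ y - P x₁ x₂ (y' + d') + P x₁ x₂ y') : ℝ) : ℂ)) *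
        (χ₁.χ x₁ : ℂ)) := by intro x₂; push_cast; ring
      simp_rw [e]
      rw [intervalIntegral.integral_const_mul, norm_mul, Complex.norm_real, Real.norm_of_nonneg (χ₂.le x₂ hx₂).1]
      refine (mul_le_of_le_one_left (norm_nonneg _) (χ₂.le x₂ hx₂).2).trans (key.trans ?_)
      exact mono μ' _ _ hμ' hX1 (by linarith) (by linarith)
    have h3 := norm_setIntegral_le_of_norm_le_const (μ := volume) (s := Icc a₂ b₂) (by simp) this
    refine h3.trans (le_of_eq ?_)
    simp only [Measure.real, Real.volume_Icc]
    rw [ENNReal.toReal_ofReal (by linarith)]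
    ring

/-- the majorant -/
def k0 (t : ℝ) : ℝ := (1 + |t|) ^ (-(3 / 2) : ℝ)

lemma k0_pos (t : ℝ) : 0 < k0 t := by unfold k0; positivity

lemma k0_cont : Continuous k0 := by
  unfold k0
  refine Continuous.rpow_const (by fun_prop) fun x => Or.inl (by positivity)

lemma k0_int : Integrable k0 := by
  have := integrable_one_add_norm (E := ℝ) (μ := volume) (r := 3 / 2) (by simp; norm_num)
  exact this

lemma k0_scale {A : ℝ} (hA : 0 < A) (y : ℝ) :
    ∫⁻ t, ENNReal.ofReal (k0 (A * (y - t))) = ENNReal.ofReal A⁻¹ * ENNReal.ofReal (∫ t, k0 t) := by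
  have hi : Integrable (fun t => k0 (A * (y - t))) :=
    (k0_int.comp_mul_left' hA.ne').comp_sub_left y
  rw [← ofReal_integral_eq_lintegral_ofReal hi (ae_of_all _ fun t => (k0_pos _).le),
    integral_sub_left_eq_self (fun t => k0 (A * t)) volume y, Measure.integral_comp_mul_left,
    abs_of_pos (by positivity), smul_eq_mul, ENNReal.ofReal_mul (by positivity)]

lemma k0_bound {V C T s t N : ℝ} (hV : 0 ≤ V) (hC : 0 ≤ C) (hT : T = |s| + |t|)
    (h1 : N ≤ V) (h2 : 0 < T → N ≤ C * T⁻¹ ^ 3) : N ≤ (8 * V + 8 * C) * (k0 s * k0 t) := by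
  have hT0 : 0 ≤ T := by rw [hT]; positivity
  have hk : (1 + T)⁻¹ ^ 3 ≤ k0 s * k0 t := by
    unfold k0
    rw [← Real.mul_rpow (by positivity) (by positivity)]
    have e : (1 + T)⁻¹ ^ 3 = ((1 + T) ^ 2) ^ (-(3 / 2) : ℝ) := by
      rw [← Real.rpow_natCast (1 + T) 2, ← Real.rpow_mul (by positivity), inv_pow, ← Real.rpow_natCast (1 + T) 3,
        ← Real.rpow_neg (by positivity)]
      norm_num
    rw [e]
    apply Real.rpow_le_rpow_of_nonpos (by positivity) _ (by norm_num)
    rw [hT]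
    nlinarith [abs_nonneg s, abs_nonneg t, mul_nonneg (abs_nonneg s) (abs_nonneg t)]
  refine le_trans ?_ (mul_le_mul_of_nonneg_left hk (by positivity))
  rw [inv_pow, ← div_eq_mul_inv, le_div_iff₀ (by positivity)]
  rcases le_or_gt T 1 with h | h
  · have : (1 + T) ^ 3 ≤ 2 ^ 3 := by gcongr; linarith
    have h5 : N * (1 + T) ^ 3 ≤ V * (1 + T) ^ 3 := by gcongr
    nlinarith [mul_le_mul_of_nonneg_left this hV]
  · have h3 := h2 (by linarith)
    have h4 : (1 + T) ^ 3 ≤ (2 * T) ^ 3 := by gcongr; linarith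
    have h5 : N * (1 + T) ^ 3 ≤ C * T⁻¹ ^ 3 * (1 + T) ^ 3 := by gcongr
    have h6 : C * T⁻¹ ^ 3 * (1 + T) ^ 3 ≤ C * T⁻¹ ^ 3 * (2 * T) ^ 3 := by gcongr
    have h7 : C * T⁻¹ ^ 3 * (2 * T) ^ 3 = 8 * C := by field_simp; norm_num
    linarith



lemma ennreal_amgm (x y : ℝ≥0∞) : x * y ≤ (x ^ 2 + y ^ 2) / 2 := by
  rw [ENNReal.le_div_iff_mul_le (by simp) (by simp)]
  rcases eq_or_ne x ⊤ with rfl | hx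
  · simp
  rcases eq_or_ne y ⊤ with rfl | hy
  · simp
  lift x to ℝ≥0 using hx
  lift y to ℝ≥0 using hy
  norm_cast
  rw [← NNReal.coe_le_coe]
  push_cast
  nlinarith [sq_nonneg ((x:ℝ) - y)]

lemma h_integrable {g : ℝ → ℂ} (hg : Integrable g) :
    Integrable (fun z : ℝ × ℝ => g (z.2 + z.1) * (starRingEnd ℂ) (g z.2)) (volume.prod volume) := by
  have h1 : Integrable (fun q : ℝ × ℝ => (starRingEnd ℂ) (g q.1) * g q.2) (volume.prod volume) :=
    Integrable.mul_prod (f := fun t => (starRingEnd ℂ) (g t)) (by simpa using (Complex.conjCLE.toContinuousLinearMap.integrable_comp hg)) hg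
  have mp : MeasurePreserving (fun z : ℝ × ℝ => (z.2, z.2 + z.1)) (volume.prod volume) (volume.prod volume) :=
    (measurePreserving_prod_add (volume : Measure ℝ) (volume : Measure ℝ)).comp Measure.measurePreserving_swap
  have h2 := mp.integrable_comp_of_integrable h1
  refine h2.congr (ae_of_all _ fun z => ?_)
  simp [mul_comm]

lemma h_sq {g : ℝ → ℂ} (hgm : Measurable g) (S : Set ℝ) :
    ∫⁻ z, ‖g (z.2 + z.1) * (starRingEnd ℂ) (g z.2)‖ₑ ^ 2 ∂((volume.restrict S).prod volume) ≤
      volume S * ∫⁻ t, ‖g t‖ₑ ^ 4 := by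
  have hm : Measurable (fun z : ℝ × ℝ => ‖g (z.2 + z.1) * (starRingEnd ℂ) (g z.2)‖ₑ ^ 2) := by
    have m1 : Measurable (fun z : ℝ × ℝ => (starRingEnd ℂ) (g z.2)) :=
      Complex.continuous_conj.measurable.comp (hgm.comp measurable_snd)
    fun_prop
  rw [lintegral_prod _ hm.aemeasurable]
  have : ∀ d : ℝ, ∫⁻ y, ‖g (y + d) * (starRingEnd ℂ) (g y)‖ₑ ^ 2 ≤ ∫⁻ t, ‖g t‖ₑ ^ 4 := by
    intro d
    calc ∫⁻ y, ‖g (y + d) * (starRingEnd ℂ) (g y)‖ₑ ^ 2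
        ≤ ∫⁻ y, (‖g (y + d)‖ₑ ^ 4 + ‖g y‖ₑ ^ 4) / 2 := by
          refine lintegral_mono fun y => ?_
          rw [enorm_mul, RCLike.enorm_conj, mul_pow]
          refine (ennreal_amgm _ _).trans (le_of_eq ?_)
          rw [← pow_mul, ← pow_mul]
      _ = ((∫⁻ y, ‖g (y + d)‖ₑ ^ 4) + ∫⁻ y, ‖g y‖ₑ ^ 4) / 2 := by
          simp_rw [div_eq_mul_inv]
          rw [lintegral_mul_const _ (by fun_prop), lintegral_add_left (by fun_prop)]
      _ = ∫⁻ t, ‖g t‖ₑ ^ 4 := by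
          rw [lintegral_add_right_eq_self (fun y => ‖g y‖ₑ ^ 4) d, ENNReal.add_div, ENNReal.add_halves]
  calc _ ≤ ∫⁻ d in S, ∫⁻ t, ‖g t‖ₑ ^ 4 := lintegral_mono fun d => this d
    _ = _ := by rw [setLIntegral_const, mul_comm]

lemma chart_L2 {a₁ b₁ a₂ b₂ a₁' b₁' a₂' b₂' c K : ℝ} (h1 : a₁ < b₁) (h2 : a₂ < b₂)
    (i1 : a₁ < a₁') (i2 : b₁' < b₁) (i3 : a₂ < a₂') (i4 : b₂' < b₂) (hc : 0 < c) (hK : 0 ≤ K) :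
    ∃ C : ℝ≥0, ∀ (μ : ℝ) (J : Set ℝ) (P : ℝ → ℝ → ℝ → ℝ), 0 < μ → Convex ℝ J →
      Chart a₁ b₁ a₂ b₂ J c K μ P → ∀ (M α ℓ δ : ℝ), 0 < M → 0 < δ → δ ≤ ℓ → Icc α (α + 2 * ℓ) ⊆ J →
      ∀ g : ℝ → ℂ, Measurable g → Integrable g → (∀ t, t ∉ Icc α (α + ℓ) → g t = 0) →
      ∫⁻ x in Icc a₁' b₁' ×ˢ Icc a₂' b₂', ‖∫ d in Ioc (δ / 2) δ, ∫ y,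
        Complex.exp (Complex.I * ((M * (P x.1 x.2 (y + d) - P x.1 x.2 y) : ℝ) : ℂ)) *
          (g (y + d) * (starRingEnd ℂ) (g y))‖ₑ ^ 2 ≤
        C * ENNReal.ofReal ((M * μ)⁻¹ ^ 2) * ∫⁻ t, ‖g t‖ₑ ^ 4 := by
  obtain ⟨χ₁⟩ := exists_cutoff h1
  obtain ⟨χ₂⟩ := exists_cutoff h2
  obtain ⟨m₁, hm₁, hm₁'⟩ := χ₁.pos _ _ i1 i2
  obtain ⟨m₂, hm₂, hm₂'⟩ := χ₂.pos _ _ i3 i4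
  have hX1 := χ₁.hX
  have hX2 := χ₂.hX
  have cχ1 := χ₁.cont
  have cχ2 := χ₂.cont
  have hW : 0 ≤ WK (c / 4) K := by unfold WK; positivity
  obtain ⟨V, hV⟩ : ∃ V, V = (b₁ - a₁) * (b₂ - a₂) := ⟨_, rfl⟩
  have hV0 : 0 < V := by rw [hV]; exact mul_pos (by linarith) (by linarith)
  obtain ⟨Ck, hCk⟩ : ∃ Ck, Ck = 24 * (χ₁.X + χ₂.X) * WK (c / 4) K ^ 3 * ((b₁ - a₁) * (b₂ - a₂)) := ⟨_, rfl⟩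
  have hCk0 : 0 ≤ Ck := by rw [hCk, ← hV]; positivity
  obtain ⟨C', hC'⟩ : ∃ C', C' = 8 * V + 8 * (8 * Ck) := ⟨_, rfl⟩
  have hC'0 : 0 < C' := by rw [hC']; positivity
  obtain ⟨I0, hI0⟩ : ∃ I0, I0 = ∫ t, k0 t := ⟨_, rfl⟩
  have hI00 : 0 ≤ I0 := by rw [hI0]; exact integral_nonneg fun t => (k0_pos t).le
  refine ⟨(C' * I0 ^ 2 / 2 / (m₁ * m₂)).toNNReal, ?_⟩
  intro μ J P hμ hJ hCh M α ℓ δ hM hδ hδℓ hαJ g hgm hgi hgs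
  have hcP := hCh.cont
  obtain ⟨A, hA⟩ : ∃ A, A = M * μ := ⟨_, rfl⟩
  have hA0 : 0 < A := by rw [hA]; positivity
  set J₀ := Icc α (α + ℓ) with hJ₀
  set I := Ioc (δ / 2) δ with hI
  let s : ℝ × ℝ → ℝ := fun x => min 1 (√(χ₁.χ x.1 * χ₂.χ x.2))
  have hs0 : ∀ x, 0 ≤ s x := fun x => le_min zero_le_one (Real.sqrt_nonneg _)
  have hs1 : ∀ x, s x ≤ 1 := fun x => min_le_left _ _
  have hs2 : ∀ x ∈ Icc a₁ b₁ ×ˢ Icc a₂ b₂, s x ^ 2 = χ₁.χ x.1 * χ₂.χ x.2 := by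
    intro x hx
    have e1 := χ₁.le x.1 hx.1
    have e2 := χ₂.le x.2 hx.2
    simp only [s]
    rw [min_eq_right, Real.sq_sqrt (mul_nonneg e1.1 e2.1)]
    exact (Real.sqrt_le_sqrt (mul_le_one₀ e1.2 e2.1 e2.2)).trans Real.sqrt_one.le
  have cs : Continuous s := by fun_prop
  let E : ℝ × ℝ → ℝ × ℝ → ℂ := fun x z => Complex.exp (Complex.I * ((M * (P x.1 x.2 (z.2 + z.1) - P x.1 x.2 z.2) : ℝ) : ℂ))
  have cE : Continuous (Function.uncurry E) := by
    have t1 : Continuous (fun q : (ℝ × ℝ) × (ℝ × ℝ) => P q.1.1 q.1.2 (q.2.2 + q.2.1)) :=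
      hcP.comp (by fun_prop : Continuous (fun q : (ℝ × ℝ) × (ℝ × ℝ) => (q.1.1, q.1.2, q.2.2 + q.2.1)))
    have t2 : Continuous (fun q : (ℝ × ℝ) × (ℝ × ℝ) => P q.1.1 q.1.2 (q.2.2)) :=
      hcP.comp (by fun_prop : Continuous (fun q : (ℝ × ℝ) × (ℝ × ℝ) => (q.1.1, q.1.2, q.2.2)))
    simp only [E, Function.uncurry_def]
    fun_prop
  have nE : ∀ x z, ‖E x z‖ = 1 := by
    intro x z
    simp only [E]
    rw [mul_comm Complex.I, Complex.norm_exp_ofReal_mul_I]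
  let e : ℝ × ℝ → ℝ × ℝ → ℂ := fun x z => (s x : ℂ) * E x z
  have he : Measurable (Function.uncurry e) := by
    have : Continuous (Function.uncurry e) := by
      have : Continuous (fun q : (ℝ × ℝ) × (ℝ × ℝ) => E q.1 q.2) := cE
      simp only [e, Function.uncurry_def]
      fun_prop
    exact this.measurable
  let h : ℝ × ℝ → ℂ := fun z => g (z.2 + z.1) * (starRingEnd ℂ) (g z.2)
  let ν : Measure (ℝ × ℝ) := (volume.restrict I).prod (volume.restrict J₀)
  let ξ : Measure (ℝ × ℝ) := (volume.restrict (Icc a₁ b₁)).prod (volume.restrict (Icc a₂ b₂))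
  have hνr : ν = (volume.prod volume).restrict (I ×ˢ J₀) := Measure.prod_restrict _ _
  have hξr : ξ = (volume.prod volume).restrict (Icc a₁ b₁ ×ˢ Icc a₂ b₂) := Measure.prod_restrict _ _
  have hh : Integrable h ν := by
    rw [hνr]; exact (h_integrable hgi).restrict
  let Kk : ℝ × ℝ → ℝ × ℝ → ℝ≥0∞ := fun z z' => ENNReal.ofReal C' * (ENNReal.ofReal (k0 (A * (z.1 - z'.1))) * ENNReal.ofReal (k0 (A * δ * (z.2 - z'.2))))
  have k0e : ∀ t, k0 (-t) = k0 t := fun t => by simp [k0]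
  have k0m : Measurable k0 := k0_cont.measurable
  have T := TT_bound ξ ν e he ?_ h hh Kk ?_ ?_
    (ENNReal.ofReal C' * ((ENNReal.ofReal A⁻¹ * ENNReal.ofReal I0) * (ENNReal.ofReal (A * δ)⁻¹ * ENNReal.ofReal I0))) ?_ ?_
  · have hfin : ENNReal.ofReal (m₁ * m₂) * ∫⁻ x in Icc a₁' b₁' ×ˢ Icc a₂' b₂', ‖∫ d in I, ∫ y, E x (d, y) * h (d, y)‖ₑ ^ 2
        ≤ ∫⁻ x, ‖∫ z, e x z * h z ∂ν‖ₑ ^ 2 ∂ξ := by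
      rw [← lintegral_const_mul' _ _ (by simp), hξr]
      refine le_trans ?_ (lintegral_mono_set (prod_mono (Icc_subset_Icc i1.le i2.le) (Icc_subset_Icc i3.le i4.le)))
      refine setLIntegral_mono' (measurableSet_Icc.prod measurableSet_Icc) fun x hx => ?_
      have e1 : ∫ z, e x z * h z ∂ν = (s x : ℂ) * ∫ d in I, ∫ y, E x (d, y) * h (d, y) := by
        have : Integrable (fun z => E x z * h z) ν := by
          refine hh.bdd_mul (c := 1) ?_ (ae_of_all _ fun z => (nE x z).le)
          exact (cE.comp (continuous_const.prodMk continuous_id)).aestronglyMeasurable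
        simp only [e, mul_assoc]
        rw [integral_const_mul, integral_prod _ this]
        congr 1
        refine integral_congr_ae (ae_of_all _ fun d => ?_)
        simp only
        refine setIntegral_eq_integral_of_forall_compl_eq_zero fun y hy => ?_
        simp [h, hgs y hy]
      rw [e1, enorm_mul, mul_pow]
      refine mul_le_mul_left ?_ _
      have hx' : x ∈ Icc a₁ b₁ ×ˢ Icc a₂ b₂ := ⟨Icc_subset_Icc i1.le i2.le hx.1, Icc_subset_Icc i3.le i4.le hx.2⟩
      rw [← ofReal_norm, ← ENNReal.ofReal_pow (norm_nonneg _), Complex.norm_real, Real.norm_of_nonneg (hs0 x), hs2 x hx']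
      refine ENNReal.ofReal_le_ofReal (mul_le_mul (hm₁' _ hx.1) (hm₂' _ hx.2) hm₂.le (hm₁.le.trans (hm₁' _ hx.1)))
    have hsq : ∫⁻ z, ‖h z‖ₑ ^ 2 ∂ν ≤ ENNReal.ofReal (δ / 2) * ∫⁻ t, ‖g t‖ₑ ^ 4 := by
      have := h_sq hgm I
      rw [Real.volume_Ioc, show δ - δ / 2 = δ / 2 by ring] at this
      refine le_trans ?_ this
      refine lintegral_mono' ?_ le_rfl
      exact Measure.prod_mono le_rfl Measure.restrict_le_self
    have hmm : 0 < m₁ * m₂ := mul_pos hm₁ hm₂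
    have hall := hfin.trans (T.trans (mul_le_mul_right hsq _))
    have hgoal : ∫⁻ x in Icc a₁' b₁' ×ˢ Icc a₂' b₂', ‖∫ d in I, ∫ y, E x (d, y) * h (d, y)‖ₑ ^ 2 ≤
        ENNReal.ofReal (m₁ * m₂)⁻¹ * (ENNReal.ofReal C' * ((ENNReal.ofReal A⁻¹ * ENNReal.ofReal I0) * (ENNReal.ofReal (A * δ)⁻¹ * ENNReal.ofReal I0)) * (ENNReal.ofReal (δ / 2) * ∫⁻ t, ‖g t‖ₑ ^ 4)) := by
      refine le_trans (le_of_eq ?_) (mul_le_mul_right hall _)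
      rw [← mul_assoc, ← ENNReal.ofReal_mul (by positivity), inv_mul_cancel₀ hmm.ne']
      simp
    refine hgoal.trans (le_of_eq ?_)
    rw [← mul_assoc (ENNReal.ofReal C' * _), ← mul_assoc (ENNReal.ofReal (m₁ * m₂)⁻¹)]
    congr 1
    change _ = ENNReal.ofReal (C' * I0 ^ 2 / 2 / (m₁ * m₂)) * _
    rw [← ENNReal.ofReal_mul (by positivity), ← ENNReal.ofReal_mul (by positivity),
      ← ENNReal.ofReal_mul (by positivity), ← ENNReal.ofReal_mul (by positivity), ← ENNReal.ofReal_mul (by positivity), ← ENNReal.ofReal_mul (by positivity),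
      ← ENNReal.ofReal_mul (by positivity)]
    congr 1
    rw [← hA]
    field_simp
  · intro x z
    simp only [e]
    rw [norm_mul, nE, mul_one, Complex.norm_real, Real.norm_of_nonneg (hs0 x)]
    exact hs1 x
  · simp only [Kk, Function.uncurry_def]
    fun_prop
  · intro z z'
    simp only [Kk]
    rw [← k0e (A * (z.1 - z'.1)), ← k0e (A * δ * (z.2 - z'.2))]
    congr 4
    · congr 1; ring
    · congr 1; ring
  · refine ae_of_all _ fun z => ?_
    calc ∫⁻ z', Kk z z' ∂ν ≤ ∫⁻ z', Kk z z' ∂(volume.prod volume) := by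
          rw [hνr]; exact setLIntegral_le_lintegral _ _
      _ ≤ _ := by
          simp only [Kk]
          rw [lintegral_const_mul _ (by fun_prop)]
          rw [lintegral_prod_mul (f := fun t => ENNReal.ofReal (k0 (A * (z.1 - t)))) (g := fun t => ENNReal.ofReal (k0 (A * δ * (z.2 - t)))) (by fun_prop) (by fun_prop)]
          rw [k0_scale hA0, k0_scale (by positivity), hI0]
  · have hz : ∀ᵐ z ∂ν, z ∈ I ×ˢ J₀ := by
      rw [hνr]; exact ae_restrict_mem (measurableSet_Ioc.prod measurableSet_Icc)
    filter_upwards [hz] with z hz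
    filter_upwards [‹∀ᵐ z ∂ν, z ∈ I ×ˢ J₀›] with z' hz'
    obtain ⟨d, y⟩ := z
    obtain ⟨d', y'⟩ := z'
    obtain ⟨hd, hy⟩ := hz
    obtain ⟨hd', hy'⟩ := hz'
    simp only [hI, hJ₀, mem_Ioc, mem_Icc] at hd hy hd' hy'
    have heq : ∫ x, e x (d, y) * (starRingEnd ℂ) (e x (d', y')) ∂ξ =
        ∫ x : ℝ × ℝ, Complex.exp (Complex.I * ((M * (P x.1 x.2 (y + d) - P x.1 x.2 y - P x.1 x.2 (y' + d') + P x.1 x.2 y') : ℝ) : ℂ)) *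
          ((χ₁.χ x.1 * χ₂.χ x.2 : ℝ) : ℂ) ∂ξ := by
      have hx : ∀ᵐ x ∂ξ, x ∈ Icc a₁ b₁ ×ˢ Icc a₂ b₂ := by
        rw [hξr]; exact ae_restrict_mem (measurableSet_Icc.prod measurableSet_Icc)
      refine integral_congr_ae ?_
      filter_upwards [hx] with x hx
      simp only [e, E]
      rw [← hs2 x hx, map_mul, Complex.conj_ofReal, ← Complex.exp_conj, mul_mul_mul_comm, ← Complex.exp_add, mul_comm]
      congr 1
      · congr 1
        rw [map_mul, Complex.conj_I, Complex.conj_ofReal]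
        push_cast; ring
      · push_cast; ring
    rw [heq]
    have hmem : ∀ t, α ≤ t → t ≤ α + 2 * ℓ → t ∈ J := fun t ht ht' => hαJ ⟨ht, ht'⟩
    have hbd : ‖∫ x : ℝ × ℝ, Complex.exp (Complex.I * ((M * (P x.1 x.2 (y + d) - P x.1 x.2 y - P x.1 x.2 (y' + d') + P x.1 x.2 y') : ℝ) : ℂ)) *
          ((χ₁.χ x.1 * χ₂.χ x.2 : ℝ) : ℂ) ∂ξ‖ ≤ C' * (k0 (A * (d - d')) * k0 (A * δ * (y - y'))) := by
      rw [hC']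
      refine k0_bound (T := |A * (d - d')| + |A * δ * (y - y')|) hV0.le (by positivity) rfl ?_ ?_
      · have hx : ∀ᵐ x ∂ξ, x ∈ Icc a₁ b₁ ×ˢ Icc a₂ b₂ := by
          rw [hξr]; exact ae_restrict_mem (measurableSet_Icc.prod measurableSet_Icc)
        have := norm_integral_le_of_norm_le_const (μ := ξ) (C := 1) (f := fun x : ℝ × ℝ => Complex.exp (Complex.I * ((M * (P x.1 x.2 (y + d) - P x.1 x.2 y - P x.1 x.2 (y' + d') + P x.1 x.2 y') : ℝ) : ℂ)) *
          ((χ₁.χ x.1 * χ₂.χ x.2 : ℝ) : ℂ)) (by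
            filter_upwards [hx] with x hx
            rw [norm_mul, mul_comm Complex.I, Complex.norm_exp_ofReal_mul_I, one_mul, Complex.norm_real, ← hs2 x hx, Real.norm_of_nonneg (by positivity)]
            exact pow_le_one₀ (hs0 x) (hs1 x))
        refine this.trans (le_of_eq ?_)
        rw [one_mul, Measure.real, hξr, Measure.restrict_apply_univ, Measure.prod_prod, Real.volume_Icc, Real.volume_Icc,
          ENNReal.toReal_mul, ENNReal.toReal_ofReal (by linarith), ENNReal.toReal_ofReal (by linarith), hV]
      · intro hT
        obtain ⟨D, hD⟩ : ∃ D, D = |d - d'| + |y - y'| * |d'| := ⟨_, rfl⟩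
        have hd'0 : |d'| = d' := abs_of_pos (by linarith)
        have hTD : |A * (d - d')| + |A * δ * (y - y')| ≤ 2 * (A * D) := by
          rw [hD, abs_mul, abs_mul, abs_mul, abs_of_pos hA0, abs_of_pos hδ, hd'0]
          have n1 := mul_nonneg hA0.le (abs_nonneg (d - d'))
          have n2 := mul_nonneg hA0.le (abs_nonneg (y - y'))
          have n3 := mul_nonneg n2 (by linarith : 0 ≤ 2 * d' - δ)
          linarith only [n1, n3]
        have hAD : 0 < A * D := by linarith
        have hD0 : 0 < D := pos_of_mul_pos_right hAD hA0.le
        have kk := hCh.kernel h1 h2 hJ hc hK hμ χ₁ χ₂ hM (hmem y (by linarith) (by linarith)) (hmem (y + d) (by linarith) (by linarith))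
          (hmem y' (by linarith) (by linarith)) (hmem (y' + d') (by linarith) (by linarith)) (hmem (y + d') (by linarith) (by linarith)) hD hD0
        rw [← hCk, ← hA] at kk
        refine kk.trans ?_
        have : (A * D)⁻¹ ≤ 2 * (|A * (d - d')| + |A * δ * (y - y')|)⁻¹ := by
          rw [inv_le_comm₀ hAD (by positivity), mul_inv, inv_inv]
          linarith
        calc (A * D)⁻¹ ^ 3 * Ck ≤ (2 * (|A * (d - d')| + |A * δ * (y - y')|)⁻¹) ^ 3 * Ck := by
              gcongr
          _ = _ := by ring
    simp only [Kk]
    rw [← ENNReal.ofReal_mul (k0_pos _).le, ← ENNReal.ofReal_mul hC'0.le, ← ofReal_norm]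
    exact ENNReal.ofReal_le_ofReal hbd



/-- autocorrelation -/
def acorr (w : ℝ → ℂ) (d : ℝ) : ℂ := ∫ y, w (y + d) * (starRingEnd ℂ) (w y)

lemma acorr_neg (w : ℝ → ℂ) (d : ℝ) : acorr w (-d) = (starRingEnd ℂ) (acorr w d) := by
  unfold acorr
  rw [← integral_conj, ← integral_add_right_eq_self _ d]
  congr 1
  ext y
  simp [mul_comm]

lemma acorr_int {w : ℝ → ℂ} (hw : Integrable w) : Integrable (acorr w) :=
  (h_integrable hw).integral_prod_left

lemma integral_acorr {w : ℝ → ℂ} (hw : Integrable w) :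
    ∫ d, acorr w d = (∫ t, w t) * (starRingEnd ℂ) (∫ t, w t) := by
  unfold acorr
  rw [integral_integral_swap (f := fun d y => w (y + d) * (starRingEnd ℂ) (w y)) (h_integrable hw)]
  simp_rw [integral_mul_const, integral_add_left_eq_self w]
  rw [integral_const_mul, integral_conj]

lemma dyadic_union (ℓ : ℝ) (hℓ : 0 < ℓ) :
    ⋃ k : ℕ, Ioc (ℓ * (1 / 2) ^ k / 2) (ℓ * (1 / 2) ^ k) = Ioc 0 ℓ := by
  ext d
  simp only [mem_iUnion, mem_Ioc]
  constructor
  · rintro ⟨k, h1, h2⟩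
    refine ⟨lt_trans (by positivity) h1, h2.trans ?_⟩
    exact mul_le_of_le_one_right hℓ.le (pow_le_one₀ (by norm_num) (by norm_num))
  · rintro ⟨h1, h2⟩
    obtain ⟨n, h3, h4⟩ := exists_nat_pow_near_of_lt_one (x := d / ℓ) (y := 1 / 2) (by positivity)
      ((div_le_one hℓ).2 h2) (by norm_num) (by norm_num)
    refine ⟨n, ?_, ?_⟩
    · rw [lt_div_iff₀ hℓ, pow_succ] at h3; linarith
    · rw [div_le_iff₀ hℓ] at h4; linarith

lemma dyadic_disj (ℓ : ℝ) (hℓ : 0 < ℓ) :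
    Pairwise (Function.onFun Disjoint fun k : ℕ => Ioc (ℓ * (1 / 2) ^ k / 2) (ℓ * (1 / 2) ^ k)) := by
  have key : ∀ m n : ℕ, m < n → Disjoint (Ioc (ℓ * (1 / 2) ^ m / 2) (ℓ * (1 / 2) ^ m))
      (Ioc (ℓ * (1 / 2) ^ n / 2) (ℓ * (1 / 2) ^ n)) := by
    intro m n h
    rw [Set.disjoint_left]
    rintro x ⟨h1, h2⟩ ⟨h3, h4⟩
    have : (1 / 2 : ℝ) ^ n ≤ (1 / 2) ^ (m + 1) := pow_le_pow_of_le_one (by norm_num) (by norm_num) h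
    rw [pow_succ] at this
    nlinarith
  intro m n h
  rcases lt_or_gt_of_ne h with h | h
  · exact key m n h
  · exact (key n m h).symm

lemma sq_le_dyadic {w : ℝ → ℂ} (hw : Integrable w) {α ℓ : ℝ} (hℓ : 0 < ℓ)
    (hs : ∀ t, t ∉ Icc α (α + ℓ) → w t = 0) :
    ‖∫ t, w t‖ₑ ^ 2 ≤ 2 * ∑' k : ℕ, ‖∫ d in Ioc (ℓ * (1 / 2) ^ k / 2) (ℓ * (1 / 2) ^ k), acorr w d‖ₑ := by
  have hI := acorr_int hw
  have h0 : ∀ d, ℓ < d → acorr w d = 0 := by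
    intro d hd
    unfold acorr
    rw [← integral_zero ℝ ℂ]
    congr 1
    ext y
    by_cases h1 : y ∈ Icc α (α + ℓ)
    · rw [hs (y + d)]
      · simp
      · intro h2; linarith [h2.2, h1.1]
    · rw [hs y h1]; simp
  have e1 : ∫ d in Ioi (0:ℝ), acorr w d = ∫ d in Ioc 0 ℓ, acorr w d := by
    refine setIntegral_eq_of_subset_of_forall_sdiff_eq_zero measurableSet_Ioi Ioc_subset_Ioi_self ?_
    rintro x ⟨h1, h2⟩
    apply h0
    by_contra h
    exact h2 ⟨h1, not_lt.1 h⟩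
  have e2 : HasSum (fun k : ℕ => ∫ d in Ioc (ℓ * (1 / 2) ^ k / 2) (ℓ * (1 / 2) ^ k), acorr w d)
      (∫ d in Ioc 0 ℓ, acorr w d) := by
    rw [← dyadic_union ℓ hℓ]
    exact hasSum_integral_iUnion (fun k => measurableSet_Ioc) (dyadic_disj ℓ hℓ) hI.integrableOn
  have e3 : ∫ d in Iic (0:ℝ), acorr w d = (starRingEnd ℂ) (∫ d in Ioi (0:ℝ), acorr w d) := by
    rw [← integral_conj]
    have := integral_comp_neg_Iic (0:ℝ) (fun d => acorr w (-d))
    simp only [neg_neg, neg_zero] at this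
    rw [this]
    simp_rw [acorr_neg]
  have e4 : ‖∫ d, acorr w d‖ₑ ≤ 2 * ‖∫ d in Ioi (0:ℝ), acorr w d‖ₑ := by
    rw [← intervalIntegral.integral_Iic_add_Ioi (b := (0:ℝ)) hI.integrableOn hI.integrableOn, e3, two_mul]
    refine (enorm_add_le _ _).trans ?_
    rw [RCLike.enorm_conj]
  rw [integral_acorr hw, enorm_mul, RCLike.enorm_conj, ← pow_two, e1, ← e2.tsum_eq] at e4
  refine e4.trans ?_
  gcongr
  exact enorm_tsum_le_tsum_enorm

lemma jensen_geo {q : ℝ} (hq : 1 < q) {τ : ℝ≥0∞} (h0 : τ ≠ 0) (h1 : τ < 1) :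
    ∃ W : ℝ≥0, ∀ B : ℕ → ℝ≥0∞, (∑' k, B k) ^ q ≤ W * ∑' k, (τ ^ k)⁻¹ * B k ^ q := by
  have hq0 : 0 < 1 / (q - 1) := by have : 0 < q - 1 := by linarith
                                   positivity
  have ht : τ ≠ ⊤ := h1.ne_top
  set ω := τ ^ (1 / (q - 1)) with hω
  have hω1 : ω < 1 := ENNReal.rpow_lt_one h1 hq0
  have hω0 : ω ≠ 0 := by
    rw [hω]; simp [h0, ht]
  have hωt : ω ≠ ⊤ := hω1.ne_top
  have hWt : (∑' k : ℕ, ω ^ k) ^ (q - 1) ≠ ⊤ := by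
    apply ENNReal.rpow_ne_top_of_nonneg (by linarith)
    rw [ENNReal.tsum_geometric, Ne, ENNReal.inv_eq_top]
    exact (tsub_pos_of_lt hω1).ne'
  refine ⟨((∑' k : ℕ, ω ^ k) ^ (q - 1)).toNNReal, fun B => ?_⟩
  rw [ENNReal.coe_toNNReal hWt]
  have := jensen_tsum hq (fun k : ℕ => ω ^ k) (fun k => (ω ^ k)⁻¹ * B k)
  have e : ∀ k, ω ^ k * ((ω ^ k)⁻¹ * B k) = B k := fun k => by
    rw [← mul_assoc, ENNReal.mul_inv_cancel (pow_ne_zero _ hω0) (ENNReal.pow_ne_top hωt), one_mul]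
  simp only [e] at this
  refine this.trans (le_of_eq ?_)
  congr 1
  congr 1
  ext k
  rw [ENNReal.mul_rpow_of_nonneg _ _ (by linarith), ← mul_assoc]
  congr 1
  have h2 : ω ^ k ≠ 0 := pow_ne_zero _ hω0
  have h3 : ω ^ k ≠ ⊤ := ENNReal.pow_ne_top hωt
  have h4 : (ω ^ k) ^ (q - 1) = τ ^ k := by
    rw [hω, ← ENNReal.rpow_natCast, ← ENNReal.rpow_natCast, ← ENNReal.rpow_mul, ← ENNReal.rpow_mul]
    congr 1
    have : q - 1 ≠ 0 := by linarith
    field_simp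
  rw [← h4, ← ENNReal.rpow_neg, ← ENNReal.rpow_neg_one, ← ENNReal.rpow_mul]
  nth_rw 1 [← ENNReal.rpow_one (ω ^ k)]
  rw [← ENNReal.rpow_add _ _ h2 h3]
  congr 1
  ring

lemma holder_supp {g : ℝ → ℂ} (hg : Measurable g) {α ℓ : ℝ} (hℓ : 0 < ℓ)
    (hs : ∀ t, t ∉ Icc α (α + ℓ) → g t = 0) {n : ℝ} (hn : 0 < n) {p : ℝ} (hp : n < p) :
    (∫⁻ t, ‖g t‖ₑ ^ n) ^ (p / n) ≤ ENNReal.ofReal ℓ ^ (p / n - 1) * ∫⁻ t, ‖g t‖ₑ ^ p := by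
  have h1 : ∀ m : ℝ, 0 < m → ∫⁻ t, ‖g t‖ₑ ^ m = ∫⁻ t in Icc α (α + ℓ), ‖g t‖ₑ ^ m := by
    intro m hm
    rw [setLIntegral_eq_of_support_subset]
    intro t ht
    by_contra h
    apply ht
    simp [hs t h, hm]
  have := jensen_lintegral (volume.restrict (Icc α (α + ℓ))) (p := p / n)
    ((one_lt_div hn).2 hp) (f := fun t => ‖g t‖ₑ ^ n) (by fun_prop)
  rw [h1 n hn, h1 p (hn.trans hp)]
  refine this.trans (le_of_eq ?_)
  rw [Measure.restrict_apply_univ, Real.volume_Icc]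
  congr 2
  · congr 1
    ring
  · ext t
    rw [← ENNReal.rpow_mul]
    congr 1
    field_simp



lemma acorr_bound {w : ℝ → ℂ} (hw : Measurable w) (d : ℝ) :
    ‖acorr w d‖ₑ ≤ ∫⁻ t, ‖w t‖ₑ ^ 2 := by
  unfold acorr
  refine (enorm_integral_le_lintegral_enorm _).trans ?_
  calc ∫⁻ y, ‖w (y + d) * (starRingEnd ℂ) (w y)‖ₑ
      ≤ ∫⁻ y, (‖w (y + d)‖ₑ ^ 2 + ‖w y‖ₑ ^ 2) / 2 := by
        refine lintegral_mono fun y => ?_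
        rw [enorm_mul, RCLike.enorm_conj]
        exact ennreal_amgm _ _
    _ = ((∫⁻ y, ‖w (y + d)‖ₑ ^ 2) + ∫⁻ y, ‖w y‖ₑ ^ 2) / 2 := by
        simp_rw [div_eq_mul_inv]
        rw [lintegral_mul_const _ (by fun_prop), lintegral_add_left (by fun_prop)]
    _ = _ := by
        rw [lintegral_add_right_eq_self (fun y => ‖w y‖ₑ ^ 2) d, ENNReal.add_div, ENNReal.add_halves]

lemma holder_combine {N2 N4 Np L : ℝ≥0∞} {p : ℝ} (hp : 4 < p) (hL : L ≠ ⊤) (hL0 : L ≠ 0) (hN : Np ≠ ⊤) (hN0 : Np ≠ 0)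
    (h2 : N2 ^ (p / 2) ≤ L ^ (p / 2 - 1) * Np) (h4 : N4 ^ (p / 4) ≤ L ^ (p / 4 - 1) * Np) :
    (L * N2) ^ (p / 2 - 2) * N4 ≤ L ^ (p - 4) * Np := by
  have e2 : N2 ^ (p / 2 - 2) ≤ (L ^ (p / 2 - 1) * Np) ^ ((p / 2 - 2) / (p / 2)) := by
    have := ENNReal.rpow_le_rpow h2 (show 0 ≤ (p / 2 - 2) / (p / 2) by apply div_nonneg <;> linarith)
    rw [← ENNReal.rpow_mul] at this
    rwa [show p / 2 * ((p / 2 - 2) / (p / 2)) = p / 2 - 2 by field_simp] at this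
  have e4 : N4 ≤ (L ^ (p / 4 - 1) * Np) ^ (4 / p) := by
    have := ENNReal.rpow_le_rpow h4 (show 0 ≤ 4 / p by apply div_nonneg <;> linarith)
    rw [← ENNReal.rpow_mul] at this
    rwa [show p / 4 * (4 / p) = 1 by field_simp, ENNReal.rpow_one] at this
  rw [ENNReal.mul_rpow_of_nonneg _ _ (by linarith)]
  refine (mul_le_mul' (mul_le_mul' le_rfl e2) e4).trans (le_of_eq ?_)
  have hp0 : p ≠ 0 := by linarith
  rw [ENNReal.mul_rpow_of_nonneg _ _ (by apply div_nonneg <;> linarith),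
    ENNReal.mul_rpow_of_nonneg _ _ (by apply div_nonneg <;> linarith), ← ENNReal.rpow_mul, ← ENNReal.rpow_mul]
  calc _ = (L ^ (p / 2 - 2) * L ^ ((p / 2 - 1) * ((p / 2 - 2) / (p / 2))) * L ^ ((p / 4 - 1) * (4 / p))) *
      (Np ^ ((p / 2 - 2) / (p / 2)) * Np ^ (4 / p)) := by ring
    _ = _ := by
      rw [← ENNReal.rpow_add _ _ hL0 hL, ← ENNReal.rpow_add _ _ hL0 hL, ← ENNReal.rpow_add _ _ hN0 hN]
      congr 1
      · congr 1
        field_simp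
        ring
      · nth_rw 2 [← ENNReal.rpow_one Np]
        congr 1
        field_simp
        ring

lemma chart_Lp {a₁ b₁ a₂ b₂ a₁' b₁' a₂' b₂' c K p : ℝ} (hp : 4 < p) (h1 : a₁ < b₁) (h2 : a₂ < b₂)
    (i1 : a₁ < a₁') (i2 : b₁' < b₁) (i3 : a₂ < a₂') (i4 : b₂' < b₂) (hc : 0 < c) (hK : 0 ≤ K) :
    ∃ C : ℝ≥0, 0 < C ∧ ∀ (μ : ℝ) (J : Set ℝ) (P : ℝ → ℝ → ℝ → ℝ), 0 < μ → Convex ℝ J →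
      Chart a₁ b₁ a₂ b₂ J c K μ P → ∀ (M α ℓ : ℝ), 0 < M → 0 < ℓ → Icc α (α + 2 * ℓ) ⊆ J →
      ∀ g : ℝ → ℂ, Measurable g → (∀ t, t ∉ Icc α (α + ℓ) → g t = 0) →
      ∫⁻ x in Icc a₁' b₁' ×ˢ Icc a₂' b₂', ‖∫ y,
        Complex.exp (Complex.I * ((M * P x.1 x.2 y : ℝ) : ℂ)) * g y‖ₑ ^ p ≤
        C * ENNReal.ofReal ((M * μ)⁻¹ ^ 2) * (ENNReal.ofReal ℓ ^ (p - 4) * ∫⁻ t, ‖g t‖ₑ ^ p) := by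
  obtain ⟨C2, hC2⟩ := chart_L2 h1 h2 i1 i2 i3 i4 hc hK
  obtain ⟨q, hq⟩ : ∃ q, q = p / 2 := ⟨_, rfl⟩
  obtain ⟨τ, hτ⟩ : ∃ τ : ℝ≥0∞, τ = (1 / 2) ^ ((q - 2) / 2) := ⟨_, rfl⟩
  have half1 : (1 / 2 : ℝ≥0∞) < 1 := by simp
  have half0 : (1 / 2 : ℝ≥0∞) ≠ 0 := by simp
  have hτ1 : τ < 1 := by rw [hτ]; exact ENNReal.rpow_lt_one half1 (by linarith)
  have hτ0 : τ ≠ 0 := by rw [hτ]; simp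
  obtain ⟨W, hW⟩ := jensen_geo (q := q) (by linarith) hτ0 hτ1
  have hT : (∑' k : ℕ, τ ^ k) ≠ ⊤ := by
    rw [ENNReal.tsum_geometric, Ne, ENNReal.inv_eq_top]
    exact (tsub_pos_of_lt hτ1).ne'
  obtain ⟨T, hTe⟩ : ∃ T : ℝ≥0, (T : ℝ≥0∞) = ∑' k : ℕ, τ ^ k := ⟨_, ENNReal.coe_toNNReal hT⟩
  refine ⟨2 ^ q * W * T * C2 + 1, by positivity, ?_⟩
  intro μ J P hμ hJ hCh M α ℓ hM hℓ hαJ g hgm hgs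
  have hA : 0 < M * μ := mul_pos hM hμ
  obtain ⟨L, hL⟩ : ∃ L, L = ENNReal.ofReal ℓ := ⟨_, rfl⟩
  have hL0 : L ≠ 0 := by rw [hL]; simpa using hℓ
  have hLt : L ≠ ⊤ := by rw [hL]; simp
  rw [← hL]
  have hp0 : 0 < p := by linarith
  by_cases hNt : ∫⁻ t, ‖g t‖ₑ ^ p = ⊤
  · rw [hNt]
    refine le_top.trans (le_of_eq ?_)
    symm
    rw [ENNReal.mul_top (by simp [hL0, hLt]), ENNReal.mul_top]
    simp only [ne_eq, mul_eq_zero, not_or]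
    refine ⟨by simp, ?_⟩
    simp only [ENNReal.ofReal_eq_zero, not_le]
    positivity
  by_cases hN0 : ∫⁻ t, ‖g t‖ₑ ^ p = 0
  · rw [lintegral_eq_zero_iff (by fun_prop)] at hN0
    have : ∀ x : ℝ × ℝ, ∫ y, Complex.exp (Complex.I * ((M * P x.1 x.2 y : ℝ) : ℂ)) * g y = 0 := by
      intro x
      rw [← integral_zero ℝ ℂ]
      apply integral_congr_ae
      filter_upwards [hN0] with y hy
      have : g y = 0 := by simpa [hp0, hp0.le, not_lt.2 hp0.le] using hy
      simp [this]
    simp only [this, enorm_zero, ENNReal.zero_rpow_of_pos hp0, lintegral_zero]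
    exact zero_le
  have H1 := holder_supp hgm hℓ hgs (n := 1) one_pos (p := p) (by linarith)
  have H2 := holder_supp hgm hℓ hgs (n := 2) two_pos (p := p) (by linarith)
  have H4 := holder_supp hgm hℓ hgs (n := 4) four_pos (p := p) (by linarith)
  have e2 : ∫⁻ t, ‖g t‖ₑ ^ (2:ℝ) = ∫⁻ t, ‖g t‖ₑ ^ 2 := by simp
  have e4 : ∫⁻ t, ‖g t‖ₑ ^ (4:ℝ) = ∫⁻ t, ‖g t‖ₑ ^ 4 := by
    congr 1; ext t; exact_mod_cast ENNReal.rpow_natCast (‖g t‖ₑ) 4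
  rw [e2] at H2
  rw [e4] at H4
  have hgi : Integrable g := by
    refine ⟨hgm.aestronglyMeasurable, ?_⟩
    simp only [ENNReal.rpow_one, div_one] at H1
    have : (∫⁻ t, ‖g t‖ₑ) ^ p ≠ ⊤ := by
      refine ne_top_of_le_ne_top ?_ H1
      exact ENNReal.mul_ne_top (ENNReal.rpow_ne_top_of_nonneg (by linarith) (hL ▸ hLt)) hNt
    rw [hasFiniteIntegral_iff_enorm]
    rw [Ne, ENNReal.rpow_eq_top_iff_of_pos hp0] at this
    exact lt_top_iff_ne_top.2 this
  set N2 := ∫⁻ t, ‖g t‖ₑ ^ 2 with hN2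
  set N4 := ∫⁻ t, ‖g t‖ₑ ^ 4 with hN4
  set Np := ∫⁻ t, ‖g t‖ₑ ^ p with hNp
  have HC := holder_combine hp hLt hL0 hNt hN0 (by rw [hL]; exact H2) (by rw [hL]; exact H4)
  have hcP := hCh.cont
  let e : ℝ × ℝ → ℝ → ℂ := fun x y => Complex.exp (Complex.I * ((M * P x.1 x.2 y : ℝ) : ℂ))
  have ce : Continuous (Function.uncurry e) := by
    have t2 : Continuous (fun q : (ℝ × ℝ) × ℝ => P q.1.1 q.1.2 q.2) :=
      hcP.comp (by fun_prop : Continuous (fun q : (ℝ × ℝ) × ℝ => (q.1.1, q.1.2, q.2)))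
    simp only [e, Function.uncurry_def]
    fun_prop
  have ne : ∀ x y, ‖e x y‖ = 1 := by
    intro x y
    simp only [e]
    rw [mul_comm Complex.I, Complex.norm_exp_ofReal_mul_I]
  let w : ℝ × ℝ → ℝ → ℂ := fun x y => e x y * g y
  have nw : ∀ x y, ‖w x y‖ₑ = ‖g y‖ₑ := by
    intro x y
    rw [← ofReal_norm, ← ofReal_norm]; simp [w, ne]
  have mw : Measurable (Function.uncurry w) := ce.measurable.mul (hgm.comp measurable_snd)
  have mwx : ∀ x, Measurable (w x) := fun x => mw.comp (measurable_const.prodMk measurable_id)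
  have iw : ∀ x, Integrable (w x) := by
    intro x
    refine ⟨(mwx x).aestronglyMeasurable, ?_⟩
    rw [hasFiniteIntegral_iff_enorm]
    simp_rw [nw]
    exact hasFiniteIntegral_iff_enorm.1 hgi.2
  let B : ℕ → ℝ × ℝ → ℝ≥0∞ := fun k x => ‖∫ d in Ioc (ℓ * (1 / 2) ^ k / 2) (ℓ * (1 / 2) ^ k), acorr (w x) d‖ₑ
  have hac : ∀ x d, acorr (w x) d = ∫ y, Complex.exp (Complex.I * ((M * (P x.1 x.2 (y + d) - P x.1 x.2 y) : ℝ) : ℂ)) *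
          (g (y + d) * (starRingEnd ℂ) (g y)) := by
    intro x d
    unfold acorr
    congr 1
    ext y
    simp only [w, e]
    rw [map_mul, ← Complex.exp_conj, map_mul, Complex.conj_I, Complex.conj_ofReal]
    rw [show Complex.I * ((M * (P x.1 x.2 (y + d) - P x.1 x.2 y) : ℝ) : ℂ) =
      Complex.I * ((M * P x.1 x.2 (y + d) : ℝ) : ℂ) + -Complex.I * ((M * P x.1 x.2 y : ℝ) : ℂ) by push_cast; ring,
      Complex.exp_add]
    ring
  have mac : StronglyMeasurable (fun q : (ℝ × ℝ) × ℝ => acorr (w q.1) q.2) := by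
    unfold acorr
    have : Measurable (fun z : ((ℝ × ℝ) × ℝ) × ℝ => w z.1.1 (z.2 + z.1.2) * (starRingEnd ℂ) (w z.1.1 z.2)) := by
      refine (mw.comp (by fun_prop : Measurable fun z : ((ℝ × ℝ) × ℝ) × ℝ => (z.1.1, z.2 + z.1.2))).mul
        (Complex.continuous_conj.measurable.comp
          (mw.comp (by fun_prop : Measurable fun z : ((ℝ × ℝ) × ℝ) × ℝ => (z.1.1, z.2))))
    exact this.stronglyMeasurable.integral_prod_right
  have mB : ∀ k, Measurable (B k) := by
    intro k
    exact (mac.integral_prod_right (ν := volume.restrict (Ioc (ℓ * (1 / 2) ^ k / 2) (ℓ * (1 / 2) ^ k)))).measurable.enorm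
  have hB1 : ∀ k x, B k x ≤ (1 / 2) ^ k * (L * N2) := by
    intro k x
    refine (enorm_integral_le_lintegral_enorm _).trans ?_
    refine (lintegral_mono fun d => acorr_bound (mwx x) d).trans ?_
    simp_rw [nw]
    rw [setLIntegral_const, Real.volume_Ioc, mul_comm N2, ← mul_assoc]
    gcongr
    calc ENNReal.ofReal (ℓ * (1 / 2) ^ k - ℓ * (1 / 2) ^ k / 2) ≤ ENNReal.ofReal ((1 / 2) ^ k * ℓ) := by
          apply ENNReal.ofReal_le_ofReal
          have : 0 ≤ ℓ * (1 / 2) ^ k := by positivity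
          linarith
      _ = _ := by
          rw [ENNReal.ofReal_mul (by positivity), ENNReal.ofReal_pow (by positivity), hL]
          congr 2
          rw [ENNReal.ofReal_div_of_pos (by norm_num)]; simp
  have hB2 : ∀ k, ∫⁻ x in Icc a₁' b₁' ×ˢ Icc a₂' b₂', B k x ^ 2 ≤ C2 * ENNReal.ofReal ((M * μ)⁻¹ ^ 2) * N4 := by
    intro k
    have := hC2 μ J P hμ hJ hCh M α ℓ (ℓ * (1 / 2) ^ k) hM (by positivity)
      (mul_le_of_le_one_right hℓ.le (pow_le_one₀ (by norm_num) (by norm_num))) hαJ g hgm hgi hgs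
    simp only [B, hac]
    exact this
  have hhk : ∀ k : ℕ, ((1 / 2 : ℝ≥0∞) ^ k) ^ (q - 2) = τ ^ k * τ ^ k := by
    intro k
    rw [← mul_pow, hτ, ← ENNReal.rpow_add _ _ half0 half1.ne_top, ← ENNReal.rpow_natCast, ← ENNReal.rpow_natCast,
      ← ENNReal.rpow_mul, ← ENNReal.rpow_mul]
    congr 1; ring
  have hB3 : ∀ k x, (τ ^ k)⁻¹ * B k x ^ q ≤ (L * N2) ^ (q - 2) * (τ ^ k * B k x ^ 2) := by
    intro k x
    have t0 : τ ^ k ≠ 0 := pow_ne_zero _ hτ0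
    have tt : τ ^ k ≠ ⊤ := ENNReal.pow_ne_top hτ1.ne_top
    calc (τ ^ k)⁻¹ * B k x ^ q = (τ ^ k)⁻¹ * (B k x ^ (q - 2) * B k x ^ 2) := by
          congr 1
          rw [← ENNReal.rpow_natCast, ← ENNReal.rpow_add_of_nonneg _ _ (by linarith) (by norm_num)]
          congr 1; push_cast; ring
      _ ≤ (τ ^ k)⁻¹ * (((1 / 2) ^ k * (L * N2)) ^ (q - 2) * B k x ^ 2) := by
          gcongr
          · linarith
          · exact hB1 k x
      _ = ((τ ^ k)⁻¹ * τ ^ k) * ((L * N2) ^ (q - 2) * (τ ^ k * B k x ^ 2)) := by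
          rw [ENNReal.mul_rpow_of_nonneg _ _ (by linarith : 0 ≤ q - 2), hhk]
          ring
      _ = _ := by rw [ENNReal.inv_mul_cancel t0 tt, one_mul]
  have hpt : ∀ x, ‖∫ y, w x y‖ₑ ^ p ≤ 2 ^ q * W * (L * N2) ^ (q - 2) * ∑' k, τ ^ k * B k x ^ 2 := by
    intro x
    have s1 := sq_le_dyadic (iw x) hℓ (α := α) (fun t ht => by simp [w, hgs t ht])
    calc ‖∫ y, w x y‖ₑ ^ p = (‖∫ y, w x y‖ₑ ^ 2) ^ q := by
          rw [← ENNReal.rpow_natCast, ← ENNReal.rpow_mul]; congr 1; rw [hq]; push_cast; ring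
      _ ≤ (2 * ∑' k, B k x) ^ q := by gcongr; linarith
      _ = 2 ^ q * (∑' k, B k x) ^ q := by rw [ENNReal.mul_rpow_of_nonneg _ _ (by linarith)]
      _ ≤ 2 ^ q * (W * ∑' k, (τ ^ k)⁻¹ * B k x ^ q) := by gcongr; exact hW fun k => B k x
      _ ≤ 2 ^ q * (W * ∑' k, (L * N2) ^ (q - 2) * (τ ^ k * B k x ^ 2)) := by
          exact mul_le_mul_right (mul_le_mul_right (ENNReal.tsum_le_tsum fun k => hB3 k x) _) _
      _ = _ := by rw [ENNReal.tsum_mul_left]; ring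
  calc ∫⁻ x in Icc a₁' b₁' ×ˢ Icc a₂' b₂', ‖∫ y, w x y‖ₑ ^ p
      ≤ ∫⁻ x in Icc a₁' b₁' ×ˢ Icc a₂' b₂', 2 ^ q * W * (L * N2) ^ (q - 2) * ∑' k, τ ^ k * B k x ^ 2 :=
        lintegral_mono fun x => hpt x
    _ = 2 ^ q * W * (L * N2) ^ (q - 2) * ∑' k, τ ^ k * ∫⁻ x in Icc a₁' b₁' ×ˢ Icc a₂' b₂', B k x ^ 2 := by
        rw [lintegral_const_mul _ (by fun_prop), lintegral_tsum (fun k => by fun_prop)]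
        congr 2
        ext k
        rw [lintegral_const_mul _ (by fun_prop)]
    _ ≤ 2 ^ q * W * (L * N2) ^ (q - 2) * ∑' k, τ ^ k * (C2 * ENNReal.ofReal ((M * μ)⁻¹ ^ 2) * N4) := by
        gcongr with k; exact hB2 k
    _ = 2 ^ q * W * T * C2 * ENNReal.ofReal ((M * μ)⁻¹ ^ 2) * ((L * N2) ^ (q - 2) * N4) := by
        rw [ENNReal.tsum_mul_right, ← hTe]; ring
    _ ≤ 2 ^ q * W * T * C2 * ENNReal.ofReal ((M * μ)⁻¹ ^ 2) * (L ^ (p - 4) * Np) := by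
        rw [hq]; exact mul_le_mul_right HC _
    _ ≤ _ := by
        gcongr
        push_cast
        rw [ENNReal.coe_rpow_of_nonneg _ (by linarith)]
        exact le_self_add



abbrev E4 := ℝ × ℝ × ℝ × ℝ

/-- Directional derivative operator. -/
def Dd (d : E4) (Φ : E4 → ℝ) : E4 → ℝ := fun z => fderiv ℝ Φ z d

lemma Dd_smooth {U : Set E4} (hU : IsOpen U) {Φ : E4 → ℝ} (h : ContDiffOn ℝ (⊤ : ℕ∞) Φ U) (d : E4) :
    ContDiffOn ℝ (⊤ : ℕ∞) (Dd d Φ) U := by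
  have h1 : ContDiffOn ℝ (⊤ : ℕ∞) (fderiv ℝ Φ) U := h.fderiv_of_isOpen hU (by simp)
  exact h1.clm_apply contDiffOn_const

lemma Dd_iter_smooth {U : Set E4} (hU : IsOpen U) {Φ : E4 → ℝ} (h : ContDiffOn ℝ (⊤ : ℕ∞) Φ U) (d : E4) (k : ℕ) :
    ContDiffOn ℝ (⊤ : ℕ∞) ((Dd d)^[k] Φ) U := by
  induction k with
  | zero => exact h
  | succ k ih => rw [Function.iterate_succ_apply']; exact Dd_smooth hU ih d

lemma Dd_hasDeriv {U : Set E4} (hU : IsOpen U) {Φ : E4 → ℝ} (h : ContDiffOn ℝ (⊤ : ℕ∞) Φ U) (d : E4)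
    {Z : ℝ → E4} {x : ℝ} (hZ : HasDerivAt Z d x) (hz : Z x ∈ U) :
    HasDerivAt (fun x => Φ (Z x)) (Dd d Φ (Z x)) x := by
  have h1 : HasFDerivAt Φ (fderiv ℝ Φ (Z x)) (Z x) :=
    ((h.contDiffAt (hU.mem_nhds hz)).differentiableAt (by simp)).hasFDerivAt
  exact h1.comp_hasDerivAt x hZ

lemma Dd_bound {U : Set E4} (hU : IsOpen U) {Φ : E4 → ℝ} (h : ContDiffOn ℝ (⊤ : ℕ∞) Φ U) (e d : E4)
    {Q : Set E4} (hQ : IsCompact Q) (hQU : Q ⊆ U) :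
    ∃ K : ℝ, 0 ≤ K ∧ ∀ k ≤ 3, ∀ z ∈ Q, |Dd d ((Dd e)^[k] Φ) z| ≤ K ∧ |Dd d (Dd d ((Dd e)^[k] Φ)) z| ≤ K := by
  have key : ∀ Ψ : E4 → ℝ, ContDiffOn ℝ (⊤ : ℕ∞) Ψ U → ∃ K : ℝ, ∀ z ∈ Q, |Ψ z| ≤ K := by
    intro Ψ hΨ
    obtain ⟨K, hK⟩ := hQ.exists_bound_of_continuousOn (hΨ.continuousOn.mono hQU)
    exact ⟨K, hK⟩
  choose K1 h1 using fun k => key _ (Dd_smooth hU (Dd_iter_smooth hU h e k) d)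
  choose K2 h2 using fun k => key _ (Dd_smooth hU (Dd_smooth hU (Dd_iter_smooth hU h e k) d) d)
  refine ⟨∑ k ∈ Finset.range 4, (|K1 k| + |K2 k|), by positivity, fun k hk z hz => ?_⟩
  have : |K1 k| + |K2 k| ≤ ∑ k ∈ Finset.range 4, (|K1 k| + |K2 k|) :=
    Finset.single_le_sum (f := fun k => |K1 k| + |K2 k|) (fun i _ => by positivity) (by simp; omega)
  have a1 := h1 k z hz
  have a2 := h2 k z hz
  have := le_abs_self (K1 k)
  have := le_abs_self (K2 k)
  have := abs_nonneg (K1 k)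
  have := abs_nonneg (K2 k)
  constructor <;> linarith

lemma dirData_of {U : Set E4} (hU : IsOpen U) {Φ : E4 → ℝ} (h : ContDiffOn ℝ (⊤ : ℕ∞) Φ U) (e d : E4)
    {Q : Set E4} (hQU : Q ⊆ U) {K : ℝ}
    (hK : ∀ k ≤ 3, ∀ z ∈ Q, |Dd d ((Dd e)^[k] Φ) z| ≤ K ∧ |Dd d (Dd d ((Dd e)^[k] Φ)) z| ≤ K)
    {a b : ℝ} {J : Set ℝ} {Z : ℝ → ℝ → E4} (hZ : ∀ x ∈ Icc a b, ∀ t ∈ J, Z x t ∈ Q)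
    (hZ1 : ∀ x t, HasDerivAt (fun x => Z x t) e x) (hZ2 : ∀ x t, HasDerivAt (fun t => Z x t) d t)
    {P : ℝ → ℝ → ℝ} {κ μ : ℝ} (hP : ∀ x ∈ Icc a b, ∀ t ∈ J, HasDerivAt (fun x => P x t) (κ + μ * Φ (Z x t)) x) :
    DirData a b J K μ P (fun _ => κ) (fun k x t => (Dd e)^[k] Φ (Z x t)) (fun k x t => Dd d ((Dd e)^[k] Φ) (Z x t))
      (fun k x t => Dd d (Dd d ((Dd e)^[k] Φ)) (Z x t)) where
  hP := hP
  hx := by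
    intro k _ x hx t ht
    rw [Function.iterate_succ_apply']
    exact Dd_hasDeriv hU (Dd_iter_smooth hU h e k) e (hZ1 x t) (hQU (hZ x hx t ht))
  c3 := by
    intro t ht x hx
    exact (Dd_hasDeriv hU (Dd_iter_smooth hU h e 3) e (hZ1 x t) (hQU (hZ x hx t ht))).continuousAt.continuousWithinAt
  hF := by
    intro k _ x hx t ht
    exact Dd_hasDeriv hU (Dd_iter_smooth hU h e k) d (hZ2 x t) (hQU (hZ x hx t ht))
  hG := by
    intro k _ x hx t ht
    exact Dd_hasDeriv hU (Dd_smooth hU (Dd_iter_smooth hU h e k) d) d (hZ2 x t) (hQU (hZ x hx t ht))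
  bG := fun k hk x hx t ht => (hK k hk _ (hZ x hx t ht)).1
  bH := fun k hk x hx t ht => (hK k hk _ (hZ x hx t ht)).2

abbrev eT : E4 := (0, 0, 0, 1)

lemma chart_gen {U : Set E4} (hU : IsOpen U) {Φ₁ Φ₂ : E4 → ℝ} (h1 : ContDiffOn ℝ (⊤ : ℕ∞) Φ₁ U)
    (h2 : ContDiffOn ℝ (⊤ : ℕ∞) Φ₂ U) {a b r0 r1 : ℝ}
    (hc : ∀ x ∈ Icc a b, ∀ r ∈ Icc r0 r1, (x, (0:ℝ), r, (0:ℝ)) ∈ U ∧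
      Dd eT Φ₁ (x, 0, r, 0) = 0 ∧ Dd eT (Dd eT Φ₁) (x, 0, r, 0) ≠ 0 ∧
      Dd eT Φ₂ (x, 0, r, 0) ≠ 0 ∧ Dd eT (Dd eT Φ₂) (x, 0, r, 0) = 0) :
    ∃ τ₀ c K : ℝ, 0 < τ₀ ∧ 0 < c ∧ 0 ≤ K ∧ ∀ τ ≤ τ₀, ∀ r ∈ Icc r0 r1, 
      ∀ P : ℝ → ℝ → ℝ → ℝ, Continuous (fun q : ℝ × ℝ × ℝ => P q.1 q.2.1 q.2.2) →
      ∀ μ μ₁ μ₂ κ₁ κ₂ : ℝ, μ ≤ μ₁ → μ ≤ μ₂ →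
      (∀ x₁ ∈ Icc a b, ∀ x₂ ∈ Icc (-τ) τ, ∀ t ∈ Icc (-τ) τ,
        HasDerivAt (fun x => P x x₂ t) (κ₁ + μ₁ * Φ₁ (x₁, x₂, r, t)) x₁) →
      (∀ x₁ ∈ Icc a b, ∀ x₂ ∈ Icc (-τ) τ, ∀ t ∈ Icc (-τ) τ,
        HasDerivAt (fun x => P x₁ x t) (κ₂ + μ₂ * Φ₂ (x₁, x₂, r, t)) x₂) →
      Chart a b (-τ) τ (Icc (-τ) τ) c K μ P := by
  set Qc : Set E4 := Icc a b ×ˢ {(0:ℝ)} ×ˢ Icc r0 r1 ×ˢ {(0:ℝ)} with hQc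
  have cQc : IsCompact Qc := isCompact_Icc.prod (isCompact_singleton.prod (isCompact_Icc.prod isCompact_singleton))
  have hQ' : ∀ z ∈ Qc, z ∈ U ∧ Dd eT Φ₁ z = 0 ∧ Dd eT (Dd eT Φ₁) z ≠ 0 ∧ Dd eT Φ₂ z ≠ 0 ∧ Dd eT (Dd eT Φ₂) z = 0 := by
    rintro ⟨x, y, r, t⟩ ⟨hx, hy, hr, ht⟩
    simp only [mem_singleton_iff] at hx hy hr ht
    subst hy; subst ht
    exact hc x hx r hr
  have cG1 := (Dd_smooth hU h1 eT).continuousOn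
  have cH1 := (Dd_smooth hU (Dd_smooth hU h1 eT) eT).continuousOn
  have cG2 := (Dd_smooth hU h2 eT).continuousOn
  have cH2 := (Dd_smooth hU (Dd_smooth hU h2 eT) eT).continuousOn
  have hQU : Qc ⊆ U := fun z hz => (hQ' z hz).1
  obtain ⟨c, hc0, hcH, hcG⟩ : ∃ c : ℝ, 0 < c ∧ (∀ z ∈ Qc, c < |Dd eT (Dd eT Φ₁) z|) ∧ (∀ z ∈ Qc, c < |Dd eT Φ₂ z|) := by
    have key : ∀ Ψ : E4 → ℝ, ContinuousOn Ψ U → (∀ z ∈ Qc, Ψ z ≠ 0) → ∃ c : ℝ, 0 < c ∧ ∀ z ∈ Qc, c < |Ψ z| := by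
      intro Ψ hΨ hn
      rcases Qc.eq_empty_or_nonempty with h | h
      · exact ⟨1, one_pos, by simp [h]⟩
      obtain ⟨z0, hz0, hm⟩ := cQc.exists_isMinOn h ((hΨ.mono hQU).abs)
      have p0 : 0 < |Ψ z0| := abs_pos.2 (hn z0 hz0)
      refine ⟨|Ψ z0| / 2, by positivity, fun z hz => ?_⟩
      have : |Ψ z0| ≤ |Ψ z| := hm hz
      linarith
    obtain ⟨c1, h1, h1'⟩ := key _ cH1 fun z hz => (hQ' z hz).2.2.1
    obtain ⟨c2, h2, h2'⟩ := key _ cG2 fun z hz => (hQ' z hz).2.2.2.1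
    exact ⟨min c1 c2, lt_min h1 h2, fun z hz => (min_le_left _ _).trans_lt (h1' z hz),
      fun z hz => (min_le_right _ _).trans_lt (h2' z hz)⟩
  set V : Set E4 := ((U ∩ (fun z => |Dd eT (Dd eT Φ₁) z|) ⁻¹' Ioi c) ∩ (U ∩ (fun z => |Dd eT Φ₂ z|) ⁻¹' Ioi c)) ∩
    ((U ∩ (fun z => |Dd eT Φ₁ z|) ⁻¹' Iio (c / 4)) ∩ (U ∩ (fun z => |Dd eT (Dd eT Φ₂) z|) ⁻¹' Iio (c / 4))) with hV
  have oV : IsOpen V := by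
    refine IsOpen.inter (IsOpen.inter ?_ ?_) (IsOpen.inter ?_ ?_)
    · exact cH1.abs.isOpen_inter_preimage hU isOpen_Ioi
    · exact cG2.abs.isOpen_inter_preimage hU isOpen_Ioi
    · exact cG1.abs.isOpen_inter_preimage hU isOpen_Iio
    · exact cH2.abs.isOpen_inter_preimage hU isOpen_Iio
  have hQV : Qc ⊆ V := by
    intro z hz
    obtain ⟨q1, q2, q3, q4, q5⟩ := hQ' z hz
    refine ⟨⟨⟨q1, hcH z hz⟩, ⟨q1, hcG z hz⟩⟩, ⟨⟨q1, ?_⟩, ⟨q1, ?_⟩⟩⟩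
    · simp only [mem_preimage, q2, abs_zero, mem_Iio]; positivity
    · simp only [mem_preimage, q5, abs_zero, mem_Iio]; positivity
  obtain ⟨τ₀, hτ0, hτ⟩ := cQc.exists_cthickening_subset_open oV hQV
  have cQ : IsCompact (Metric.cthickening τ₀ Qc) := cQc.cthickening
  have hVU : V ⊆ U := fun z hz => hz.1.1.1
  obtain ⟨K1, hK1, hK1'⟩ := Dd_bound hU h1 (1, 0, 0, 0) eT cQ (hτ.trans hVU)
  obtain ⟨K2, hK2, hK2'⟩ := Dd_bound hU h2 (0, 1, 0, 0) eT cQ (hτ.trans hVU)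
  refine ⟨τ₀, c, max K1 K2, hτ0, hc0, le_max_of_le_left hK1, ?_⟩
  intro τ hττ r hr P hPc μ μ₁ μ₂ κ₁ κ₂ hm1 hm2 hP1 hP2
  have hmem : ∀ x₁ ∈ Icc a b, ∀ x₂ ∈ Icc (-τ) τ, ∀ t ∈ Icc (-τ) τ, (x₁, x₂, r, t) ∈ Metric.cthickening τ₀ Qc := by
    intro x₁ hx₁ x₂ hx₂ t ht
    apply Metric.mem_cthickening_of_dist_le _ (x₁, 0, r, 0) _ _ (by simp [hQc, hx₁, hr])
    have q1 : |x₂| ≤ τ₀ := (abs_le.2 hx₂).trans hττ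
    have q2 : |t| ≤ τ₀ := (abs_le.2 ht).trans hττ
    simp [Prod.dist_eq, q1, q2, hτ0.le, Real.dist_eq]
  refine ⟨hPc, ?_, ?_⟩
  · intro x₂ hx₂
    refine ⟨μ₁, _, _, _, _, hm1, dirData_of hU h1 (1, 0, 0, 0) eT (hτ.trans hVU) (K := max K1 K2) (fun k hk z hz =>
      ⟨(hK1' k hk z hz).1.trans (le_max_left _ _), (hK1' k hk z hz).2.trans (le_max_left _ _)⟩)
      (Z := fun x t => (x, x₂, r, t)) (fun x hx t ht => hmem x hx x₂ hx₂ t ht) ?_ ?_ 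
      (fun x hx t ht => hP1 x hx x₂ hx₂ t ht), ?_, ?_⟩
    · intro x t
      exact (hasDerivAt_id x).prodMk ((hasDerivAt_const x x₂).prodMk ((hasDerivAt_const x r).prodMk (hasDerivAt_const x t)))
    · intro x t
      exact (hasDerivAt_const t x).prodMk ((hasDerivAt_const t x₂).prodMk ((hasDerivAt_const t r).prodMk (hasDerivAt_id t)))
    · intro x hx t ht
      exact le_of_lt (hτ (hmem x hx x₂ hx₂ t ht)).1.1.2
    · intro x hx t ht
      exact le_of_lt (hτ (hmem x hx x₂ hx₂ t ht)).2.1.2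
  · intro x₁ hx₁
    refine ⟨μ₂, _, _, _, _, hm2, dirData_of hU h2 (0, 1, 0, 0) eT (hτ.trans hVU) (K := max K1 K2) (fun k hk z hz =>
      ⟨(hK2' k hk z hz).1.trans (le_max_right _ _), (hK2' k hk z hz).2.trans (le_max_right _ _)⟩)
      (Z := fun x t => (x₁, x, r, t)) (fun x hx t ht => hmem x₁ hx₁ x hx t ht) ?_ ?_ 
      (fun x hx t ht => hP2 x₁ hx₁ x hx t ht), ?_, ?_⟩
    · intro x t
      exact (hasDerivAt_const x x₁).prodMk ((hasDerivAt_id x).prodMk ((hasDerivAt_const x r).prodMk (hasDerivAt_const x t)))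
    · intro x t
      exact (hasDerivAt_const t x₁).prodMk ((hasDerivAt_const t x).prodMk ((hasDerivAt_const t r).prodMk (hasDerivAt_id t)))
    · intro x hx t ht
      exact le_of_lt (hτ (hmem x₁ hx₁ x hx t ht)).1.2.2
    · intro x hx t ht
      exact le_of_lt (hτ (hmem x₁ hx₁ x hx t ht)).2.2.2



lemma deriv_even_zero {φ : ℝ → ℝ} (h : ∀ t, φ (-t) = φ t) : deriv φ 0 = 0 := by
  have : deriv (fun t => φ (-t)) 0 = -deriv φ (-0) := deriv_comp_neg φ 0
  simp only [h, neg_zero] at this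
  have h2 : deriv (fun t => φ t) 0 = deriv φ 0 := rfl
  rw [h2] at this
  linarith

lemma deriv2_odd_zero {φ : ℝ → ℝ} (h : ∀ t, φ (-t) = -φ t) : deriv (deriv φ) 0 = 0 := by
  apply deriv_even_zero
  intro t
  have h1 : deriv (fun t => φ (-t)) t = -deriv φ (-t) := deriv_comp_neg φ t
  have h2 : (fun t => φ (-t)) = fun t => -φ t := funext h
  rw [h2] at h1
  have h3 : deriv (fun t => -φ t) t = -deriv φ t := deriv.fun_neg
  rw [h3] at h1
  linarith

lemma deriv2_mul {s h : ℝ → ℝ} (cs : ContDiffAt ℝ (⊤ : ℕ∞) s 0) (ch : ContDiffAt ℝ (⊤ : ℕ∞) h 0)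
    (s0 : s 0 = 0) (h0 : h 0 = 0) : deriv (deriv (fun t => s t * h t)) 0 = 2 * (deriv s 0 * deriv h 0) := by
  have key : ∀ f : ℝ → ℝ, ContDiffAt ℝ (⊤ : ℕ∞) f 0 → (∀ᶠ t in nhds 0, DifferentiableAt ℝ f t) ∧ DifferentiableAt ℝ (deriv f) 0 := by
    intro f hf
    have h2 : ContDiffAt ℝ 2 f 0 := hf.of_le (WithTop.coe_le_coe.2 (le_top : (2 : ℕ∞) ≤ ⊤))
    constructor
    · filter_upwards [h2.eventually (by simp)] with t ht
      exact ht.differentiableAt (by simp)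
    · exact (h2.derivWithin (m := 1) (by norm_num)).differentiableAt (by simp)
  obtain ⟨a1, a2⟩ := key s cs
  obtain ⟨b1, b2⟩ := key h ch
  have e : deriv (fun t => s t * h t) =ᶠ[nhds 0] fun t => deriv s t * h t + s t * deriv h t := by
    filter_upwards [a1, b1] with t h1 h2
    exact (h1.hasDerivAt.mul h2.hasDerivAt).deriv
  rw [e.deriv_eq]
  have := ((a2.hasDerivAt.mul b1.self_of_nhds.hasDerivAt).add (a1.self_of_nhds.hasDerivAt.mul b2.hasDerivAt)).deriv
  refine this.trans ?_
  rw [s0, h0]; ring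

lemma center_calc {s w ρ : ℝ → ℝ} (cs : ContDiffAt ℝ (⊤ : ℕ∞) s 0) (cw : ContDiffAt ℝ (⊤ : ℕ∞) w 0)
    (cρ : ContDiffAt ℝ (⊤ : ℕ∞) ρ 0) (so : ∀ t, s (-t) = -s t) (we : ∀ t, w (-t) = w t) (ρe : ∀ t, ρ (-t) = ρ t)
    (s1 : deriv s 0 ≠ 0) (w0 : 0 < w 0) (ρ0 : 0 < ρ 0) (m : ℝ) (hm : m ≠ 0) :
    deriv (fun t => -(s t * (s t / (ρ t * (ρ t + w t))))) 0 = 0 ∧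
    deriv (deriv (fun t => -(s t * (s t / (ρ t * (ρ t + w t)))))) 0 ≠ 0 ∧
    deriv (fun t => m * (s t / ρ t)) 0 ≠ 0 ∧ deriv (deriv (fun t => m * (s t / ρ t))) 0 = 0 := by
  have s0 : s 0 = 0 := by have := so 0; simp at this; linarith
  have hd : ∀ D : ℝ → ℝ, ContDiffAt ℝ (⊤ : ℕ∞) D 0 → D 0 ≠ 0 → HasDerivAt (fun t => s t / D t) (deriv s 0 / D 0) 0 := by
    intro D cD D0
    refine HasDerivAt.congr_deriv ((cs.differentiableAt (by simp)).hasDerivAt.div (cD.differentiableAt (by simp)).hasDerivAt D0) ?_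
    rw [s0]; field_simp; ring
  have cD : ContDiffAt ℝ (⊤ : ℕ∞) (fun t => ρ t * (ρ t + w t)) 0 := cρ.mul (cρ.add cw)
  have D0 : 0 < ρ 0 * (ρ 0 + w 0) := by positivity
  refine ⟨deriv_even_zero fun t => ?_, ?_, ?_, deriv2_odd_zero fun t => ?_⟩
  · rw [so, we, ρe]; ring
  · have := deriv2_mul cs (cs.neg.div cD D0.ne') s0 (by simp [s0])
    have e : (fun t => -(s t * (s t / (ρ t * (ρ t + w t))))) = (fun t => s t * (-s t / (ρ t * (ρ t + w t)))) := by
      ext t; ring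
    rw [e]
    refine (ne_of_eq_of_ne this ?_)
    have h2 : deriv (fun t => -s t / (ρ t * (ρ t + w t))) 0 = -(deriv s 0 / (ρ 0 * (ρ 0 + w 0))) := by
      refine HasDerivAt.deriv ((hd _ cD D0.ne').neg.congr_of_eventuallyEq (Filter.Eventually.of_forall fun t => ?_))
      simp [neg_div]
    have h3 : deriv s 0 * -(deriv s 0 / (ρ 0 * (ρ 0 + w 0))) ≠ 0 :=
      mul_ne_zero s1 (neg_ne_zero.2 (div_ne_zero s1 D0.ne'))
    have : deriv s 0 * deriv (fun t => -s t / (ρ t * (ρ t + w t))) 0 ≠ 0 := by rw [h2]; exact h3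
    exact mul_ne_zero two_ne_zero this
  · rw [((hd ρ cρ ρ0.ne').const_mul m).deriv]
    exact mul_ne_zero hm (div_ne_zero s1 ρ0.ne')
  · rw [so, ρe]; ring

lemma Dd_center {U : Set E4} (hU : IsOpen U) {Φ : E4 → ℝ} (h : ContDiffOn ℝ (⊤ : ℕ∞) Φ U) {x r : ℝ}
    (hz : (x, (0:ℝ), r, (0:ℝ)) ∈ U) :
    Dd eT Φ (x, 0, r, 0) = deriv (fun t => Φ (x, 0, r, t)) 0 ∧
    Dd eT (Dd eT Φ) (x, 0, r, 0) = deriv (deriv (fun t => Φ (x, 0, r, t))) 0 := by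
  have hZ : ∀ t : ℝ, HasDerivAt (fun t : ℝ => ((x, 0, r, t) : E4)) eT t := fun t =>
    (hasDerivAt_const t x).prodMk ((hasDerivAt_const t 0).prodMk ((hasDerivAt_const t r).prodMk (hasDerivAt_id t)))
  refine ⟨(Dd_hasDeriv hU h eT (hZ 0) hz).deriv.symm, ?_⟩
  rw [← (Dd_hasDeriv hU (Dd_smooth hU h eT) eT (hZ 0) hz).deriv]
  apply Filter.EventuallyEq.deriv_eq
  have : ∀ᶠ t : ℝ in nhds 0, ((x, 0, r, t) : E4) ∈ U := (hZ 0).continuousAt.eventually (hU.mem_nhds hz)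
  filter_upwards [this] with t ht
  exact (Dd_hasDeriv hU h eT (hZ t) ht).deriv.symm



def PA (r z₁ z₂ t : ℝ) : ℝ := √((z₁ + r * cos t) ^ 2 + (z₂ + r * sin t) ^ 2)
def PB (r u v t : ℝ) : ℝ := √((u + r * cos (v - t)) ^ 2 + (r * sin (v - t)) ^ 2)

lemma smooth_parts {U : Set E4} {w S S' : E4 → ℝ} (cw : ContDiff ℝ (⊤ : ℕ∞) w) (cS : ContDiff ℝ (⊤ : ℕ∞) S)
    (cS' : ContDiff ℝ (⊤ : ℕ∞) S') (hU : ∀ z ∈ U, 0 < w z) :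
    ContDiffOn ℝ (⊤ : ℕ∞) (fun z => √(w z ^ 2 + S' z ^ 2)) U ∧
    ContDiffOn ℝ (⊤ : ℕ∞) (fun z => -(S z * (S z / (√(w z ^ 2 + S' z ^ 2) * (√(w z ^ 2 + S' z ^ 2) + w z))))) U ∧
    ContDiffOn ℝ (⊤ : ℕ∞) (fun z => S z / √(w z ^ 2 + S' z ^ 2)) U := by
  have hp : ∀ z ∈ U, 0 < √(w z ^ 2 + S' z ^ 2) := fun z hz => by
    have := hU z hz; positivity
  have c : ContDiffOn ℝ (⊤ : ℕ∞) (fun z => √(w z ^ 2 + S' z ^ 2)) U := by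
    apply ContDiffOn.sqrt
    · exact ((cw.pow 2).add (cS'.pow 2)).contDiffOn
    · intro z hz
      have := hU z hz; positivity
  refine ⟨c, ?_, ?_⟩
  · refine (cS.contDiffOn.mul (cS.contDiffOn.div (c.mul (c.add cw.contDiffOn)) ?_)).neg
    intro z hz
    have := hU z hz
    have := hp z hz
    positivity
  · exact cS.contDiffOn.div c fun z hz => (hp z hz).ne'

lemma cos_ge_half {t : ℝ} (h : |t| ≤ 1) : 1 / 2 ≤ cos t := by
  have h1 := Real.one_sub_sq_div_two_le_cos (x := t)
  have : t ^ 2 ≤ 1 := by rw [← sq_abs]; exact pow_le_one₀ (abs_nonneg _) h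
  linarith

lemma chartA : ∃ τ₀ c K : ℝ, 0 < τ₀ ∧ 0 < c ∧ 0 ≤ K ∧ ∀ τ ≤ τ₀, ∀ r ∈ Icc (3 / 16 : ℝ) (4 / 3),
    Chart (-1 / 16) 2 (-τ) τ (Icc (-τ) τ) c K 1 (PA r) := by
  let w : E4 → ℝ := fun z => z.1 + z.2.2.1 * cos z.2.2.2
  let S : E4 → ℝ := fun z => z.2.1 + z.2.2.1 * sin z.2.2.2
  have cw : ContDiff ℝ (⊤ : ℕ∞) w := by simp only [w]; fun_prop
  have cS : ContDiff ℝ (⊤ : ℕ∞) S := by simp only [S]; fun_prop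
  let U : Set E4 := {z | 0 < w z}
  have hU : IsOpen U := isOpen_lt continuous_const cw.continuous
  obtain ⟨c1, c2, c3⟩ := smooth_parts (U := U) cw cS cS fun z hz => hz
  have c3' : ContDiffOn ℝ (⊤ : ℕ∞) (fun z => 1 * (S z / √(w z ^ 2 + S z ^ 2))) U := contDiffOn_const.mul c3
  obtain ⟨τ₀, c, K, h1, h2, h3, h4⟩ := chart_gen hU c2 c3' (a := -1 / 16) (b := 2) (r0 := 3 / 16) (r1 := 4 / 3) (by
    intro x hx r hr
    have hz : (x, (0:ℝ), r, (0:ℝ)) ∈ U := by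
      simp only [U, w, mem_ofPred_eq, cos_zero]; linarith [hx.1, hr.1]
    obtain ⟨q1, q2⟩ := Dd_center hU c2 hz
    obtain ⟨q3, q4⟩ := Dd_center hU c3' hz
    rw [q1, q2, q3, q4]
    have hι : ContDiff ℝ (⊤ : ℕ∞) (fun t : ℝ => ((x, 0, r, t) : E4)) := by fun_prop
    have hz' : (fun z => √(w z ^ 2 + S z ^ 2)) (x, (0:ℝ), r, (0:ℝ)) > 0 := by
      have : 0 < w (x, (0:ℝ), r, (0:ℝ)) := hz
      simp only; positivity
    refine ⟨hz, center_calc (s := fun t => S (x, 0, r, t)) (w := fun t => w (x, 0, r, t))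
      (ρ := fun t => √(w (x, 0, r, t) ^ 2 + S (x, 0, r, t) ^ 2)) (cS.comp hι).contDiffAt (cw.comp hι).contDiffAt
      (ContDiffAt.comp (g := fun z => √(w z ^ 2 + S z ^ 2)) (f := fun t : ℝ => ((x, 0, r, t) : E4)) (0:ℝ) (c1.contDiffAt (hU.mem_nhds hz)) hι.contDiffAt) ?_ ?_ ?_ ?_ hz hz' 1 one_ne_zero⟩
    · intro t; simp [S]
    · intro t; simp [w]
    · intro t; simp [w, S]
    · have : HasDerivAt (fun t => S (x, 0, r, t)) (r * cos 0) 0 := ((hasDerivAt_sin 0).const_mul r).const_add 0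
      rw [this.deriv, cos_zero]
      have := hr.1
      intro h; linarith)
  refine ⟨min τ₀ 1, c, K, lt_min h1 one_pos, h2, h3, ?_⟩
  intro τ hτ r hr
  have hr0 : 0 < r := by linarith [hr.1]
  have pos : ∀ x₁ ∈ Icc (-1 / 16 : ℝ) 2, ∀ x₂ ∈ Icc (-τ) τ, ∀ t ∈ Icc (-τ) τ, 0 < x₁ + r * cos t := by
    intro x₁ hx x₂ hx2 t ht
    have := cos_ge_half ((abs_le.2 ht).trans (hτ.trans (min_le_right _ _)))
    nlinarith [hr.1, hx.1]
  refine h4 τ (hτ.trans (min_le_left _ _)) r hr (PA r) (by unfold PA; fun_prop) 1 1 1 1 0 le_rfl le_rfl ?_ ?_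
  · intro x₁ hx x₂ hx2 t ht
    have hp := pos x₁ hx x₂ hx2 t ht
    unfold PA
    simp only [w, S]
    obtain ⟨W, hW⟩ : ∃ W, W = x₁ + r * cos t := ⟨_, rfl⟩
    obtain ⟨Y, hY⟩ : ∃ Y, Y = x₂ + r * sin t := ⟨_, rfl⟩
    rw [← hW, ← hY]
    rw [← hW] at hp
    have hR : 0 < W ^ 2 + Y ^ 2 := by positivity
    have hd : HasDerivAt (fun x => (x + r * cos t) ^ 2 + Y ^ 2) (2 * W) x₁ := by
      refine HasDerivAt.congr_deriv ((((hasDerivAt_id x₁).add_const (r * cos t)).pow 2).add_const (Y ^ 2)) ?_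
      simp [hW]
    refine HasDerivAt.congr_deriv (hd.sqrt (by rw [← hW]; exact hR.ne')) ?_
    rw [← hW]
    have hs := Real.sq_sqrt hR.le
    have hsp := Real.sqrt_pos.2 hR
    set R := √(W ^ 2 + Y ^ 2)
    field_simp
    nlinarith
  · intro x₁ hx x₂ hx2 t ht
    have hp := pos x₁ hx x₂ hx2 t ht
    unfold PA
    simp only [w, S]
    obtain ⟨W, hW⟩ : ∃ W, W = x₁ + r * cos t := ⟨_, rfl⟩
    obtain ⟨Y, hY⟩ : ∃ Y, Y = x₂ + r * sin t := ⟨_, rfl⟩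
    rw [← hW, ← hY]
    rw [← hW] at hp
    have hR : 0 < W ^ 2 + Y ^ 2 := by positivity
    have hd : HasDerivAt (fun x => W ^ 2 + (x + r * sin t) ^ 2) (2 * Y) x₂ := by
      refine HasDerivAt.congr_deriv ((((hasDerivAt_id x₂).add_const (r * sin t)).pow 2).const_add (W ^ 2)) ?_
      simp [hY]
    refine HasDerivAt.congr_deriv (hd.sqrt (by rw [← hY]; exact hR.ne')) ?_
    rw [← hY]
    have hsp := Real.sqrt_pos.2 hR
    field_simp
    ring

lemma chartB : ∃ τ₀ c K : ℝ, 0 < τ₀ ∧ 0 < c ∧ 0 ≤ K ∧ ∀ τ ≤ τ₀, ∀ r ∈ Icc (0 : ℝ) (3 / 16),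
    Chart (1 / 8) 2 (-τ) τ (Icc (-τ) τ) c K (r ^ 2) (PB r) := by
  let w : E4 → ℝ := fun z => z.1 + z.2.2.1 * cos (z.2.1 - z.2.2.2)
  let S : E4 → ℝ := fun z => sin (z.2.1 - z.2.2.2)
  let S' : E4 → ℝ := fun z => z.2.2.1 * sin (z.2.1 - z.2.2.2)
  have cw : ContDiff ℝ (⊤ : ℕ∞) w := by simp only [w]; fun_prop
  have cS : ContDiff ℝ (⊤ : ℕ∞) S := by simp only [S]; fun_prop
  have cS' : ContDiff ℝ (⊤ : ℕ∞) S' := by simp only [S']; fun_prop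
  let U : Set E4 := {z | 0 < w z}
  have hU : IsOpen U := isOpen_lt continuous_const cw.continuous
  obtain ⟨c1, c2, c3⟩ := smooth_parts (U := U) cw cS cS' fun z hz => hz
  have c3' : ContDiffOn ℝ (⊤ : ℕ∞) (fun z => (-z.1) * (S z / √(w z ^ 2 + S' z ^ 2))) U :=
    contDiff_fst.neg.contDiffOn.mul c3
  obtain ⟨τ₀, c, K, h1, h2, h3, h4⟩ := chart_gen hU c2 c3' (a := 1 / 8) (b := 2) (r0 := 0) (r1 := 3 / 16) (by
    intro x hx r hr
    have hz : (x, (0:ℝ), r, (0:ℝ)) ∈ U := by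
      simp only [U, w, mem_ofPred_eq, sub_zero, cos_zero]; linarith [hx.1, hr.1]
    obtain ⟨q1, q2⟩ := Dd_center hU c2 hz
    obtain ⟨q3, q4⟩ := Dd_center hU c3' hz
    rw [q1, q2, q3, q4]
    have hι : ContDiff ℝ (⊤ : ℕ∞) (fun t : ℝ => ((x, 0, r, t) : E4)) := by fun_prop
    have hz' : (fun z => √(w z ^ 2 + S' z ^ 2)) (x, (0:ℝ), r, (0:ℝ)) > 0 := by
      have : 0 < w (x, (0:ℝ), r, (0:ℝ)) := hz
      simp only; positivity
    refine ⟨hz, center_calc (s := fun t => S (x, 0, r, t)) (w := fun t => w (x, 0, r, t))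
      (ρ := fun t => √(w (x, 0, r, t) ^ 2 + S' (x, 0, r, t) ^ 2)) (cS.comp hι).contDiffAt (cw.comp hι).contDiffAt
      (ContDiffAt.comp (g := fun z => √(w z ^ 2 + S' z ^ 2)) (f := fun t : ℝ => ((x, 0, r, t) : E4)) (0:ℝ) (c1.contDiffAt (hU.mem_nhds hz)) hι.contDiffAt) ?_ ?_ ?_ ?_ hz hz' (-x) (by have := hx.1; intro h; linarith)⟩
    · intro t; simp [S]
    · intro t; simp [w]
    · intro t; simp [w, S']
    · have : HasDerivAt (fun t => S (x, 0, r, t)) (-1) 0 := by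
        refine HasDerivAt.congr_deriv ((((hasDerivAt_id (0:ℝ)).const_sub 0)).sin) ?_
        simp
      rw [this.deriv]
      norm_num)
  refine ⟨min τ₀ (1 / 2), c, K, lt_min h1 (by norm_num), h2, h3, ?_⟩
  intro τ hτ r hr
  have hr0 : 0 ≤ r := hr.1
  have pos : ∀ x₁ ∈ Icc (1 / 8 : ℝ) 2, ∀ x₂ ∈ Icc (-τ) τ, ∀ t ∈ Icc (-τ) τ, 0 < x₁ + r * cos (x₂ - t) := by
    intro x₁ hx x₂ hx2 t ht
    have hτ2 := hτ.trans (min_le_right _ _)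
    have := cos_ge_half (t := x₂ - t) (by rw [abs_le]; constructor <;> linarith [hx2.1, hx2.2, ht.1, ht.2])
    have : 0 ≤ r * cos (x₂ - t) := mul_nonneg hr0 (by linarith)
    linarith [hx.1]
  refine h4 τ (hτ.trans (min_le_left _ _)) r hr (PB r) (by unfold PB; fun_prop) (r ^ 2) (r ^ 2) r 1 0 le_rfl ?_ ?_ ?_
  · nlinarith [hr.2]
  · intro x₁ hx x₂ hx2 t ht
    have hp := pos x₁ hx x₂ hx2 t ht
    unfold PB
    simp only [w, S, S']
    obtain ⟨W, hW⟩ : ∃ W, W = x₁ + r * cos (x₂ - t) := ⟨_, rfl⟩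
    obtain ⟨Y, hY⟩ : ∃ Y, Y = sin (x₂ - t) := ⟨_, rfl⟩
    rw [← hW, ← hY]
    rw [← hW] at hp
    have hR : 0 < W ^ 2 + (r * Y) ^ 2 := by positivity
    have hd : HasDerivAt (fun x => (x + r * cos (x₂ - t)) ^ 2 + (r * Y) ^ 2) (2 * W) x₁ := by
      refine HasDerivAt.congr_deriv ((((hasDerivAt_id x₁).add_const (r * cos (x₂ - t))).pow 2).add_const ((r * Y) ^ 2)) ?_
      simp [hW]
    refine HasDerivAt.congr_deriv (hd.sqrt (by rw [← hW]; exact hR.ne')) ?_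
    rw [← hW]
    have hs := Real.sq_sqrt hR.le
    have hsp := Real.sqrt_pos.2 hR
    set R := √(W ^ 2 + (r * Y) ^ 2)
    field_simp
    nlinarith
  · intro x₁ hx x₂ hx2 t ht
    have hp := pos x₁ hx x₂ hx2 t ht
    unfold PB
    simp only [w, S, S']
    have hR : 0 < (x₁ + r * cos (x₂ - t)) ^ 2 + (r * sin (x₂ - t)) ^ 2 := by positivity
    have hd : HasDerivAt (fun x => (x₁ + r * cos (x - t)) ^ 2 + (r * sin (x - t)) ^ 2) (2 * (r * (-x₁ * sin (x₂ - t)))) x₂ := by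
      have t1 := (((((hasDerivAt_id x₂).sub_const t).cos.const_mul r).const_add x₁).pow 2)
      have t2 := (((((hasDerivAt_id x₂).sub_const t).sin.const_mul r)).pow 2)
      refine HasDerivAt.congr_deriv (t1.add t2) ?_
      simp
      ring
    refine HasDerivAt.congr_deriv (hd.sqrt hR.ne') ?_
    have hsp := Real.sqrt_pos.2 hR
    field_simp
    ring



/-- Region of `(u, v)`. -/
def Rg (τ r : ℝ) : Set (ℝ × ℝ) := {x | x.1 ∈ Ioc (0:ℝ) (4 / 3) ∧ 3 / 8 ≤ x.1 + r ∧ x.2 ∈ Icc (-τ) τ}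

lemma Rg_meas (τ r : ℝ) : MeasurableSet (Rg τ r) := by
  have : Rg τ r = (Prod.fst ⁻¹' Ioc (0:ℝ) (4 / 3)) ∩ ({x | 3 / 8 ≤ x.1 + r} ∩ Prod.snd ⁻¹' Icc (-τ) τ) := by
    ext x; simp [Rg]
  rw [this]
  exact (measurable_fst measurableSet_Ioc).inter ((measurableSet_le measurable_const (by fun_prop)).inter
    (measurable_snd measurableSet_Icc))

/-- The oscillatory operator. -/
def EM (r M : ℝ) (g : ℝ → ℂ) (x : ℝ × ℝ) : ℂ :=
  ∫ t, Complex.exp (Complex.I * ((M * PB r x.1 x.2 t : ℝ) : ℂ)) * g t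

lemma PB_eq_PA (r u v t : ℝ) : PB r u v t = PA r (u * cos v) (u * sin v) t := by
  unfold PB PA
  congr 1
  rw [cos_sub, sin_sub]
  have h1 := sin_sq_add_cos_sq v
  have h2 := sin_sq_add_cos_sq t
  have h3 : sin v ^ 2 = 1 - cos v ^ 2 := by linarith
  have h4 : sin t ^ 2 = 1 - cos t ^ 2 := by linarith
  ring_nf
  simp only [h3, h4]
  ring

lemma EM_cont_meas {r M : ℝ} {g : ℝ → ℂ} (hg : Measurable g) : Measurable (EM r M g) := by
  unfold EM
  have c : Continuous fun q : (ℝ × ℝ) × ℝ => Complex.exp (Complex.I * ((M * PB r q.1.1 q.1.2 q.2 : ℝ) : ℂ)) := by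
    unfold PB; fun_prop
  exact (c.measurable.mul (hg.comp measurable_snd)).stronglyMeasurable.integral_prod_right.measurable

lemma smoothE : ∃ τ₀ : ℝ, 0 < τ₀ ∧ τ₀ ≤ 1 ∧ ∀ τ : ℝ, 0 < τ → τ ≤ τ₀ → ∀ p : ℝ, 4 < p → ∃ C : ℝ≥0, 0 < C ∧
    ∀ r M α ℓ : ℝ, 0 < r → r ≤ 4 / 3 → 0 < M → 0 < ℓ → Icc α (α + 2 * ℓ) ⊆ Icc (-τ) τ →
    ∀ g : ℝ → ℂ, Measurable g → (∀ t, t ∉ Icc α (α + ℓ) → g t = 0) →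
    ∫⁻ x in Rg (τ / 4) r, ‖EM r M g x‖ₑ ^ p * ENNReal.ofReal x.1 ≤
      C * ENNReal.ofReal ((M * r ^ 2)⁻¹ ^ 2) * (ENNReal.ofReal ℓ ^ (p - 4) * ∫⁻ t, ‖g t‖ₑ ^ p) := by
  obtain ⟨τA, cA, KA, hA1, hA2, hA3, hA⟩ := chartA
  obtain ⟨τB, cB, KB, hB1, hB2, hB3, hB⟩ := chartB
  refine ⟨min (min τA τB) 1, lt_min (lt_min hA1 hB1) one_pos, min_le_right _ _, ?_⟩
  intro τ hτ0 hτ p hp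
  have hτA : τ ≤ τA := hτ.trans ((min_le_left _ _).trans (min_le_left _ _))
  have hτB : τ ≤ τB := hτ.trans ((min_le_left _ _).trans (min_le_right _ _))
  have hτ1 : τ ≤ 1 := hτ.trans (min_le_right _ _)
  have hp0 : 0 < p := by linarith
  obtain ⟨C1, hC1, H1⟩ := chart_Lp hp (a₁ := -1 / 16) (b₁ := 2) (a₂ := -τ) (b₂ := τ) (a₁' := 0) (b₁' := 3 / 2)
    (a₂' := -τ / 2) (b₂' := τ / 2) (c := cA) (K := KA) (by norm_num) (by linarith) (by norm_num) (by norm_num)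
    (by linarith) (by linarith) hA2 hA3
  obtain ⟨C2, hC2, H2⟩ := chart_Lp hp (a₁ := 1 / 8) (b₁ := 2) (a₂ := -τ) (b₂ := τ) (a₁' := 3 / 16) (b₁' := 3 / 2)
    (a₂' := -τ / 2) (b₂' := τ / 2) (c := cB) (K := KB) (by norm_num) (by linarith) (by norm_num) (by norm_num)
    (by linarith) (by linarith) hB2 hB3
  refine ⟨4 * C1 + 2 * C2, by positivity, ?_⟩
  intro r M α ℓ hr0 hr1 hM hℓ hJ g hg hgs
  have hMr : 0 < M * r ^ 2 := by positivity
  rcases le_or_gt (3 / 16) r with hr | hr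
  · have T := H1 1 (Icc (-τ) τ) (PA r) one_pos (convex_Icc _ _) (hA τ hτA r ⟨hr, hr1⟩) M α ℓ hM hℓ hJ g hg hgs
    set B : Set (ℝ × ℝ) := Icc 0 (3 / 2) ×ˢ Icc (-τ / 2) (τ / 2) with hBdef
    let F : ℝ × ℝ → ℝ≥0∞ := fun z => ‖∫ t, Complex.exp (Complex.I * ((M * PA r z.1 z.2 t : ℝ) : ℂ)) * g t‖ₑ ^ p
    have mB : MeasurableSet B := measurableSet_Icc.prod measurableSet_Icc
    have step : ∫⁻ x in Rg (τ / 4) r, ‖EM r M g x‖ₑ ^ p * ENNReal.ofReal x.1 ≤ ∫⁻ z in B, F z := by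
      have hsub : Rg (τ / 4) r ⊆ polarCoord.target := by
        rintro x ⟨h1, h2, h3⟩
        rw [polarCoord_target]
        have := Real.pi_gt_three
        exact ⟨h1.1, by linarith [h3.1], by linarith [h3.2]⟩
      rw [← lintegral_indicator mB, ← lintegral_comp_polarCoord_symm]
      refine le_trans ?_ (lintegral_mono_set hsub)
      apply setLIntegral_mono_ae' (Rg_meas _ _)
      refine ae_of_all _ fun x hx => ?_
      obtain ⟨h1, h2, h3⟩ := hx
      have hv1 : |x.2| ≤ 1 := by rw [abs_le]; constructor <;> linarith [h3.1, h3.2]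
      have hc := cos_ge_half hv1
      have hsn : |sin x.2| ≤ τ / 4 := (Real.abs_sin_le_abs).trans (abs_le.2 ⟨by linarith [h3.1], by linarith [h3.2]⟩)
      have hmem : polarCoord.symm x ∈ B := by
        rw [polarCoord_symm_apply]
        refine ⟨⟨mul_nonneg h1.1.le (by linarith), ?_⟩, ?_⟩
        · simp only
          have := Real.cos_le_one x.2
          nlinarith [h1.1, h1.2]
        · have : |x.1 * sin x.2| ≤ τ / 2 := by
            rw [abs_mul, abs_of_pos h1.1]
            nlinarith [h1.1, h1.2, abs_nonneg (sin x.2)]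
          have := abs_le.1 this
          exact ⟨by simp only; linarith [this.1], this.2⟩
      rw [indicator_of_mem hmem, smul_eq_mul, mul_comm]
      simp only [F, EM, polarCoord_symm_apply, PB_eq_PA]
      exact le_rfl
    refine step.trans (T.trans ?_)
    refine mul_le_mul_left ?_ _
    push_cast
    have : ENNReal.ofReal ((M * 1)⁻¹ ^ 2) ≤ 4 * ENNReal.ofReal ((M * r ^ 2)⁻¹ ^ 2) := by
      rw [show (4 : ℝ≥0∞) = ENNReal.ofReal 4 by simp, ← ENNReal.ofReal_mul (by norm_num)]
      apply ENNReal.ofReal_le_ofReal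
      rw [mul_one, inv_pow, inv_pow, mul_pow, mul_inv]
      have h5 : 1 ≤ 4 * ((r ^ 2) ^ 2)⁻¹ := by
        rw [← div_eq_mul_inv, one_le_div (by positivity)]
        have : r ^ 2 ≤ 16 / 9 := by nlinarith
        nlinarith [sq_nonneg r]
      have h6 : 0 ≤ (M ^ 2)⁻¹ := by positivity
      nlinarith
    calc (C1 : ℝ≥0∞) * ENNReal.ofReal ((M * 1)⁻¹ ^ 2) ≤ C1 * (4 * ENNReal.ofReal ((M * r ^ 2)⁻¹ ^ 2)) :=
          mul_le_mul_right this _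
      _ = 4 * C1 * ENNReal.ofReal ((M * r ^ 2)⁻¹ ^ 2) := by ring
      _ ≤ _ := mul_le_mul_left le_self_add _
  · have T := H2 (r ^ 2) (Icc (-τ) τ) (PB r) (by positivity) (convex_Icc _ _) (hB τ hτB r ⟨hr0.le, hr.le⟩) M α ℓ hM hℓ hJ g hg hgs
    have hsub : Rg (τ / 4) r ⊆ Icc (3 / 16) (3 / 2) ×ˢ Icc (-τ / 2) (τ / 2) := by
      rintro x ⟨h1, h2, h3⟩
      exact ⟨⟨by linarith, by linarith [h1.2]⟩, ⟨by linarith [h3.1], by linarith [h3.2]⟩⟩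
    calc ∫⁻ x in Rg (τ / 4) r, ‖EM r M g x‖ₑ ^ p * ENNReal.ofReal x.1
        ≤ ∫⁻ x in Rg (τ / 4) r, 2 * ‖EM r M g x‖ₑ ^ p := by
          apply setLIntegral_mono_ae' (Rg_meas _ _)
          refine ae_of_all _ fun x hx => ?_
          rw [mul_comm]
          gcongr
          rw [show (2 : ℝ≥0∞) = ENNReal.ofReal 2 by simp]
          apply ENNReal.ofReal_le_ofReal
          linarith [hx.1.2]
      _ ≤ ∫⁻ x in Icc (3 / 16) (3 / 2) ×ˢ Icc (-τ / 2) (τ / 2), 2 * ‖EM r M g x‖ₑ ^ p := lintegral_mono_set hsub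
      _ = 2 * ∫⁻ x in Icc (3 / 16) (3 / 2) ×ˢ Icc (-τ / 2) (τ / 2), ‖EM r M g x‖ₑ ^ p := by
          rw [lintegral_const_mul _ ((EM_cont_meas hg).enorm.pow_const _)]
      _ ≤ 2 * (C2 * ENNReal.ofReal ((M * r ^ 2)⁻¹ ^ 2) * (ENNReal.ofReal ℓ ^ (p - 4) * ∫⁻ t, ‖g t‖ₑ ^ p)) :=
          mul_le_mul_right T _
      _ = 2 * C2 * (ENNReal.ofReal ((M * r ^ 2)⁻¹ ^ 2) * (ENNReal.ofReal ℓ ^ (p - 4) * ∫⁻ t, ‖g t‖ₑ ^ p)) := by ring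
      _ ≤ _ := by
          rw [← mul_assoc]
          refine mul_le_mul_left (mul_le_mul_left ?_ _) _
          push_cast
          exact le_add_self



/-- dyadic index -/
def Nd (a L : ℝ) (m : ℕ) (s : ℝ) : ℤ := ⌊(2:ℝ) ^ m * ((s - a) / L)⌋

lemma Nd_half (a L : ℝ) (m : ℕ) (s : ℝ) : Nd a L m s = Nd a L (m + 1) s / 2 := by
  unfold Nd
  rw [pow_succ]
  have := Int.floor_div_natCast ((2:ℝ) ^ m * 2 * ((s - a) / L)) 2
  push_cast at this
  rw [← this]
  congr 1
  ring

lemma Nd_mono {a L : ℝ} (hL : 0 < L) (m : ℕ) {s t : ℝ} (h : s ≤ t) : Nd a L m s ≤ Nd a L m t := by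
  unfold Nd
  gcongr

lemma Nd_mem {a L : ℝ} (hL : 0 < L) {m : ℕ} {s : ℝ} {i : ℤ} (h : Nd a L m s = i) :
    s ∈ Icc (a + L * i * (1 / 2) ^ m) (a + L * i * (1 / 2) ^ m + L * (1 / 2) ^ m) := by
  unfold Nd at h
  rw [Int.floor_eq_iff] at h
  obtain ⟨h1, h2⟩ := h
  have h2m : (0:ℝ) < 2 ^ m := by positivity
  have e : (2:ℝ) ^ m * (1 / 2) ^ m = 1 := by rw [← mul_pow]; norm_num
  have e1 : s - a = ((2:ℝ) ^ m * ((s - a) / L)) * (L * (1 / 2) ^ m) := by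
    calc s - a = (s - a) * ((2:ℝ) ^ m * (1 / 2) ^ m) := by rw [e, mul_one]
      _ = _ := by field_simp
  have h3 : 0 < L * (1 / 2) ^ m := by positivity
  constructor
  · nlinarith
  · nlinarith

lemma Nd_meas (a L : ℝ) (m : ℕ) : Measurable (Nd a L m) := by
  unfold Nd
  exact Int.measurable_floor.comp (by fun_prop)

lemma Nd_eq_of_le {a L : ℝ} {m m' : ℕ} (h : m ≤ m') {s t : ℝ} (e : Nd a L m' s = Nd a L m' t) :
    Nd a L m s = Nd a L m t := by
  induction m', h using Nat.le_induction with
  | base => exact e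
  | succ k hk ih =>
    apply ih
    rw [Nd_half a L k s, Nd_half a L k t, e]

def Sd (a L : ℝ) (m : ℕ) (v : ℝ) : Set ℝ :=
  {t | t ∈ Ico a (a + L) ∧ Nd a L m t = Nd a L m v ∧ Nd a L (m + 1) v < Nd a L (m + 1) t}

lemma Sd_meas (a L : ℝ) (m : ℕ) (v : ℝ) : MeasurableSet (Sd a L m v) := by
  have : Sd a L m v = Ico a (a + L) ∩ ((Nd a L m ⁻¹' {Nd a L m v}) ∩ (Nd a L (m + 1) ⁻¹' Ioi (Nd a L (m + 1) v))) := by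
    ext t; simp [Sd]
  rw [this]
  exact measurableSet_Ico.inter ((Nd_meas a L m (measurableSet_singleton _)).inter (Nd_meas a L (m + 1) measurableSet_Ioi))

lemma Sd_disj (a L : ℝ) (v : ℝ) : Pairwise (Function.onFun Disjoint fun m => Sd a L m v) := by
  have key : ∀ m m', m < m' → Disjoint (Sd a L m v) (Sd a L m' v) := by
    intro m m' h
    rw [Set.disjoint_left]
    rintro t ⟨_, _, h1⟩ ⟨_, h2, _⟩
    exact absurd (Nd_eq_of_le (m := m + 1) h h2) (ne_of_gt h1)
  intro m n h
  rcases lt_or_gt_of_ne h with h | h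
  · exact key m n h
  · exact (key n m h).symm

lemma Nd_zero {a L : ℝ} (hL : 0 < L) {s : ℝ} (hs : s ∈ Ico a (a + L)) : Nd a L 0 s = 0 := by
  unfold Nd
  rw [Int.floor_eq_iff]
  have h1 := hs.1
  have h2 := hs.2
  constructor
  · simp only [pow_zero, one_mul, Int.cast_zero]
    exact div_nonneg (by linarith) hL.le
  · simp only [pow_zero, one_mul, Int.cast_zero, zero_add]
    rw [div_lt_one hL]; linarith

lemma Sd_union {a L : ℝ} (hL : 0 < L) {v : ℝ} (hv : v ∈ Ico a (a + L)) :
    ⋃ m, Sd a L m v = Ioi v ∩ Ico a (a + L) := by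
  ext t
  simp only [mem_iUnion, mem_inter_iff, mem_Ioi]
  constructor
  · rintro ⟨m, h1, h2, h3⟩
    refine ⟨?_, h1⟩
    by_contra h
    exact absurd (Nd_mono (a := a) hL (m + 1) (not_lt.1 h)) (not_le.2 h3)
  · rintro ⟨h1, h2⟩
    have hex : ∃ m, Nd a L m v ≠ Nd a L m t := by
      obtain ⟨m, hm⟩ := pow_unbounded_of_one_lt (L / (t - v)) (one_lt_two)
      refine ⟨m, fun e => ?_⟩
      have q1 := Nd_mem (a := a) hL (m := m) (s := v) rfl
      have q2 := Nd_mem (a := a) hL (m := m) (s := t) e.symm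
      have : t - v ≤ L * (1 / 2) ^ m := by linarith [q1.1, q2.2]
      have htv : 0 < t - v := by linarith
      rw [div_lt_iff₀ htv] at hm
      have e1 : (2:ℝ) ^ m * (1 / 2) ^ m = 1 := by rw [← mul_pow]; norm_num
      have : (2:ℝ) ^ m * (t - v) ≤ 2 ^ m * (L * (1 / 2) ^ m) := by gcongr
      have : (2:ℝ) ^ m * (L * (1 / 2) ^ m) = L := by
        calc (2:ℝ) ^ m * (L * (1 / 2) ^ m) = L * ((2:ℝ) ^ m * (1 / 2) ^ m) := by ring
          _ = L := by rw [e1, mul_one]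
      linarith
    classical
    set m := Nat.find hex with hm
    have hm0 : m ≠ 0 := by
      intro h
      have := Nat.find_spec hex
      rw [← hm, h, Nd_zero hL hv, Nd_zero hL h2] at this
      exact this rfl
    obtain ⟨k, hk⟩ := Nat.exists_eq_succ_of_ne_zero hm0
    refine ⟨k, h2, ?_, ?_⟩
    · have := Nat.find_min hex (m := k) (by omega)
      exact (not_not.1 this).symm
    · have := Nat.find_spec hex
      rw [← hm, hk] at this
      exact lt_of_le_of_ne (Nd_mono hL _ h1.le) this

lemma Sd_cell (a L : ℝ) (m : ℕ) (v : ℝ) :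
    Sd a L m v = ∅ ∨ Sd a L m v = Ico a (a + L) ∩ {t | Nd a L (m + 1) t = Nd a L (m + 1) v + 1} := by
  by_cases h : Nd a L (m + 1) v % 2 = 0
  · right
    ext t
    simp only [Sd, mem_inter_iff]
    refine and_congr_right fun _ => ?_
    change (Nd a L m t = Nd a L m v ∧ _) ↔ Nd a L (m + 1) t = _
    rw [Nd_half a L m t, Nd_half a L m v]
    omega
  · left
    ext t
    simp only [Sd, mem_empty_iff_false, iff_false]
    rintro ⟨_, h1, h2⟩
    rw [Nd_half a L m t, Nd_half a L m v] at h1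
    omega

def EJ (r M : ℝ) (g : ℝ → ℂ) (x : ℝ × ℝ) : ℂ :=
  ∫ t in Ici x.2, Complex.exp (Complex.I * ((M * PB r x.1 x.2 t : ℝ) : ℂ)) * g t

/-- restriction to a cell -/
def gc (a L : ℝ) (m : ℕ) (i : ℤ) (g : ℝ → ℂ) : ℝ → ℂ := (Nd a L m ⁻¹' {i}).indicator g

lemma EJ_le {r M a L : ℝ} (hL : 0 < L) {g : ℝ → ℂ} (hgi : Integrable g)
    (hgs : ∀ t, t ∉ Ico a (a + L) → g t = 0) {x : ℝ × ℝ} (hx : x.2 ∈ Ico a (a + L)) :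
    ∃ i : ℕ → ℤ, ‖EJ r M g x‖ₑ ≤ ∑' m : ℕ, ‖EM r M (gc a L (m + 1) (i m) g) x‖ₑ := by
  refine ⟨fun m => Nd a L (m + 1) x.2 + 1, ?_⟩
  set h : ℝ → ℂ := fun t => Complex.exp (Complex.I * ((M * PB r x.1 x.2 t : ℝ) : ℂ)) * g t with hh
  have ih : Integrable h := by
    refine hgi.bdd_mul (c := 1) ?_ ?_
    · apply Continuous.aestronglyMeasurable
      unfold PB; fun_prop
    · refine ae_of_all _ fun t => ?_
      rw [mul_comm Complex.I, Complex.norm_exp_ofReal_mul_I]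
  have e1 : EJ r M g x = ∫ t in Ioi x.2 ∩ Ico a (a + L), h t := by
    unfold EJ
    rw [integral_Ici_eq_integral_Ioi]
    refine setIntegral_eq_of_subset_of_forall_sdiff_eq_zero measurableSet_Ioi inter_subset_left ?_
    rintro t ⟨h1, h2⟩
    rw [hgs t (fun h3 => h2 ⟨h1, h3⟩), mul_zero]
  have e2 : HasSum (fun m => ∫ t in Sd a L m x.2, h t) (∫ t in Ioi x.2 ∩ Ico a (a + L), h t) := by
    rw [← Sd_union hL hx]
    exact hasSum_integral_iUnion (fun m => Sd_meas a L m _) (Sd_disj a L _) ih.integrableOn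
  rw [e1, ← e2.tsum_eq]
  refine enorm_tsum_le_tsum_enorm.trans (ENNReal.tsum_le_tsum fun m => ?_)
  rcases Sd_cell a L m x.2 with h0 | h0
  · rw [h0]; simp
  · have mc : MeasurableSet {t | Nd a L (m + 1) t = Nd a L (m + 1) x.2 + 1} := Nd_meas a L (m + 1) (measurableSet_singleton _)
    have : ∫ t in Sd a L m x.2, h t = EM r M (gc a L (m + 1) (Nd a L (m + 1) x.2 + 1) g) x := by
      rw [h0, ← integral_indicator (measurableSet_Ico.inter mc)]
      unfold EM
      congr 1
      ext t
      by_cases h1 : Nd a L (m + 1) t = Nd a L (m + 1) x.2 + 1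
      · by_cases h2 : t ∈ Ico a (a + L)
        · rw [indicator_of_mem (show t ∈ Ico a (a + L) ∩ {t | Nd a L (m + 1) t = Nd a L (m + 1) x.2 + 1} from ⟨h2, h1⟩), gc, indicator_of_mem (by exact h1)]
        · rw [indicator_of_notMem (show t ∉ Ico a (a + L) ∩ {t | Nd a L (m + 1) t = Nd a L (m + 1) x.2 + 1} from fun h => h2 h.1), gc, indicator_of_mem (by exact h1), hgs t h2, mul_zero]
      · rw [indicator_of_notMem (show t ∉ Ico a (a + L) ∩ {t | Nd a L (m + 1) t = Nd a L (m + 1) x.2 + 1} from fun h => h1 h.2), gc, indicator_of_notMem (by exact h1), mul_zero]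
    rw [this]



lemma gc_meas {a L : ℝ} {m : ℕ} {i : ℤ} {g : ℝ → ℂ} (hg : Measurable g) : Measurable (gc a L m i g) :=
  hg.indicator (Nd_meas a L m (measurableSet_singleton _))

lemma gc_sum {a L : ℝ} {m : ℕ} {g : ℝ → ℂ} (hg : Measurable g) {p : ℝ} (hp : 0 < p) :
    ∑' i : ℤ, ∫⁻ t, ‖gc a L m i g t‖ₑ ^ p = ∫⁻ t, ‖g t‖ₑ ^ p := by
  rw [← lintegral_tsum]
  · refine lintegral_congr fun t => ?_
    rw [tsum_eq_single (Nd a L m t)]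
    · unfold gc
      rw [indicator_of_mem (by exact rfl)]
    · intro i hi
      unfold gc
      rw [indicator_of_notMem (by intro h; exact hi h.symm)]
      simp [hp]
  · intro i
    exact ((gc_meas hg).enorm.pow_const p).aemeasurable

lemma integrable_of_Lp {g : ℝ → ℂ} (hg : Measurable g) {α ℓ : ℝ} (hℓ : 0 < ℓ)
    (hs : ∀ t, t ∉ Icc α (α + ℓ) → g t = 0) {p : ℝ} (hp : 1 < p) (hf : ∫⁻ t, ‖g t‖ₑ ^ p ≠ ⊤) :
    Integrable g := by
  have h := holder_supp hg hℓ hs (n := 1) one_pos hp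
  refine ⟨hg.aestronglyMeasurable, ?_⟩
  unfold HasFiniteIntegral
  simp only [ENNReal.rpow_one, div_one] at h
  have h2 : (∫⁻ t, ‖g t‖ₑ) ^ p < ⊤ := by
    refine lt_of_le_of_lt h (ENNReal.mul_lt_top ?_ (lt_top_iff_ne_top.2 hf))
    exact ENNReal.rpow_lt_top_of_nonneg (by linarith) ENNReal.ofReal_ne_top
  rw [ENNReal.rpow_lt_top_iff_of_pos (by linarith)] at h2
  exact h2

lemma jump_Lp : ∃ τ₁ : ℝ, 0 < τ₁ ∧ τ₁ ≤ 1 / 4 ∧ ∀ p : ℝ, 4 < p → ∃ C : ℝ≥0, 0 < C ∧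
    ∀ r M : ℝ, 0 < r → r ≤ 4 / 3 → 0 < M →
    ∀ g : ℝ → ℂ, Measurable g → (∀ t, t ∉ Icc (-τ₁) τ₁ → g t = 0) →
    ∫⁻ x in Rg τ₁ r, ‖EJ r M g x‖ₑ ^ p * ENNReal.ofReal x.1 ≤
      C * ENNReal.ofReal ((M * r ^ 2)⁻¹ ^ 2) * ∫⁻ t, ‖g t‖ₑ ^ p := by
  obtain ⟨τ, hτ0, hτ1, HS⟩ := smoothE
  refine ⟨τ / 4, by positivity, by linarith, ?_⟩
  intro p hp
  have hp0 : 0 < p := by linarith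
  obtain ⟨C, hC, H⟩ := HS τ hτ0 le_rfl p hp
  set q : ℝ≥0∞ := (1 / 2 : ℝ≥0∞) ^ ((p - 4) / 2) with hq
  have hhalf : (1 / 2 : ℝ≥0∞) < 1 := by simp
  have hhalf0 : (1 / 2 : ℝ≥0∞) ≠ 0 := by simp
  have hq0 : q ≠ 0 := by
    rw [hq, Ne, ENNReal.rpow_eq_zero_iff]
    rintro (⟨h, _⟩ | ⟨h, _⟩)
    · exact hhalf0 h
    · exact hhalf.ne_top h
  have hq1 : q < 1 := ENNReal.rpow_lt_one hhalf (by linarith)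
  have hqt : q ≠ ⊤ := hq1.ne_top
  obtain ⟨W, hW⟩ := jensen_geo (q := p) (by linarith) hq0 hq1
  have hg1 : (1 - q)⁻¹ ≠ ⊤ := by
    rw [Ne, ENNReal.inv_eq_top, tsub_eq_zero_iff_le, not_le]; exact hq1
  refine ⟨W * C * (1 - q)⁻¹.toNNReal + 1, by positivity, ?_⟩
  intro r M hr0 hr1 hM g hg hgs
  set Q := ENNReal.ofReal ((M * r ^ 2)⁻¹ ^ 2) with hQ
  have hQ0 : Q ≠ 0 := by
    rw [hQ, Ne, ENNReal.ofReal_eq_zero, not_le]; positivity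
  set G := ∫⁻ t, ‖g t‖ₑ ^ p with hG
  by_cases hGt : G = ⊤
  · rw [hGt, ENNReal.mul_top]
    · exact le_top
    · refine mul_ne_zero ?_ hQ0
      simp
  have hgi : Integrable g := integrable_of_Lp hg (α := -(τ / 4)) (ℓ := τ / 2) (by positivity)
    (fun t ht => hgs t (fun h => ht ⟨h.1, by linarith [h.2]⟩)) (by linarith) hGt
  set a := -(τ / 4) with ha
  set L := 5 * τ / 8 with hL
  have hL0 : 0 < L := by positivity
  have hgs' : ∀ t, t ∉ Ico a (a + L) → g t = 0 := by
    intro t ht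
    exact hgs t (fun h => ht ⟨h.1, by have := h.2; rw [ha, hL]; linarith⟩)
  have pt : ∀ x ∈ Rg (τ / 4) r, ‖EJ r M g x‖ₑ ^ p * ENNReal.ofReal x.1 ≤
      W * ∑' m : ℕ, (q ^ m)⁻¹ * ∑' i : ℤ, ‖EM r M (gc a L (m + 1) i g) x‖ₑ ^ p * ENNReal.ofReal x.1 := by
    intro x hx
    have hx2 := hx.2.2
    obtain ⟨i, hi⟩ := EJ_le (r := r) (M := M) hL0 hgi hgs' (x := x)
      ⟨hx2.1, by have := hx2.2; rw [ha, hL]; linarith⟩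
    calc ‖EJ r M g x‖ₑ ^ p * ENNReal.ofReal x.1
        ≤ (∑' m : ℕ, ‖EM r M (gc a L (m + 1) (i m) g) x‖ₑ) ^ p * ENNReal.ofReal x.1 :=
          mul_le_mul_left (ENNReal.rpow_le_rpow hi hp0.le) _
      _ ≤ (W * ∑' m : ℕ, (q ^ m)⁻¹ * ‖EM r M (gc a L (m + 1) (i m) g) x‖ₑ ^ p) * ENNReal.ofReal x.1 :=
          mul_le_mul_left (hW _) _
      _ = W * ∑' m : ℕ, (q ^ m)⁻¹ * (‖EM r M (gc a L (m + 1) (i m) g) x‖ₑ ^ p * ENNReal.ofReal x.1) := by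
          rw [mul_assoc, ← ENNReal.tsum_mul_right]
          simp only [mul_assoc]
      _ ≤ _ := by
          refine mul_le_mul_right (ENNReal.tsum_le_tsum fun m => mul_le_mul_right ?_ _) _
          exact ENNReal.le_tsum (f := fun i => ‖EM r M (gc a L (m + 1) i g) x‖ₑ ^ p * ENNReal.ofReal x.1) (i m)
  have hmeas : ∀ (m : ℕ) (i : ℤ), Measurable fun x : ℝ × ℝ => ‖EM r M (gc a L (m + 1) i g) x‖ₑ ^ p * ENNReal.ofReal x.1 := by
    intro m i
    exact ((EM_cont_meas (gc_meas hg)).enorm.pow_const p).mul (by fun_prop)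
  have cell : ∀ (m : ℕ) (i : ℤ), ∫⁻ x in Rg (τ / 4) r, ‖EM r M (gc a L (m + 1) i g) x‖ₑ ^ p * ENNReal.ofReal x.1 ≤
      C * Q * ((q * q) ^ m * ∫⁻ t, ‖gc a L (m + 1) i g t‖ₑ ^ p) := by
    intro m i
    by_cases hz : ∀ t, gc a L (m + 1) i g t = 0
    · have : ∀ x, EM r M (gc a L (m + 1) i g) x = 0 := by
        intro x; unfold EM; simp [hz]
      simp [this, hp0]
    · rw [not_forall] at hz
      obtain ⟨t, ht⟩ := hz
      have ht1 : Nd a L (m + 1) t = i := by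
        by_contra h
        exact ht (by unfold gc; rw [indicator_of_notMem (by exact h)])
      have ht2 : t ∈ Ico a (a + L) := by
        by_contra h
        apply ht
        unfold gc; rw [indicator_of_mem (by exact ht1), hgs' t h]
      have hm := Nd_mem hL0 ht1
      have hpow : (1 / 2 : ℝ) ^ (m + 1) ≤ 1 / 2 := by
        rw [pow_succ]
        have : (1 / 2 : ℝ) ^ m ≤ 1 := pow_le_one₀ (by norm_num) (by norm_num)
        linarith
      have hℓ : 0 < L * (1 / 2) ^ (m + 1) := by positivity
      have hℓ2 : L * (1 / 2) ^ (m + 1) ≤ L * (1 / 2) := by gcongr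
      refine (H r M (a + L * i * (1 / 2) ^ (m + 1)) (L * (1 / 2) ^ (m + 1)) hr0 hr1 hM hℓ ?_ _ (gc_meas hg) ?_).trans ?_
      · apply Icc_subset_Icc
        · have := hm.2; have := ht2.1; nlinarith [ha, hL, hℓ2, hτ0]
        · have := hm.1; have := ht2.2; nlinarith [ha, hL, hℓ2, hτ0]
      · intro s hs
        unfold gc
        rw [indicator_of_notMem]
        intro h
        exact hs (Nd_mem hL0 h)
      · refine mul_le_mul_right (mul_le_mul_left ?_ _) _
        have e1 : q * q = (1 / 2 : ℝ≥0∞) ^ (p - 4) := by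
          rw [hq, ← ENNReal.rpow_add _ _ hhalf0 hhalf.ne_top]; congr 1; ring
        rw [e1, ← ENNReal.rpow_natCast, ← ENNReal.rpow_mul, mul_comm (p - 4) (m:ℝ), ENNReal.rpow_mul]
        refine ENNReal.rpow_le_rpow ?_ (by linarith)
        rw [ENNReal.rpow_natCast]
        have : (1 / 2 : ℝ≥0∞) = ENNReal.ofReal (1 / 2) := by
          rw [ENNReal.ofReal_div_of_pos two_pos]; simp
        rw [this, ← ENNReal.ofReal_pow (by norm_num)]
        apply ENNReal.ofReal_le_ofReal
        rw [pow_succ]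
        have : (0:ℝ) < (1 / 2 : ℝ) ^ m := by positivity
        rw [hL]
        nlinarith
  calc ∫⁻ x in Rg (τ / 4) r, ‖EJ r M g x‖ₑ ^ p * ENNReal.ofReal x.1
      ≤ ∫⁻ x in Rg (τ / 4) r, W * ∑' m : ℕ, (q ^ m)⁻¹ * ∑' i : ℤ, ‖EM r M (gc a L (m + 1) i g) x‖ₑ ^ p * ENNReal.ofReal x.1 :=
        setLIntegral_mono_ae' (Rg_meas _ _) (ae_of_all _ pt)
    _ = W * ∑' m : ℕ, (q ^ m)⁻¹ * ∑' i : ℤ, ∫⁻ x in Rg (τ / 4) r, ‖EM r M (gc a L (m + 1) i g) x‖ₑ ^ p * ENNReal.ofReal x.1 := by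
        have m1 : ∀ m : ℕ, Measurable fun x : ℝ × ℝ => ∑' i : ℤ, ‖EM r M (gc a L (m + 1) i g) x‖ₑ ^ p * ENNReal.ofReal x.1 :=
          fun m => Measurable.tsum (hmeas m)
        rw [lintegral_const_mul _ (Measurable.tsum fun m => (m1 m).const_mul _),
          lintegral_tsum (fun m => ((m1 m).const_mul _).aemeasurable)]
        congr 2
        ext m
        rw [lintegral_const_mul _ (m1 m), lintegral_tsum (fun i => (hmeas m i).aemeasurable)]
    _ ≤ W * ∑' m : ℕ, (q ^ m)⁻¹ * ∑' i : ℤ, C * Q * ((q * q) ^ m * ∫⁻ t, ‖gc a L (m + 1) i g t‖ₑ ^ p) := by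
        refine mul_le_mul_right (ENNReal.tsum_le_tsum fun m => mul_le_mul_right (ENNReal.tsum_le_tsum fun i => cell m i) _) _
    _ = W * ∑' m : ℕ, q ^ m * (C * Q * G) := by
        congr 2
        ext m
        rw [ENNReal.tsum_mul_left, ENNReal.tsum_mul_left, gc_sum hg hp0, mul_pow]
        have : (q ^ m)⁻¹ * q ^ m = 1 := ENNReal.inv_mul_cancel (pow_ne_zero _ hq0) (ENNReal.pow_ne_top hqt)
        calc (q ^ m)⁻¹ * (C * Q * (q ^ m * q ^ m * G)) = ((q ^ m)⁻¹ * q ^ m) * (q ^ m * (C * Q * G)) := by ring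
          _ = _ := by rw [this, one_mul]
    _ = (W * C * (1 - q)⁻¹) * Q * G := by
        rw [ENNReal.tsum_mul_right, ENNReal.tsum_geometric]; ring
    _ ≤ _ := by
        refine mul_le_mul_left (mul_le_mul_left ?_ _) _
        push_cast
        rw [ENNReal.coe_toNNReal hg1]
        exact le_self_add



lemma vdc1 {φ φ1 φ2 : ℝ → ℝ} {c d μ : ℝ} (hcd : c ≤ d) (hμ : 0 < μ)
    (h1 : ∀ s ∈ Icc c d, HasDerivAt φ (φ1 s) s) (h2 : ∀ s ∈ Icc c d, HasDerivAt φ1 (φ2 s) s)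
    (h3 : ContinuousOn φ2 (Icc c d)) (hp : ∀ s ∈ Icc c d, 0 ≤ φ2 s) (hm : ∀ s ∈ Icc c d, μ ≤ φ1 s) :
    ‖∫ s in c..d, Complex.exp (Complex.I * (φ s : ℂ))‖ ≤ 3 / μ := by
  have hu : uIcc c d = Icc c d := uIcc_of_le hcd
  have c0 : ContinuousOn φ (Icc c d) := fun s hs => (h1 s hs).continuousAt.continuousWithinAt
  have c1 : ContinuousOn φ1 (Icc c d) := fun s hs => (h2 s hs).continuousAt.continuousWithinAt
  have hne : ∀ s ∈ Icc c d, φ1 s ≠ 0 := fun s hs => (hμ.trans_le (hm s hs)).ne'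
  have cR : ContinuousOn (fun s => φ2 s / φ1 s ^ 2) (Icc c d) :=
    h3.div (c1.pow 2) (fun s hs => pow_ne_zero _ (hne s hs))
  have cE : ContinuousOn (fun s => Complex.exp (Complex.I * (φ s : ℂ))) (Icc c d) := by
    apply Complex.continuous_exp.comp_continuousOn
    exact continuousOn_const.mul (Complex.continuous_ofReal.comp_continuousOn c0)
  have iR : IntervalIntegrable (fun s => φ2 s / φ1 s ^ 2) volume c d := by
    apply ContinuousOn.intervalIntegrable; rw [hu]; exact cR
  have eR : ∫ s in c..d, φ2 s / φ1 s ^ 2 = (φ1 c)⁻¹ - (φ1 d)⁻¹ := by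
    have := intervalIntegral.integral_eq_sub_of_hasDerivAt (f := fun s => -(φ1 s)⁻¹) (f' := fun s => φ2 s / φ1 s ^ 2)
      (a := c) (b := d) (fun s hs => by
        rw [hu] at hs
        refine HasDerivAt.congr_deriv ((h2 s hs).inv (hne s hs)).neg ?_
        ring) iR
    rw [this]; ring
  set G : ℝ → ℂ := fun s => Complex.exp (Complex.I * (φ s : ℂ)) * (-Complex.I) * (((φ2 s / φ1 s ^ 2 : ℝ)) : ℂ) with hG
  have cG : ContinuousOn G (Icc c d) :=
    (cE.mul continuousOn_const).mul (Complex.continuous_ofReal.comp_continuousOn cR)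
  have iE : IntervalIntegrable (fun s => Complex.exp (Complex.I * (φ s : ℂ))) volume c d := by
    apply ContinuousOn.intervalIntegrable; rw [hu]; exact cE
  have iG : IntervalIntegrable G volume c d := by
    apply ContinuousOn.intervalIntegrable; rw [hu]; exact cG
  set F : ℝ → ℂ := fun s => Complex.exp (Complex.I * (φ s : ℂ)) * ((-Complex.I) * (((φ1 s)⁻¹ : ℝ) : ℂ)) with hF
  have dF : ∀ s ∈ uIcc c d, HasDerivAt F (Complex.exp (Complex.I * (φ s : ℂ)) - G s) s := by
    intro s hs
    rw [hu] at hs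
    have d1 : HasDerivAt (fun s => Complex.exp (Complex.I * (φ s : ℂ))) (Complex.exp (Complex.I * (φ s : ℂ)) * (Complex.I * (φ1 s : ℂ))) s :=
      ((h1 s hs).ofReal_comp.const_mul Complex.I).cexp
    have d2 : HasDerivAt (fun s => (((φ1 s)⁻¹ : ℝ) : ℂ)) ((-(φ2 s) / φ1 s ^ 2 : ℝ) : ℂ) s :=
      ((h2 s hs).inv (hne s hs)).ofReal_comp
    refine HasDerivAt.congr_deriv (d1.mul (d2.const_mul (-Complex.I))) ?_
    have hc : (φ1 s : ℂ) ≠ 0 := by exact_mod_cast hne s hs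
    simp only [hG]
    push_cast
    have e : Complex.I * (φ1 s : ℂ) * (-Complex.I * (φ1 s : ℂ)⁻¹) = 1 := by
      rw [show Complex.I * (φ1 s : ℂ) * (-Complex.I * (φ1 s : ℂ)⁻¹) = -(Complex.I * Complex.I) * ((φ1 s : ℂ) * (φ1 s : ℂ)⁻¹) by ring,
        Complex.I_mul_I, mul_inv_cancel₀ hc]; ring
    linear_combination (Complex.exp (Complex.I * (φ s : ℂ))) * e
  have key := intervalIntegral.integral_eq_sub_of_hasDerivAt dF (iE.sub iG)
  rw [intervalIntegral.integral_sub iE iG] at key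
  have nE : ∀ s, ‖Complex.exp (Complex.I * (φ s : ℂ))‖ = 1 := by
    intro s; rw [mul_comm, Complex.norm_exp_ofReal_mul_I]
  have nF : ∀ s ∈ Icc c d, ‖F s‖ = (φ1 s)⁻¹ := by
    intro s hs
    simp only [hF, norm_mul, nE, norm_neg, Complex.norm_I, one_mul, Complex.norm_real]
    rw [Real.norm_of_nonneg (inv_nonneg.2 (hμ.le.trans (hm s hs)))]
  have nG : ‖∫ s in c..d, G s‖ ≤ (φ1 c)⁻¹ - (φ1 d)⁻¹ := by
    rw [← eR]
    refine intervalIntegral.norm_integral_le_of_norm_le hcd ?_ iR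
    refine ae_of_all _ fun s hs => ?_
    have hs' : s ∈ Icc c d := Ioc_subset_Icc_self hs
    simp only [hG, norm_mul, nE, norm_neg, Complex.norm_I, one_mul, Complex.norm_real]
    rw [Real.norm_of_nonneg (div_nonneg (hp s hs') (sq_nonneg _))]
  have e : ∫ s in c..d, Complex.exp (Complex.I * (φ s : ℂ)) = F d - F c + ∫ s in c..d, G s := by
    rw [← key]; ring
  have mc : c ∈ Icc c d := left_mem_Icc.2 hcd
  have md : d ∈ Icc c d := right_mem_Icc.2 hcd
  have t1 : ‖F d - F c + ∫ s in c..d, G s‖ ≤ ‖F d‖ + ‖F c‖ + ‖∫ s in c..d, G s‖ :=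
    (norm_add_le _ _).trans (by gcongr; exact norm_sub_le _ _)
  have q1 : (φ1 c)⁻¹ ≤ μ⁻¹ := inv_anti₀ hμ (hm c mc)
  have q2 : (φ1 d)⁻¹ ≤ μ⁻¹ := inv_anti₀ hμ (hm d md)
  rw [e, div_eq_mul_inv]
  rw [nF c mc, nF d md] at t1
  have : 0 < μ⁻¹ := by positivity
  linarith

lemma vdc_half {φ φ1 φ2 : ℝ → ℝ} {c d l : ℝ} (hcd : c ≤ d) (hl : 0 < l)
    (h1 : ∀ s ∈ Icc c d, HasDerivAt φ (φ1 s) s) (h2 : ∀ s ∈ Icc c d, HasDerivAt φ1 (φ2 s) s)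
    (h3 : ContinuousOn φ2 (Icc c d)) (hp : ∀ s ∈ Icc c d, l ^ 2 ≤ φ2 s) (hc : 0 ≤ φ1 c) :
    ‖∫ s in c..d, Complex.exp (Complex.I * (φ s : ℂ))‖ ≤ 4 / l := by
  have nE : ∀ s, ‖Complex.exp (Complex.I * (φ s : ℂ))‖ = 1 := by
    intro s; rw [mul_comm, Complex.norm_exp_ofReal_mul_I]
  have tr : ∀ a b : ℝ, a ≤ b → ‖∫ s in a..b, Complex.exp (Complex.I * (φ s : ℂ))‖ ≤ b - a := by
    intro a b hab
    have := intervalIntegral.norm_integral_le_of_norm_le_const (a := a) (b := b) (C := 1)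
      (f := fun s => Complex.exp (Complex.I * (φ s : ℂ))) (fun s _ => (nE s).le)
    rwa [one_mul, abs_of_nonneg (by linarith)] at this
  by_cases hs : d - c ≤ 1 / l
  · refine (tr c d hcd).trans (hs.trans ?_)
    gcongr; norm_num
  · rw [not_le] at hs
    have hl' : 0 < 1 / l := by positivity
    set e := c + 1 / l with he
    have hce : c ≤ e := by linarith
    have hed : e ≤ d := by linarith
    have sub1 : Icc c e ⊆ Icc c d := Icc_subset_Icc le_rfl hed
    have sub2 : Icc e d ⊆ Icc c d := Icc_subset_Icc hce le_rfl
    have gr : ∀ s ∈ Icc e d, l ≤ φ1 s := by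
      intro s hs'
      have hsc : s ∈ Icc c d := sub2 hs'
      have c1 : ContinuousOn φ1 (Icc c d) := fun s hs => (h2 s hs).continuousAt.continuousWithinAt
      have := Convex.mul_sub_le_image_sub_of_le_deriv (convex_Icc c d) c1
        (fun x hx => (h2 x (interior_subset hx)).differentiableAt.differentiableWithinAt)
        (C := l ^ 2) (fun x hx => by rw [(h2 x (interior_subset hx)).deriv]; exact hp x (interior_subset hx))
        c (left_mem_Icc.2 hcd) s hsc hsc.1
      have h5 : 1 / l ≤ s - c := by linarith [hs'.1]
      have : l ^ 2 * (1 / l) ≤ l ^ 2 * (s - c) := by gcongr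
      have : l ^ 2 * (1 / l) = l := by field_simp
      linarith
    have v := vdc1 hed hl (fun s hs => h1 s (sub2 hs)) (fun s hs => h2 s (sub2 hs)) (h3.mono sub2)
      (fun s hs => (sq_nonneg l).trans (hp s (sub2 hs))) gr
    have cE : ContinuousOn (fun s => Complex.exp (Complex.I * (φ s : ℂ))) (Icc c d) := by
      apply Complex.continuous_exp.comp_continuousOn
      exact continuousOn_const.mul (Complex.continuous_ofReal.comp_continuousOn
        (fun s hs => (h1 s hs).continuousAt.continuousWithinAt))
    have i1 : IntervalIntegrable (fun s => Complex.exp (Complex.I * (φ s : ℂ))) volume c e := by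
      apply ContinuousOn.intervalIntegrable; rw [uIcc_of_le hce]; exact cE.mono sub1
    have i2 : IntervalIntegrable (fun s => Complex.exp (Complex.I * (φ s : ℂ))) volume e d := by
      apply ContinuousOn.intervalIntegrable; rw [uIcc_of_le hed]; exact cE.mono sub2
    rw [← intervalIntegral.integral_add_adjacent_intervals i1 i2]
    refine (norm_add_le _ _).trans ?_
    have := tr c e hce
    have e4 : 4 / l = 1 / l + 3 / l := by ring
    linarith

lemma vdc_half' {φ φ1 φ2 : ℝ → ℝ} {c d l : ℝ} (hcd : c ≤ d) (hl : 0 < l)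
    (h1 : ∀ s ∈ Icc c d, HasDerivAt φ (φ1 s) s) (h2 : ∀ s ∈ Icc c d, HasDerivAt φ1 (φ2 s) s)
    (h3 : ContinuousOn φ2 (Icc c d)) (hp : ∀ s ∈ Icc c d, l ^ 2 ≤ φ2 s) (hc : φ1 d ≤ 0) :
    ‖∫ s in c..d, Complex.exp (Complex.I * (φ s : ℂ))‖ ≤ 4 / l := by
  have mem : ∀ s ∈ Icc (-d) (-c), -s ∈ Icc c d := fun s hs => ⟨by linarith [hs.2], by linarith [hs.1]⟩
  have := vdc_half (φ := fun s => φ (-s)) (φ1 := fun s => -φ1 (-s)) (φ2 := fun s => φ2 (-s)) (c := -d) (d := -c)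
    (by linarith) hl (fun s hs => ?_) (fun s hs => ?_) ?_ (fun s hs => hp _ (mem s hs)) (by simpa using hc)
  · have e := intervalIntegral.integral_comp_neg (a := -d) (b := -c) (fun s => Complex.exp (Complex.I * (φ s : ℂ)))
    simp only [neg_neg] at e
    rwa [e] at this
  · refine HasDerivAt.congr_deriv ((h1 _ (mem s hs)).comp s (hasDerivAt_neg s)) ?_
    ring
  · refine HasDerivAt.congr_deriv ((h2 _ (mem s hs)).comp s (hasDerivAt_neg s)).neg ?_
    ring
  · exact h3.comp continuous_neg.continuousOn mem

lemma vdc2 {φ φ1 φ2 : ℝ → ℝ} {c d l : ℝ} (hcd : c ≤ d) (hl : 0 < l)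
    (h1 : ∀ s ∈ Icc c d, HasDerivAt φ (φ1 s) s) (h2 : ∀ s ∈ Icc c d, HasDerivAt φ1 (φ2 s) s)
    (h3 : ContinuousOn φ2 (Icc c d)) (hp : ∀ s ∈ Icc c d, l ^ 2 ≤ φ2 s) :
    ‖∫ s in c..d, Complex.exp (Complex.I * (φ s : ℂ))‖ ≤ 8 / l := by
  have h48 : 4 / l ≤ 8 / l := by gcongr; norm_num
  by_cases ha : 0 ≤ φ1 c
  · exact (vdc_half hcd hl h1 h2 h3 hp ha).trans h48
  by_cases hb : φ1 d ≤ 0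
  · exact (vdc_half' hcd hl h1 h2 h3 hp hb).trans h48
  rw [not_le] at ha hb
  have c1 : ContinuousOn φ1 (Icc c d) := fun s hs => (h2 s hs).continuousAt.continuousWithinAt
  obtain ⟨e, he, h0⟩ := intermediate_value_Icc hcd c1 ⟨ha.le, hb.le⟩
  have sub1 : Icc c e ⊆ Icc c d := Icc_subset_Icc le_rfl he.2
  have sub2 : Icc e d ⊆ Icc c d := Icc_subset_Icc he.1 le_rfl
  have v1 := vdc_half' he.1 hl (fun s hs => h1 s (sub1 hs)) (fun s hs => h2 s (sub1 hs)) (h3.mono sub1)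
      (fun s hs => hp s (sub1 hs)) h0.le
  have v2 := vdc_half he.2 hl (fun s hs => h1 s (sub2 hs)) (fun s hs => h2 s (sub2 hs)) (h3.mono sub2)
      (fun s hs => hp s (sub2 hs)) h0.ge
  have cE : ContinuousOn (fun s => Complex.exp (Complex.I * (φ s : ℂ))) (Icc c d) := by
    apply Complex.continuous_exp.comp_continuousOn
    exact continuousOn_const.mul (Complex.continuous_ofReal.comp_continuousOn
      (fun s hs => (h1 s hs).continuousAt.continuousWithinAt))
  have i1 : IntervalIntegrable (fun s => Complex.exp (Complex.I * (φ s : ℂ))) volume c e := by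
    apply ContinuousOn.intervalIntegrable; rw [uIcc_of_le he.1]; exact cE.mono sub1
  have i2 : IntervalIntegrable (fun s => Complex.exp (Complex.I * (φ s : ℂ))) volume e d := by
    apply ContinuousOn.intervalIntegrable; rw [uIcc_of_le he.2]; exact cE.mono sub2
  rw [← intervalIntegral.integral_add_adjacent_intervals i1 i2]
  refine (norm_add_le _ _).trans ?_
  have e4 : 8 / l = 4 / l + 4 / l := by ring
  linarith



lemma neg_one_lt_one' : (-1 : ℝ) < 1 := by norm_num

lemma fc_eq {f : ℝ → ℂ} (hs : ∀ t, t ∉ Ioc (-1:ℝ) 1 → f t = 0) (n : ℤ) :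
    fourierCoeffOn neg_one_lt_one' f n = (1 / 2 : ℂ) * ∫ s, f s * Complex.exp (Complex.I * ((-(π * n * s) : ℝ) : ℂ)) := by
  rw [fourierCoeffOn_eq_integral, intervalIntegral.integral_of_le neg_one_lt_one'.le]
  rw [setIntegral_eq_integral_of_forall_compl_eq_zero]
  · rw [Complex.real_smul]
    congr 1
    · push_cast; norm_num
    · congr 1
      ext s
      rw [fourier_coe_apply, smul_eq_mul, mul_comm]
      congr 2
      push_cast
      ring
  · intro x hx
    rw [hs x hx, smul_zero]

lemma memLp2 {f : ℝ → ℂ} (hf : Measurable f) (h : ∫⁻ t, ‖f t‖ₑ ^ (2:ℝ) ≠ ⊤) : MemLp f 2 := by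
  refine ⟨hf.aestronglyMeasurable, ?_⟩
  rw [eLpNorm_lt_top_iff_lintegral_rpow_enorm_lt_top (by norm_num) (by norm_num)]
  simpa using lt_top_iff_ne_top.2 h

lemma parseval {f : ℝ → ℂ} (hf : Measurable f) (hs : ∀ t, t ∉ Ioc (-1:ℝ) 1 → f t = 0)
    (h : ∫⁻ t, ‖f t‖ₑ ^ (2:ℝ) ≠ ⊤) :
    HasSum (fun n : ℤ => ‖fourierCoeffOn neg_one_lt_one' f n‖ ^ 2) ((1 / 2) * (∫⁻ t, ‖f t‖ₑ ^ (2:ℝ)).toReal) := by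
  have := hasSum_sq_fourierCoeffOn neg_one_lt_one' ((memLp2 hf h).restrict (Ioc (-1) 1))
  rw [intervalIntegral.integral_of_le neg_one_lt_one'.le, setIntegral_eq_integral_of_forall_compl_eq_zero] at this
  · have e : (∫⁻ t, ‖f t‖ₑ ^ (2:ℝ)).toReal = ∫ t, ‖f t‖ ^ 2 := by
      rw [integral_eq_lintegral_of_nonneg_ae (ae_of_all _ fun t => by positivity) (by fun_prop)]
      congr 1
      refine lintegral_congr fun t => ?_
      rw [ENNReal.ofReal_pow (norm_nonneg _), ofReal_norm, ← ENNReal.rpow_natCast]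
      norm_num
    rw [e]
    convert this using 1
    rw [smul_eq_mul]; norm_num
  · intro x hx
    rw [hs x hx]; simp

lemma convL2 {k g : ℝ → ℂ} (hk : Measurable k) (hk1 : ∀ s, ‖k s‖ ≤ 1) (hks : ∀ s, s ∉ Icc (-1/2:ℝ) 0 → k s = 0)
    (hg : Measurable g) (hgs : ∀ s, s ∉ Icc (-1/4:ℝ) (1/4) → g s = 0) {B : ℝ} (hB0 : 0 ≤ B)
    (hB : ∀ ξ : ℝ, ‖∫ s, k s * Complex.exp (Complex.I * ((-(ξ * s) : ℝ) : ℂ))‖ ≤ B)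
    (h2 : ∫⁻ t, ‖g t‖ₑ ^ (2:ℝ) ≠ ⊤) :
    ∫⁻ v, ‖∫ t, k (v - t) * g t‖ₑ ^ (2:ℝ) ≤ ENNReal.ofReal (B ^ 2) * ∫⁻ t, ‖g t‖ₑ ^ (2:ℝ) := by
  have gi : Integrable g := integrable_of_Lp hg (α := -1/4) (ℓ := 1/2) (by norm_num)
    (fun t ht => hgs t (fun h => ht ⟨h.1, by linarith [h.2]⟩)) (p := 2) (by norm_num) h2
  have ki : Integrable k := by
    have : IntegrableOn k (Icc (-1/2:ℝ) 0) := by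
      refine Measure.integrableOn_of_bounded (M := 1) (by simp) hk.aestronglyMeasurable (ae_of_all _ hk1)
    rw [integrableOn_iff_integrable_of_support_subset] at this
    · exact this
    · intro s hs; by_contra h; exact hs (hks s h)
  set h : ℝ → ℂ := fun v => ∫ t, k (v - t) * g t with hh
  have hsm : StronglyMeasurable h := by
    have : Measurable fun q : ℝ × ℝ => k (q.1 - q.2) * g q.2 :=
      (hk.comp (measurable_fst.sub measurable_snd)).mul (hg.comp measurable_snd)
    exact this.stronglyMeasurable.integral_prod_right
  have hm : Measurable h := hsm.measurable
  have hhs : ∀ v, v ∉ Icc (-3/4:ℝ) (1/4) → h v = 0 := by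
    intro v hv
    refine integral_eq_zero_of_ae (ae_of_all _ fun t => ?_)
    by_cases ht : t ∈ Icc (-1/4:ℝ) (1/4)
    · change k (v - t) * g t = 0
      rw [hks, zero_mul]
      intro hc
      exact hv ⟨by linarith [hc.1, ht.1], by linarith [hc.2, ht.2]⟩
    · change k (v - t) * g t = 0
      rw [hgs t ht, mul_zero]
  have hbd : ∀ v, ‖h v‖ ≤ ∫ t, ‖g t‖ := by
    intro v
    refine norm_integral_le_of_norm_le gi.norm (ae_of_all _ fun t => ?_)
    rw [norm_mul]
    exact mul_le_of_le_one_left (norm_nonneg _) (hk1 _)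
  have hh2 : ∫⁻ t, ‖h t‖ₑ ^ (2:ℝ) ≠ ⊤ := by
    have : ∫⁻ t, ‖h t‖ₑ ^ (2:ℝ) = ∫⁻ t in Icc (-3/4:ℝ) (1/4), ‖h t‖ₑ ^ (2:ℝ) := by
      rw [setLIntegral_eq_of_support_subset]
      intro t ht
      by_contra hc
      apply ht
      simp [hhs t hc]
    rw [this]
    refine ne_of_lt (lt_of_le_of_lt (setLIntegral_mono_ae' (g := fun _ => ENNReal.ofReal (∫ t, ‖g t‖) ^ (2:ℝ)) measurableSet_Icc
      (ae_of_all _ fun t _ => ?_)) ?_)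
    · refine ENNReal.rpow_le_rpow ?_ (by norm_num)
      rw [← ofReal_norm]
      exact ENNReal.ofReal_le_ofReal (hbd t)
    · rw [setLIntegral_const]
      exact ENNReal.mul_lt_top (ENNReal.rpow_lt_top_of_nonneg (by norm_num) ENNReal.ofReal_ne_top) (by simp)
  have s1 : ∀ t, t ∉ Ioc (-1:ℝ) 1 → h t = 0 := fun t ht => hhs t fun hc => ht ⟨by linarith [hc.1], by linarith [hc.2]⟩
  have s2 : ∀ t, t ∉ Ioc (-1:ℝ) 1 → g t = 0 := fun t ht => hgs t fun hc => ht ⟨by linarith [hc.1], by linarith [hc.2]⟩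
  have P1 := parseval hm s1 hh2
  have P2 := parseval hg s2 h2
  have coef : ∀ n : ℤ, ‖fourierCoeffOn neg_one_lt_one' h n‖ ^ 2 ≤ B ^ 2 * ‖fourierCoeffOn neg_one_lt_one' g n‖ ^ 2 := by
    intro n
    rw [← mul_pow]
    refine pow_le_pow_left₀ (norm_nonneg _) ?_ 2
    rw [fc_eq s1, fc_eq s2]
    set e : ℝ → ℂ := fun s => Complex.exp (Complex.I * ((-(π * n * s) : ℝ) : ℂ)) with he
    have ee : ∀ v t, e v = e (v - t) * e t := by
      intro v t
      simp only [he]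
      rw [← Complex.exp_add]; congr 1; push_cast; ring
    have ce : Continuous e := by simp only [he]; fun_prop
    have ne : ∀ s, ‖e s‖ = 1 := by
      intro s; simp only [he]; rw [mul_comm, Complex.norm_exp_ofReal_mul_I]
    have i2 : Integrable (fun p : ℝ × ℝ => k (p.1 - p.2) * g p.2 * e p.1) (volume.prod volume) := by
      have := gi.convolution_integrand (ContinuousLinearMap.mul ℂ ℂ) ki
      simp only [ContinuousLinearMap.mul_apply'] at this
      have h3 := this.mul_bdd (c := 1) (g := fun p : ℝ × ℝ => e p.1) (by exact (ce.comp continuous_fst).aestronglyMeasurable)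
        (ae_of_all _ fun p => (ne p.1).le)
      refine h3.congr (ae_of_all _ fun p => ?_)
      simp only
      ring
    have : ∫ s, h s * e s = (∫ s, k s * e s) * ∫ t, g t * e t := by
      calc ∫ s, h s * e s = ∫ v, ∫ t, k (v - t) * g t * e v := by
            congr 1; ext v; rw [← integral_mul_const]
        _ = ∫ t, ∫ v, k (v - t) * g t * e v := integral_integral_swap i2
        _ = ∫ t, (∫ s, k s * e s) * (g t * e t) := by
            congr 1; ext t
            rw [← integral_mul_const, ← integral_sub_right_eq_self (fun s => k s * e s * (g t * e t)) t]
            congr 1; ext v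
            rw [ee v t]; ring
        _ = _ := by rw [integral_const_mul]
    rw [this, norm_mul, norm_mul, norm_mul]
    have hB' : ‖∫ s, k s * e s‖ ≤ B := hB (π * n)
    have : 0 ≤ ‖∫ t, g t * e t‖ := norm_nonneg _
    have h12 : 0 ≤ ‖(1/2:ℂ)‖ := norm_nonneg _
    calc _ = ‖∫ s, k s * e s‖ * (‖(1/2:ℂ)‖ * ‖∫ t, g t * e t‖) := by ring
      _ ≤ _ := by gcongr
  have := hasSum_le coef P1 (P2.mul_left (B ^ 2))
  have fin : (∫⁻ t, ‖h t‖ₑ ^ (2:ℝ)).toReal ≤ B ^ 2 * (∫⁻ t, ‖g t‖ₑ ^ (2:ℝ)).toReal := by linarith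
  rw [← ENNReal.ofReal_toReal hh2, ← ENNReal.ofReal_toReal h2, ← ENNReal.ofReal_mul (by positivity)]
  exact ENNReal.ofReal_le_ofReal fin

/-- distance as function of the angle -/
def rh (u r s : ℝ) : ℝ := √((u + r * cos s) ^ 2 + (r * sin s) ^ 2)

lemma khat {u r M : ℝ} (hu : 0 < u) (hu1 : u ≤ 4/3) (hr : 0 < r) (hr1 : r ≤ 4/3) (hM : 0 < M) (ξ : ℝ) :
    ‖∫ s, (Icc (-1/2:ℝ) 0).indicator (fun s => Complex.exp (Complex.I * ((M * rh u r s : ℝ) : ℂ))) s *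
      Complex.exp (Complex.I * ((-(ξ * s) : ℝ) : ℂ))‖ ≤ 8 / √(3 * M * u * r / 16) := by
  set φ : ℝ → ℝ := fun s => ξ * s - M * rh u r s with hφ
  set φ1 : ℝ → ℝ := fun s => ξ + M * (u * r * sin s / rh u r s) with hφ1
  set φ2 : ℝ → ℝ := fun s => M * (u * r * cos s / rh u r s + (u * r * sin s) ^ 2 / rh u r s ^ 3) with hφ2
  have hc : ∀ s ∈ Icc (-1/2:ℝ) 0, 1 / 2 ≤ cos s := fun s hs => cos_ge_half (abs_le.2 ⟨by linarith [hs.1], by linarith [hs.2]⟩)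
  have Qpos : ∀ s ∈ Icc (-1/2:ℝ) 0, 0 < (u + r * cos s) ^ 2 + (r * sin s) ^ 2 := by
    intro s hs
    have := hc s hs
    positivity
  have rpos : ∀ s ∈ Icc (-1/2:ℝ) 0, 0 < rh u r s := fun s hs => sqrt_pos.2 (Qpos s hs)
  have dr : ∀ s ∈ Icc (-1/2:ℝ) 0, HasDerivAt (rh u r) (-(u * r * sin s) / rh u r s) s := by
    intro s hs
    have d1 : HasDerivAt (fun s => (u + r * cos s) ^ 2 + (r * sin s) ^ 2) (-(2 * u * r * sin s)) s := by
      refine HasDerivAt.congr_deriv (((((hasDerivAt_cos s).const_mul r).const_add u).pow 2).add (((hasDerivAt_sin s).const_mul r).pow 2)) ?_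
      push_cast; ring
    refine HasDerivAt.congr_deriv (d1.sqrt (Qpos s hs).ne') ?_
    have := (rpos s hs).ne'
    unfold rh at *
    field_simp
  have D1 : ∀ s ∈ Icc (-1/2:ℝ) 0, HasDerivAt φ (φ1 s) s := by
    intro s hs
    refine HasDerivAt.congr_deriv (((hasDerivAt_id s).const_mul ξ).sub ((dr s hs).const_mul M)) ?_
    simp only [hφ1]; ring
  have D2 : ∀ s ∈ Icc (-1/2:ℝ) 0, HasDerivAt φ1 (φ2 s) s := by
    intro s hs
    have hne := (rpos s hs).ne'
    refine HasDerivAt.congr_deriv (((((hasDerivAt_sin s).const_mul (u * r)).div (dr s hs) hne).const_mul M).const_add ξ) ?_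
    simp only [hφ2]
    field_simp
    ring
  have crh : Continuous (rh u r) := by unfold rh; fun_prop
  have C2 : ContinuousOn φ2 (Icc (-1/2:ℝ) 0) := by
    refine continuousOn_const.mul (ContinuousOn.add ?_ ?_)
    · exact ContinuousOn.div (by fun_prop) crh.continuousOn (fun s hs => (rpos s hs).ne')
    · exact ContinuousOn.div (by fun_prop) (crh.pow 3).continuousOn (fun s hs => pow_ne_zero _ (rpos s hs).ne')
  have rle : ∀ s, rh u r s ≤ 8 / 3 := by
    intro s
    unfold rh
    rw [sqrt_le_left (by norm_num)]
    have := cos_le_one s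
    have h3 := sin_sq_add_cos_sq s
    have : (u + r * cos s) ^ 2 + (r * sin s) ^ 2 = u ^ 2 + r ^ 2 * (sin s ^ 2 + cos s ^ 2) + 2 * u * r * cos s := by ring
    rw [this, h3]
    have : u * r * cos s ≤ u * r * 1 := by gcongr
    nlinarith
  have hl : 0 < 3 * M * u * r / 16 := by positivity
  have := vdc2 (c := -1/2) (d := 0) (by norm_num) (sqrt_pos.2 hl) D1 D2 C2 (fun s hs => by
    rw [sq_sqrt hl.le]
    have h1 := rpos s hs
    have h2 : 0 ≤ (u * r * sin s) ^ 2 / rh u r s ^ 3 := by positivity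
    have h3 : u * r * (1 / 2) / (8 / 3) ≤ u * r * cos s / rh u r s := by
      have := hc s hs; have := rle s; gcongr
    simp only [hφ2]
    calc 3 * M * u * r / 16 = M * (u * r * (1 / 2) / (8 / 3) + 0) := by ring
      _ ≤ _ := by gcongr)
  refine le_trans (le_of_eq ?_) this
  rw [intervalIntegral.integral_of_le (by norm_num), ← integral_Icc_eq_integral_Ioc,
    ← norm_star, ← integral_indicator measurableSet_Icc]
  rw [show star (∫ s, (Icc (-1/2:ℝ) 0).indicator (fun s => Complex.exp (Complex.I * ((M * rh u r s : ℝ) : ℂ))) s *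
      Complex.exp (Complex.I * ((-(ξ * s) : ℝ) : ℂ))) = ∫ s, (starRingEnd ℂ) ((Icc (-1/2:ℝ) 0).indicator (fun s => Complex.exp (Complex.I * ((M * rh u r s : ℝ) : ℂ))) s *
      Complex.exp (Complex.I * ((-(ξ * s) : ℝ) : ℂ))) from integral_conj.symm]
  congr 2
  ext s
  by_cases hs : s ∈ Icc (-1/2:ℝ) 0
  · rw [indicator_of_mem hs, indicator_of_mem hs, ← Complex.exp_add, ← Complex.exp_conj]
    congr 1
    simp only [map_add, map_mul, Complex.conj_I, Complex.conj_ofReal, hφ]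
    push_cast; ring
  · rw [indicator_of_notMem hs, indicator_of_notMem hs]; simp



lemma EJ_meas {r M : ℝ} {g : ℝ → ℂ} (hg : Measurable g) : Measurable (EJ r M g) := by
  have c : Continuous fun q : (ℝ × ℝ) × ℝ => Complex.exp (Complex.I * ((M * PB r q.1.1 q.1.2 q.2 : ℝ) : ℂ)) := by
    unfold PB; fun_prop
  have hS : MeasurableSet {q : (ℝ × ℝ) × ℝ | q.1.2 ≤ q.2} := measurableSet_le (by fun_prop) (by fun_prop)
  have := ((c.measurable.mul (hg.comp measurable_snd)).indicator hS).stronglyMeasurable.integral_prod_right' (ν := (volume : Measure ℝ)) |>.measurable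
  convert this using 1
  ext x
  unfold EJ
  rw [← integral_indicator measurableSet_Ici]
  congr 1

lemma jump_L2 : ∃ C : ℝ≥0, 0 < C ∧ ∀ τ : ℝ, 0 < τ → τ ≤ 1 / 4 →
    ∀ r M : ℝ, 0 < r → r ≤ 4 / 3 → 0 < M →
    ∀ g : ℝ → ℂ, Measurable g → (∀ t, t ∉ Icc (-τ) τ → g t = 0) →
    ∫⁻ x in Rg τ r, ‖EJ r M g x‖ₑ ^ (2:ℝ) * ENNReal.ofReal x.1 ≤
      C * ENNReal.ofReal ((M * r)⁻¹) * ∫⁻ t, ‖g t‖ₑ ^ (2:ℝ) := by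
  refine ⟨500, by norm_num, ?_⟩
  intro τ hτ0 hτ1 r M hr0 hr1 hM g hg hgs
  have hQ0 : ENNReal.ofReal ((M * r)⁻¹) ≠ 0 := by
    rw [Ne, ENNReal.ofReal_eq_zero, not_le]; positivity
  by_cases hG : ∫⁻ t, ‖g t‖ₑ ^ (2:ℝ) = ⊤
  · rw [hG, ENNReal.mul_top]
    · exact le_top
    · refine mul_ne_zero (by norm_num) hQ0
  set G := ∫⁻ t, ‖g t‖ₑ ^ (2:ℝ) with hGd
  have key : ∀ u ∈ Ioc (0:ℝ) (4/3), ∫⁻ v in Icc (-τ) τ, ‖EJ r M g (u, v)‖ₑ ^ (2:ℝ) * ENNReal.ofReal u ≤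
      ENNReal.ofReal (1024 / 3) * ENNReal.ofReal ((M * r)⁻¹) * G := by
    intro u hu
    set k : ℝ → ℂ := (Icc (-1/2:ℝ) 0).indicator (fun s => Complex.exp (Complex.I * ((M * rh u r s : ℝ) : ℂ))) with hk
    have crh : Continuous (rh u r) := by unfold rh; fun_prop
    have kc : Continuous fun s => Complex.exp (Complex.I * ((M * rh u r s : ℝ) : ℂ)) := by fun_prop
    have km : Measurable k := kc.measurable.indicator measurableSet_Icc
    have k1 : ∀ s, ‖k s‖ ≤ 1 := by
      intro s
      rw [hk]
      refine (norm_indicator_le_norm_self _ _).trans ?_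
      rw [mul_comm, Complex.norm_exp_ofReal_mul_I]
    have main := convL2 km k1 (fun s hs => indicator_of_notMem hs _) hg
      (fun s hs => hgs s fun h => hs ⟨by linarith [h.1], by linarith [h.2]⟩)
      (B := 8 / √(3 * M * u * r / 16)) (by positivity) (khat hu.1 hu.2 hr0 hr1 hM) hG
    have eq : ∀ v ∈ Icc (-τ) τ, EJ r M g (u, v) = ∫ t, k (v - t) * g t := by
      intro v hv
      unfold EJ
      rw [← integral_indicator measurableSet_Ici]
      congr 1
      ext t
      by_cases ht : t ∈ Icc (-τ) τ
      · by_cases hvt : v ≤ t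
        · rw [indicator_of_mem (show t ∈ Ici v from hvt), hk, indicator_of_mem]
          · rfl
          · exact ⟨by linarith [hv.1, ht.2], by linarith⟩
        · rw [indicator_of_notMem (show t ∉ Ici v from hvt), hk, indicator_of_notMem, zero_mul]
          intro h
          exact hvt (by linarith [h.2])
      · rw [hgs t ht, mul_zero]
        simp only [indicator]
        split_ifs <;> simp [hgs t ht]
    have hu0 := hu.1
    calc ∫⁻ v in Icc (-τ) τ, ‖EJ r M g (u, v)‖ₑ ^ (2:ℝ) * ENNReal.ofReal u
        = ∫⁻ v in Icc (-τ) τ, ‖∫ t, k (v - t) * g t‖ₑ ^ (2:ℝ) * ENNReal.ofReal u :=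
          setLIntegral_congr_fun measurableSet_Icc fun v hv => by simp only [eq v hv]
      _ ≤ ∫⁻ v, ‖∫ t, k (v - t) * g t‖ₑ ^ (2:ℝ) * ENNReal.ofReal u := setLIntegral_le_lintegral _ _
      _ = (∫⁻ v, ‖∫ t, k (v - t) * g t‖ₑ ^ (2:ℝ)) * ENNReal.ofReal u :=
          lintegral_mul_const' _ _ ENNReal.ofReal_ne_top
      _ ≤ (ENNReal.ofReal ((8 / √(3 * M * u * r / 16)) ^ 2) * G) * ENNReal.ofReal u := mul_le_mul_left main _
      _ = ENNReal.ofReal (1024 / 3) * ENNReal.ofReal ((M * r)⁻¹) * G := by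
          rw [div_pow, sq_sqrt (by positivity), ← ENNReal.ofReal_mul (by norm_num), mul_right_comm,
            ← ENNReal.ofReal_mul (by positivity)]
          congr 2
          field_simp
          norm_num
  have hsub : Rg τ r ⊆ Ioc (0:ℝ) (4/3) ×ˢ Icc (-τ) τ := fun x hx => ⟨hx.1, hx.2.2⟩
  have hmeas : Measurable fun x : ℝ × ℝ => ‖EJ r M g x‖ₑ ^ (2:ℝ) * ENNReal.ofReal x.1 :=
    ((EJ_meas hg).enorm.pow_const _).mul (by fun_prop)
  calc ∫⁻ x in Rg τ r, ‖EJ r M g x‖ₑ ^ (2:ℝ) * ENNReal.ofReal x.1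
      ≤ ∫⁻ x in Ioc (0:ℝ) (4/3) ×ˢ Icc (-τ) τ, ‖EJ r M g x‖ₑ ^ (2:ℝ) * ENNReal.ofReal x.1 := lintegral_mono_set hsub
    _ = ∫⁻ u in Ioc (0:ℝ) (4/3), ∫⁻ v in Icc (-τ) τ, ‖EJ r M g (u, v)‖ₑ ^ (2:ℝ) * ENNReal.ofReal u := by
        rw [Measure.volume_eq_prod, ← Measure.prod_restrict, lintegral_prod _ hmeas.aemeasurable]
    _ ≤ ∫⁻ u in Ioc (0:ℝ) (4/3), ENNReal.ofReal (1024 / 3) * ENNReal.ofReal ((M * r)⁻¹) * G :=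
        setLIntegral_mono_ae' measurableSet_Ioc (ae_of_all _ key)
    _ = ENNReal.ofReal (1024 / 3) * ENNReal.ofReal ((M * r)⁻¹) * G * ENNReal.ofReal (4/3) := by
        rw [setLIntegral_const, Real.volume_Ioc, sub_zero]
    _ = (ENNReal.ofReal (1024 / 3) * ENNReal.ofReal (4/3)) * ENNReal.ofReal ((M * r)⁻¹) * G := by ring
    _ ≤ _ := by
        refine mul_le_mul_left (mul_le_mul_left ?_ _) _
        rw [← ENNReal.ofReal_mul (by norm_num)]
        rw [show ((500:ℝ≥0) : ℝ≥0∞) = ENNReal.ofReal 500 by simp]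
        exact ENNReal.ofReal_le_ofReal (by norm_num)



/-- jump bound, uniform over integer frequencies -/
def JB (τ p : ℝ) (s κ : ℕ) (C : ℝ≥0) : Prop :=
  ∀ r : ℝ, 0 < r → r ≤ 4 / 3 → ∀ M : ℤ, ∀ g : ℝ → ℂ, Measurable g → (∀ t, t ∉ Icc (-τ) τ → g t = 0) →
    ∫⁻ x in Rg τ r, ‖EJ r M g x‖ₑ ^ p * ENNReal.ofReal x.1 ≤
      C * ENNReal.ofReal (((1 + |(M:ℝ)|) ^ s * r ^ κ)⁻¹) * ∫⁻ t, ‖g t‖ₑ ^ p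

lemma EJ_neg (r M : ℝ) (g : ℝ → ℂ) (x : ℝ × ℝ) :
    ‖EJ r (-M) g x‖ₑ = ‖EJ r M (fun t => (starRingEnd ℂ) (g t)) x‖ₑ := by
  have : EJ r (-M) g x = (starRingEnd ℂ) (EJ r M (fun t => (starRingEnd ℂ) (g t)) x) := by
    unfold EJ
    rw [← integral_conj]
    congr 1
    ext t
    rw [map_mul, ← Complex.exp_conj, Complex.conj_conj]
    congr 2
    simp only [map_mul, Complex.conj_I, Complex.conj_ofReal]
    push_cast; ring
  rw [this, ← ofReal_norm, ← ofReal_norm, RCLike.norm_conj]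

lemma EJ_zero_bound {r M : ℝ} {g : ℝ → ℂ} (x : ℝ × ℝ) : ‖EJ r M g x‖ₑ ≤ ∫⁻ t, ‖g t‖ₑ := by
  unfold EJ
  refine (enorm_integral_le_lintegral_enorm _).trans ((setLIntegral_le_lintegral _ _).trans (le_of_eq ?_))
  refine lintegral_congr fun t => ?_
  rw [enorm_mul, ← ofReal_norm, mul_comm Complex.I, Complex.norm_exp_ofReal_mul_I]; simp

lemma JB_of {τ p : ℝ} {s κ : ℕ} {C : ℝ≥0} (hτ0 : 0 < τ) (hτ : τ ≤ 1 / 4) (hp : 1 < p) (hκ : κ ≤ 4)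
    (H : ∀ r M : ℝ, 0 < r → r ≤ 4 / 3 → 0 < M →
      ∀ g : ℝ → ℂ, Measurable g → (∀ t, t ∉ Icc (-τ) τ → g t = 0) →
      ∫⁻ x in Rg τ r, ‖EJ r M g x‖ₑ ^ p * ENNReal.ofReal x.1 ≤
      C * ENNReal.ofReal ((M ^ s * r ^ κ)⁻¹) * ∫⁻ t, ‖g t‖ₑ ^ p) :
    JB τ p s κ (2 ^ s * C + 4) := by
  intro r hr0 hr1 M g hg hgs
  have pos : ∀ M : ℤ, 0 < M → ∀ g : ℝ → ℂ, Measurable g → (∀ t, t ∉ Icc (-τ) τ → g t = 0) →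
      ∫⁻ x in Rg τ r, ‖EJ r M g x‖ₑ ^ p * ENNReal.ofReal x.1 ≤
      ((2 ^ s * C + 4 : ℝ≥0) : ℝ≥0∞) * ENNReal.ofReal (((1 + |(M:ℝ)|) ^ s * r ^ κ)⁻¹) * ∫⁻ t, ‖g t‖ₑ ^ p := by
    intro M hM g hg hgs
    have hM' : (1:ℝ) ≤ M := by exact_mod_cast hM
    refine (H r M hr0 hr1 (by linarith) g hg hgs).trans (mul_le_mul_left ?_ _)
    have : ENNReal.ofReal (((M:ℝ) ^ s * r ^ κ)⁻¹) ≤ 2 ^ s * ENNReal.ofReal (((1 + |(M:ℝ)|) ^ s * r ^ κ)⁻¹) := by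
      rw [show (2:ℝ≥0∞) ^ s = ENNReal.ofReal (2 ^ s) by rw [ENNReal.ofReal_pow (by norm_num)]; simp, ← ENNReal.ofReal_mul (by positivity)]
      apply ENNReal.ofReal_le_ofReal
      rw [abs_of_pos (by linarith)]
      have h1 : (1 + (M:ℝ)) ^ s ≤ 2 ^ s * M ^ s := by
        rw [← mul_pow]; gcongr; linarith
      have h2 : 0 < (1 + (M:ℝ)) ^ s := by positivity
      have h3 : 0 < r ^ κ := by positivity
      have h4 : 0 < (M:ℝ) ^ s := by positivity
      rw [← div_eq_mul_inv, inv_le_comm₀ (by positivity) (by positivity), inv_div, div_le_iff₀ (by positivity)]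
      nlinarith
    calc (C:ℝ≥0∞) * ENNReal.ofReal (((M:ℝ) ^ s * r ^ κ)⁻¹) ≤ C * (2 ^ s * ENNReal.ofReal (((1 + |(M:ℝ)|) ^ s * r ^ κ)⁻¹)) :=
          mul_le_mul_right this _
      _ = (2 ^ s * C) * ENNReal.ofReal (((1 + |(M:ℝ)|) ^ s * r ^ κ)⁻¹) := by ring
      _ ≤ _ := by
          refine mul_le_mul_left ?_ _
          push_cast
          exact le_self_add
  rcases lt_trichotomy M 0 with hM | hM | hM
  · have := pos (-M) (by omega) (fun t => (starRingEnd ℂ) (g t)) (Complex.continuous_conj.measurable.comp hg)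
      (fun t ht => by simp [hgs t ht])
    have e1 : ∀ x, ‖EJ r ((-M : ℤ) : ℝ) (fun t => (starRingEnd ℂ) (g t)) x‖ₑ = ‖EJ r M g x‖ₑ := by
      intro x
      rw [← EJ_neg]; push_cast; rw [neg_neg]
    have e2 : ∀ t, ‖(starRingEnd ℂ) (g t)‖ₑ = ‖g t‖ₑ := by
      intro t; rw [← ofReal_norm, ← ofReal_norm, RCLike.norm_conj]
    simp only [e1, e2] at this
    push_cast at this
    rw [abs_neg] at this
    simpa using this
  · subst hM
    have h1 := holder_supp hg (α := -τ) (ℓ := 2 * τ) (by positivity)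
      (fun t ht => hgs t fun h => ht ⟨h.1, by linarith [h.2]⟩) (n := 1) one_pos hp
    simp only [ENNReal.rpow_one, div_one] at h1
    set G := ∫⁻ t, ‖g t‖ₑ ^ p
    have h2 : (∫⁻ t, ‖g t‖ₑ) ^ p ≤ G := by
      refine h1.trans (mul_le_of_le_one_left' ?_)
      refine ENNReal.rpow_le_one ?_ (by linarith)
      rw [ENNReal.ofReal_le_one]; linarith
    have hsub : Rg τ r ⊆ Ioc (0:ℝ) (4/3) ×ˢ Icc (-τ) τ := fun x hx => ⟨hx.1, hx.2.2⟩
    have hκ' : (1:ℝ) ≤ 4 * (r ^ κ)⁻¹ := by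
      rw [← div_eq_mul_inv, one_le_div (by positivity)]
      calc r ^ κ ≤ (4/3:ℝ) ^ κ := by gcongr
        _ ≤ (4/3:ℝ) ^ 4 := pow_le_pow_right₀ (by norm_num) hκ
        _ ≤ 4 := by norm_num
    calc ∫⁻ x in Rg τ r, ‖EJ r (0:ℤ) g x‖ₑ ^ p * ENNReal.ofReal x.1
        ≤ ∫⁻ x in Rg τ r, G * ENNReal.ofReal (4/3) := by
          refine setLIntegral_mono_ae' (Rg_meas _ _) (ae_of_all _ fun x hx => ?_)
          refine mul_le_mul' ((ENNReal.rpow_le_rpow (EJ_zero_bound x) (by linarith)).trans h2) (ENNReal.ofReal_le_ofReal hx.1.2)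
      _ ≤ ∫⁻ x in Ioc (0:ℝ) (4/3) ×ˢ Icc (-τ) τ, G * ENNReal.ofReal (4/3) := lintegral_mono_set hsub
      _ = G * ENNReal.ofReal (4/3) * (ENNReal.ofReal (4/3) * ENNReal.ofReal (2 * τ)) := by
          rw [setLIntegral_const, Measure.volume_eq_prod, Measure.prod_prod, Real.volume_Ioc, Real.volume_Icc]
          congr 3 <;> ring_nf
      _ = ENNReal.ofReal (4/3 * (4/3 * (2 * τ))) * G := by
          rw [ENNReal.ofReal_mul (p := 4/3) (by norm_num), ENNReal.ofReal_mul (p := 4/3) (by norm_num)]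
          ring
      _ ≤ ENNReal.ofReal (4 * (r ^ κ)⁻¹) * G := by
          refine mul_le_mul_left (ENNReal.ofReal_le_ofReal ?_) _
          nlinarith
      _ ≤ _ := by
          refine mul_le_mul_left ?_ _
          rw [ENNReal.ofReal_mul (by norm_num)]
          refine mul_le_mul' ?_ (by simp)
          push_cast
          simp
  · exact pos M hM g hg hgs

lemma JB_all : ∃ τ : ℝ, 0 < τ ∧ τ ≤ 1 / 4 ∧ (∃ C, JB τ 2 1 1 C) ∧ ∀ p, 4 < p → ∃ C, JB τ p 2 4 C := by
  obtain ⟨τ, h0, h1, H⟩ := jump_Lp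
  obtain ⟨C2, _, H2⟩ := jump_L2
  refine ⟨τ, h0, h1, ⟨_, JB_of h0 h1 (by norm_num) (by norm_num) (C := C2) ?_⟩, ?_⟩
  · intro r M hr0 hr1 hM g hg hgs
    have := H2 τ h0 h1 r M hr0 hr1 hM g hg hgs
    simpa only [pow_one] using this
  · intro p hp
    obtain ⟨C, _, HC⟩ := H p hp
    refine ⟨_, JB_of h0 h1 (by linarith) le_rfl (C := C) ?_⟩
    intro r M hr0 hr1 hM g hg hgs
    refine (HC r M hr0 hr1 hM g hg hgs).trans (le_of_eq ?_)
    congr 3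
    rw [inv_pow]
    congr 1
    ring



/-- `f` has `n` derivatives on `S`, all bounded by `B`. -/
def Bd : ℕ → Set ℝ → (ℝ → ℂ) → ℝ → Prop
  | 0, S, f, B => ∀ r ∈ S, ‖f r‖ ≤ B
  | n + 1, S, f, B => (∀ r ∈ S, ‖f r‖ ≤ B) ∧ ∃ f' : ℝ → ℂ, (∀ r ∈ S, HasDerivAt f (f' r) r) ∧ Bd n S f' B

lemma Bd.bound {n : ℕ} {S : Set ℝ} {f : ℝ → ℂ} {B : ℝ} (h : Bd n S f B) : ∀ r ∈ S, ‖f r‖ ≤ B := by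
  cases n with
  | zero => exact h
  | succ n => exact h.1

lemma Bd.mono {n : ℕ} {S : Set ℝ} {f : ℝ → ℂ} {B B' : ℝ} (h : Bd n S f B) (hB : B ≤ B') : Bd n S f B' := by
  induction n generalizing f with
  | zero => exact fun r hr => (h r hr).trans hB
  | succ n ih =>
    obtain ⟨h1, f', h2, h3⟩ := h
    exact ⟨fun r hr => (h1 r hr).trans hB, f', h2, ih h3⟩

lemma Bd.pred {n : ℕ} {S : Set ℝ} {f : ℝ → ℂ} {B : ℝ} (h : Bd (n + 1) S f B) : Bd n S f B := by
  induction n generalizing f with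
  | zero => exact h.1
  | succ n ih =>
    obtain ⟨h1, f', h2, h3⟩ := h
    exact ⟨h1, f', h2, ih h3⟩

lemma Bd.add {n : ℕ} {S : Set ℝ} {f g : ℝ → ℂ} {B B' : ℝ} (h : Bd n S f B) (h' : Bd n S g B') :
    Bd n S (fun r => f r + g r) (B + B') := by
  induction n generalizing f g with
  | zero => exact fun r hr => (norm_add_le _ _).trans (add_le_add (h r hr) (h' r hr))
  | succ n ih =>
    obtain ⟨h1, f', h2, h3⟩ := h
    obtain ⟨k1, g', k2, k3⟩ := h'
    exact ⟨fun r hr => (norm_add_le _ _).trans (add_le_add (h1 r hr) (k1 r hr)), fun r => f' r + g' r,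
      fun r hr => (h2 r hr).add (k2 r hr), ih h3 k3⟩

lemma Bd.mul {n : ℕ} {S : Set ℝ} {f g : ℝ → ℂ} {B B' : ℝ} (hB : 0 ≤ B) (hB' : 0 ≤ B') (h : Bd n S f B) (h' : Bd n S g B') :
    Bd n S (fun r => f r * g r) (2 ^ n * (B * B')) := by
  induction n generalizing f g with
  | zero =>
    intro r hr
    rw [norm_mul, pow_zero, one_mul]
    exact mul_le_mul (h r hr) (h' r hr) (norm_nonneg _) hB
  | succ n ih =>
    have hf := h.pred
    have hg := h'.pred
    obtain ⟨h1, f', h2, h3⟩ := h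
    obtain ⟨k1, g', k2, k3⟩ := h'
    refine ⟨fun r hr => ?_, fun r => f' r * g r + f r * g' r, fun r hr => (h2 r hr).mul (k2 r hr), ?_⟩
    · rw [norm_mul]
      calc ‖f r‖ * ‖g r‖ ≤ B * B' := mul_le_mul (h1 r hr) (k1 r hr) (norm_nonneg _) hB
        _ ≤ _ := le_mul_of_one_le_left (by positivity) (one_le_pow₀ (by norm_num))
    · have := (ih h3 hg).add (ih hf k3)
      refine this.mono (le_of_eq ?_)
      ring

lemma Bd.const_mul {n : ℕ} {S : Set ℝ} {f : ℝ → ℂ} {B : ℝ} (h : Bd n S f B) (c : ℂ) :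
    Bd n S (fun r => c * f r) (‖c‖ * B) := by
  induction n generalizing f with
  | zero =>
    intro r hr
    rw [norm_mul]
    exact mul_le_mul_of_nonneg_left (h r hr) (norm_nonneg _)
  | succ n ih =>
    obtain ⟨h1, f', h2, h3⟩ := h
    refine ⟨fun r hr => ?_, fun r => c * f' r, fun r hr => (h2 r hr).const_mul c, ih h3⟩
    rw [norm_mul]
    exact mul_le_mul_of_nonneg_left (h1 r hr) (norm_nonneg _)

lemma Bd.congr {n : ℕ} {S : Set ℝ} (hS : IsOpen S) {f g : ℝ → ℂ} {B : ℝ} (h : Bd n S f B) (he : ∀ r ∈ S, g r = f r) :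
    Bd n S g B := by
  cases n with
  | zero => intro r hr; rw [he r hr]; exact h r hr
  | succ n =>
    obtain ⟨h1, f', h2, h3⟩ := h
    refine ⟨fun r hr => by rw [he r hr]; exact h1 r hr, f', fun r hr => ?_, h3⟩
    refine (h2 r hr).congr_of_eventuallyEq ?_
    filter_upwards [hS.mem_nhds hr] with t ht using he t ht

lemma deriv_zero_outside {K : Set ℝ} (hK : IsClosed K) {f : ℝ → ℂ} (h0 : ∀ r, r ∉ K → f r = 0) {r : ℝ} (hr : r ∉ K) :
    HasDerivAt f 0 r := by
  refine (hasDerivAt_const r (0:ℂ)).congr_of_eventuallyEq ?_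
  filter_upwards [hK.isOpen_compl.mem_nhds hr] with t ht using h0 t ht

lemma Bd.ext {n : ℕ} {S K : Set ℝ} (hS : IsOpen S) (hK : IsClosed K) (hKS : K ⊆ S) {f : ℝ → ℂ} {B : ℝ} (hB : 0 ≤ B) (h : Bd n S f B)
    (h0 : ∀ r, r ∉ K → f r = 0) : Bd n univ f B := by
  induction n generalizing f with
  | zero =>
    intro r _
    by_cases hr : r ∈ S
    · exact h r hr
    · rw [h0 r (fun hk => hr (hKS hk))]; simpa using hB
  | succ n ih =>
    obtain ⟨h1, f', h2, h3⟩ := h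
    refine ⟨fun r _ => ?_, S.indicator f', fun r _ => ?_, ih (h3.congr hS fun r hr => indicator_of_mem hr _) ?_⟩
    · by_cases hr : r ∈ S
      · exact h1 r hr
      · rw [h0 r (fun hk => hr (hKS hk))]; simpa using hB
    · by_cases hr : r ∈ S
      · rw [indicator_of_mem hr]; exact h2 r hr
      · rw [indicator_of_notMem hr]; exact deriv_zero_outside hK h0 (fun hk => hr (hKS hk))
    · intro r hr
      by_cases hrS : r ∈ S
      · rw [indicator_of_mem hrS]
        exact (h2 r hrS).unique (deriv_zero_outside hK h0 hr)
      · exact indicator_of_notMem hrS _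

lemma Bd.continuous {n : ℕ} {f : ℝ → ℂ} {B : ℝ} (h : Bd (n + 1) univ f B) : Continuous f := by
  obtain ⟨h1, f', h2, h3⟩ := h
  exact continuous_iff_continuousAt.2 fun r => (h2 r trivial).continuousAt

lemma neg_pi_lt : (-π : ℝ) < -π + 2 * π := by linarith [pi_pos]

lemma fc_norm_le {f : ℝ → ℂ} {B : ℝ} (h : ∀ r, ‖f r‖ ≤ B) (l : ℤ) : ‖fourierCoeffOn neg_pi_lt f l‖ ≤ B := by
  rw [fourierCoeffOn_eq_integral, norm_smul]
  have := intervalIntegral.norm_integral_le_of_norm_le_const (a := -π) (b := -π + 2 * π) (C := B)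
    (f := fun x => fourier (-l) (x : AddCircle (-π + 2 * π - -π)) • f x) (fun x _ => by
      rw [norm_smul, fourier_apply, Circle.norm_coe, one_mul]; exact h x)
  have hp : 0 < -π + 2 * π - -π := by linarith [pi_pos]
  rw [abs_of_pos hp] at this
  rw [norm_of_nonneg (one_div_nonneg.2 hp.le), one_div, inv_mul_le_iff₀ hp]
  rw [mul_comm B] at this
  exact this

lemma fc_decay {n : ℕ} {f : ℝ → ℂ} {B : ℝ} (h : Bd (n + 1) univ f B) (h0 : ∀ r, r ∉ Icc (-2:ℝ) 2 → f r = 0) (l : ℤ) :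
    |(l:ℝ)| ^ n * ‖fourierCoeffOn neg_pi_lt f l‖ ≤ B := by
  induction n generalizing f with
  | zero => rw [pow_zero, one_mul]; exact fc_norm_le (fun r => h.bound r trivial) l
  | succ n ih =>
    have hB : 0 ≤ B := (norm_nonneg _).trans (h.bound 0 trivial)
    by_cases hl : l = 0
    · subst hl; simpa using hB
    obtain ⟨h1, f', h2, h3⟩ := h
    have h0' : ∀ r, r ∉ Icc (-2:ℝ) 2 → f' r = 0 := fun r hr => (h2 r trivial).unique (deriv_zero_outside isClosed_Icc h0 hr)
    have I := ih h3 h0'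
    have pi3 := pi_gt_three
    have e := fourierCoeffOn_of_hasDerivAt neg_pi_lt hl (fun x _ => h2 x trivial)
      (h3.continuous.intervalIntegrable _ _)
    rw [h0 (-π) (fun h => by linarith [h.1]), h0 (-π + 2 * π) (fun h => by linarith [h.2])] at e
    have hl' : (l:ℂ) ≠ 0 := by exact_mod_cast hl
    have e2 : fourierCoeffOn neg_pi_lt f l = (Complex.I * l)⁻¹ * fourierCoeffOn neg_pi_lt f' l := by
      rw [e]
      push_cast
      have : (π:ℂ) ≠ 0 := by exact_mod_cast pi_pos.ne'
      field_simp
      ring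
    rw [e2, norm_mul, norm_inv, norm_mul, Complex.norm_I, one_mul, Complex.norm_intCast, pow_succ]
    have : |(l:ℝ)| ≠ 0 := by simpa using hl
    calc |(l:ℝ)| ^ n * |(l:ℝ)| * (|(l:ℝ)|⁻¹ * ‖fourierCoeffOn neg_pi_lt f' l‖)
        = |(l:ℝ)| ^ n * ‖fourierCoeffOn neg_pi_lt f' l‖ := by field_simp
      _ ≤ B := I

lemma summable_inv4 : Summable fun l : ℤ => ((1 + |(l:ℝ)|) ^ 4)⁻¹ := by
  have h2 : Summable fun l : ℤ => |(l:ℝ)| ^ (-(4:ℝ)) := Real.summable_abs_int_rpow (by norm_num)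
  refine Summable.of_norm_bounded_eventually h2 ?_
  have : ({0} : Set ℤ)ᶜ ∈ Filter.cofinite := (Set.finite_singleton 0).compl_mem_cofinite
  filter_upwards [this] with l hl
  have hl' : 0 < |(l:ℝ)| := by simpa using hl
  rw [norm_of_nonneg (by positivity), rpow_neg hl'.le]
  refine inv_anti₀ (by positivity) ?_
  rw [show (4:ℝ) = ((4:ℕ):ℝ) by norm_num, rpow_natCast]
  gcongr
  linarith

lemma fourier_exp {f : ℝ → ℂ} {B : ℝ} (h : Bd 5 univ f B) (h0 : ∀ r, r ∉ Icc (-2:ℝ) 2 → f r = 0) :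
    ∃ c : ℤ → ℂ, (∀ l, ‖c l‖ ≤ 16 * B * ((1 + |(l:ℝ)|) ^ 4)⁻¹) ∧
      ∀ x ∈ Icc (-3:ℝ) 3, HasSum (fun l : ℤ => c l * Complex.exp (Complex.I * ((l * x : ℝ) : ℂ))) (f x) := by
  have hB : 0 ≤ B := (norm_nonneg _).trans (h.bound 0 trivial)
  have pi3 := pi_gt_three
  have bd : ∀ l : ℤ, ‖fourierCoeffOn neg_pi_lt f l‖ ≤ 16 * B * ((1 + |(l:ℝ)|) ^ 4)⁻¹ := by
    intro l
    rw [← div_eq_mul_inv, le_div_iff₀ (by positivity)]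
    by_cases hl : l = 0
    · subst hl
      have := fc_norm_le (fun r => h.bound r trivial) 0
      simp only [Int.cast_zero, abs_zero, add_zero, one_pow, mul_one]
      linarith
    · have h1 : (1:ℝ) ≤ |(l:ℝ)| := by exact_mod_cast Int.one_le_abs hl
      have h2 : (1 + |(l:ℝ)|) ^ 4 ≤ 16 * |(l:ℝ)| ^ 4 := by
        calc (1 + |(l:ℝ)|) ^ 4 ≤ (2 * |(l:ℝ)|) ^ 4 := by gcongr; linarith
          _ = _ := by ring
      have := fc_decay h h0 l
      calc ‖fourierCoeffOn neg_pi_lt f l‖ * (1 + |(l:ℝ)|) ^ 4 ≤ ‖fourierCoeffOn neg_pi_lt f l‖ * (16 * |(l:ℝ)| ^ 4) := by gcongr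
        _ ≤ 16 * B := by linarith
  haveI : Fact (0 < 2 * π) := ⟨two_pi_pos⟩
  refine ⟨fun l => fourierCoeffOn neg_pi_lt f l, bd, ?_⟩
  intro x hx
  have fc : Continuous f := h.continuous
  let F : C(AddCircle (2 * π), ℂ) := ⟨AddCircle.liftIco (2 * π) (-π) f, AddCircle.liftIco_continuous
    (by rw [h0 (-π) (fun h => by linarith [h.1]), h0 (-π + 2 * π) (fun h => by linarith [h.2])]) fc.continuousOn⟩
  have hF : ∀ l, fourierCoeff F l = fourierCoeffOn neg_pi_lt f l := fun l => fourierCoeff_liftIco_eq f l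
  have sm : Summable (fourierCoeff F) := by
    refine Summable.of_norm_bounded (summable_inv4.mul_left (16 * B)) fun l => ?_
    rw [hF]; exact bd l
  have := has_pointwise_sum_fourier_series_of_summable sm (x : AddCircle (2 * π))
  have e : F (x : AddCircle (2 * π)) = f x := AddCircle.liftIco_coe_apply ⟨by linarith [hx.1], by linarith [hx.2]⟩
  rw [e] at this
  convert this using 1
  ext l
  rw [hF, smul_eq_mul, fourier_coe_apply]
  congr 2
  push_cast
  have : (π:ℂ) ≠ 0 := by exact_mod_cast pi_pos.ne'
  field_simp


lemma bd_pow (n : ℕ) : ∀ σ : ℝ, ∃ B : ℝ, 0 ≤ B ∧ ∀ c ∈ Icc (0:ℝ) 1,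
    Bd n (Ioo (1/4:ℝ) 2) (fun r => (((c + r) ^ σ : ℝ) : ℂ)) B := by
  have key : ∀ σ : ℝ, ∀ c ∈ Icc (0:ℝ) 1, ∀ r ∈ Ioo (1/4:ℝ) 2, ‖(((c + r) ^ σ : ℝ) : ℂ)‖ ≤ 4 ^ |σ| := by
    intro σ c hc r hr
    have h0 : 0 < c + r := by linarith [hc.1, hr.1]
    rw [Complex.norm_real, norm_of_nonneg (rpow_nonneg h0.le _)]
    rcases le_total 0 σ with h | h
    · rw [abs_of_nonneg h]; exact rpow_le_rpow h0.le (by linarith [hc.2, hr.2]) h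
    · rw [abs_of_nonpos h, rpow_neg (by norm_num), ← inv_rpow (by norm_num)]
      exact rpow_le_rpow_of_nonpos (by norm_num) (by linarith [hc.1, hr.1]) h
  induction n with
  | zero => intro σ; exact ⟨4 ^ |σ|, by positivity, fun c hc => key σ c hc⟩
  | succ n ih =>
    intro σ
    obtain ⟨B, hB, h⟩ := ih (σ - 1)
    refine ⟨max (4 ^ |σ|) (‖(σ:ℂ)‖ * B), le_max_of_le_left (by positivity), fun c hc => ?_⟩
    refine ⟨fun r hr => (key σ c hc r hr).trans (le_max_left _ _), fun r => (σ:ℂ) * (((c + r) ^ (σ - 1) : ℝ) : ℂ), fun r hr => ?_, ((h c hc).const_mul _).mono (le_max_right _ _)⟩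
    have h0 : c + r ≠ 0 := by linarith [hc.1, hr.1]
    have := ((hasDerivAt_id r).const_add c).rpow_const (p := σ) (Or.inl h0)
    refine HasDerivAt.congr_deriv this.ofReal_comp ?_
    push_cast
    simp

lemma bd_sym {a : ℝ → ℂ} (ha : IsSymbol0 a) (n : ℕ) : ∀ k : ℕ, ∃ B : ℝ, 0 ≤ B ∧ ∀ N : ℝ, 0 < N →
    Bd n (Ioo (1/4:ℝ) 2) (fun r => ((N ^ k : ℝ) : ℂ) * iteratedDerivWithin k a (Ioi 0) (N * r)) B := by
  have key : ∀ k : ℕ, ∃ B : ℝ, 0 ≤ B ∧ ∀ N : ℝ, 0 < N → ∀ r ∈ Ioo (1/4:ℝ) 2,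
      ‖((N ^ k : ℝ) : ℂ) * iteratedDerivWithin k a (Ioi 0) (N * r)‖ ≤ B := by
    intro k
    obtain ⟨C, hC⟩ := ha.2.2 k
    refine ⟨|C| * 4 ^ k, by positivity, fun N hN r hr => ?_⟩
    have r0 : 0 < r := by linarith [hr.1]
    have h := hC (N * r) (by positivity)
    rw [norm_mul, Complex.norm_real, norm_of_nonneg (by positivity)]
    rw [rpow_neg (by positivity), rpow_natCast] at h
    calc N ^ k * ‖iteratedDerivWithin k a (Ioi 0) (N * r)‖ ≤ N ^ k * (|C| * ((N * r) ^ k)⁻¹) := by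
          gcongr; exact h.trans (by gcongr; exact le_abs_self C)
      _ = |C| * (r⁻¹) ^ k := by rw [mul_pow, inv_pow]; field_simp
      _ ≤ |C| * 4 ^ k := by
          gcongr
          rw [inv_le_comm₀ r0 (by norm_num)]; linarith [hr.1]
  induction n with
  | zero => intro k; obtain ⟨B, hB, h⟩ := key k; exact ⟨B, hB, fun N hN => h N hN⟩
  | succ n ih =>
    intro k
    obtain ⟨B, hB, h⟩ := ih (k + 1)
    obtain ⟨B', hB', h'⟩ := key k
    refine ⟨max B' B, le_max_of_le_left hB', fun N hN => ?_⟩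
    refine ⟨fun r hr => (h' N hN r hr).trans (le_max_left _ _), _, fun r hr => ?_, (h N hN).mono (le_max_right _ _)⟩
    have r0 : 0 < N * r := mul_pos hN (by linarith [hr.1])
    have hd : HasDerivAt (iteratedDerivWithin k a (Ioi 0)) (iteratedDerivWithin (k+1) a (Ioi 0) (N * r)) (N * r) := by
      have d := ha.1.differentiableOn_iteratedDerivWithin (m := k) (by exact_mod_cast WithTop.coe_lt_top _) (uniqueDiffOn_Ioi 0)
      have := (d (N * r) r0).hasDerivWithinAt
      rw [← iteratedDerivWithin_succ] at this
      exact this.hasDerivAt (Ioi_mem_nhds r0)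
    have l : HasDerivAt (fun r : ℝ => N * r) N r := by simpa using (hasDerivAt_id r).const_mul N
    refine HasDerivAt.congr_deriv ((hd.scomp r l).const_mul _) ?_
    rw [pow_succ, Complex.real_smul]; push_cast; ring

lemma bd_smooth {β : ℝ → ℝ} (hβ : ContDiff ℝ (⊤ : ℕ∞) β) (u v : ℝ) (n : ℕ) : ∀ k : ℕ, ∃ B : ℝ, 0 ≤ B ∧
    Bd n (Icc u v) (fun r => ((iteratedDeriv k β r : ℝ) : ℂ)) B := by
  have key : ∀ k : ℕ, ∃ B : ℝ, 0 ≤ B ∧ ∀ r ∈ Icc u v, ‖((iteratedDeriv k β r : ℝ) : ℂ)‖ ≤ B := by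
    intro k
    obtain ⟨B, hB⟩ := isCompact_Icc.exists_bound_of_continuousOn (hβ.continuous_iteratedDeriv k (by exact_mod_cast le_top)).continuousOn (s := Icc u v)
    refine ⟨|B|, abs_nonneg _, fun r hr => ?_⟩
    rw [Complex.norm_real]; exact (hB r hr).trans (le_abs_self _)
  induction n with
  | zero => intro k; obtain ⟨B, hB, h⟩ := key k; exact ⟨B, hB, h⟩
  | succ n ih =>
    intro k
    obtain ⟨B, hB, h⟩ := ih (k + 1)
    obtain ⟨B', hB', h'⟩ := key k
    refine ⟨max B' B, le_max_of_le_left hB', fun r hr => (h' r hr).trans (le_max_left _ _), _, fun r hr => ?_, h.mono (le_max_right _ _)⟩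
    have := (hβ.differentiable_iteratedDeriv k (by exact_mod_cast WithTop.coe_lt_top _) r).hasDerivAt
    rw [← iteratedDeriv_succ] at this
    exact this.ofReal_comp

lemma Bd.subset {n : ℕ} {S S' : Set ℝ} {f : ℝ → ℂ} {B : ℝ} (h : Bd n S f B) (hs : S' ⊆ S) : Bd n S' f B := by
  induction n generalizing f with
  | zero => exact fun r hr => h r (hs hr)
  | succ n ih => obtain ⟨h1, f', h2, h3⟩ := h; exact ⟨fun r hr => h1 r (hs hr), f', fun r hr => h2 r (hs hr), ih h3⟩

lemma bd_amp {δ : ℝ} {a : ℝ → ℂ} (ha : IsSymbol0 a) {β : ℝ → ℝ} (hβ : ContDiff ℝ (⊤ : ℕ∞) β)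
    (hβs : Function.support β ⊆ Set.Icc (3 / 8) (4 / 3)) :
    ∃ B : ℝ, ∀ j : ℕ, Bd 5 univ (bfun δ a β j) B := by
  obtain ⟨B1, hB1, h1⟩ := bd_smooth hβ (1/4) 2 5 0
  obtain ⟨B2, hB2, h2⟩ := bd_pow 5 (-(3 / 2 + δ))
  obtain ⟨B3, hB3, h3⟩ := bd_sym ha 5 0
  refine ⟨2 ^ 5 * (2 ^ 5 * (B1 * B2) * B3), fun j => ?_⟩
  have hc : (2 : ℝ) ^ (-(j : ℝ)) ∈ Icc (0:ℝ) 1 := ⟨by positivity, rpow_le_one_of_one_le_of_nonpos (by norm_num) (by simp)⟩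
  have := (Bd.mul hB1 hB2 (h1.subset Ioo_subset_Icc_self) (h2 _ hc)).mul (by positivity) hB3 (h3 ((2:ℝ) ^ (j:ℝ)) (by positivity))
  refine Bd.ext isOpen_Ioo (isClosed_Icc (a := (3/8:ℝ)) (b := 4/3)) (Icc_subset_Ioo (by norm_num) (by norm_num)) (by positivity)
    (this.congr isOpen_Ioo fun r hr => ?_) (fun r hr => ?_)
  rotate_left
  · have : β r = 0 := by by_contra hh; exact hr (hβs hh)
    simp [bfun, this]
  · simp [bfun]

lemma bd_eta {η : ℝ → ℝ} (hη : ContDiff ℝ (⊤ : ℕ∞) η) {ε : ℝ} (he : ε ≤ 1/4)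
    (hs : Function.support η ⊆ Set.Icc (π - 2 * ε) (π + 2 * ε)) :
    ∃ B : ℝ, Bd 5 univ (fun s => ((η (s + π) : ℝ) : ℂ)) B := by
  have h' : ContDiff ℝ (⊤ : ℕ∞) (fun s => η (s + π)) := hη.comp (contDiff_id.add contDiff_const)
  obtain ⟨B1, hB1, h1⟩ := bd_smooth h' (-2) 2 5 0
  refine ⟨B1, Bd.ext (isOpen_Ioo (a := (-1:ℝ)) (b := 1)) (isClosed_Icc (a := (-1/2:ℝ)) (b := 1/2)) (Icc_subset_Ioo (by norm_num) (by norm_num)) hB1 ((h1.subset ?_).congr isOpen_Ioo fun r hr => ?_) (fun r hr => ?_)⟩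
  rotate_left 2
  · have : η (r + π) = 0 := by
      by_contra hh
      have := hs hh
      exact hr ⟨by linarith [this.1], by linarith [this.2]⟩
    simp [this]
  · exact fun x hx => ⟨by linarith [hx.1], by linarith [hx.2]⟩
  · simp


def SJ (r N : ℝ) (A E g : ℝ → ℂ) (x : ℝ × ℝ) : ℂ :=
  ∫ t in Ici x.2, A (PB r x.1 x.2 t) * Complex.exp (Complex.I * ((N * PB r x.1 x.2 t : ℝ) : ℂ)) * E (x.2 - t) * g t

lemma PB_le {r u v t : ℝ} (hr : 0 ≤ r) (hu : 0 ≤ u) : PB r u v t ≤ u + r := by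
  unfold PB
  rw [Real.sqrt_le_left (by positivity)]
  have h1 : (u + r * cos (v - t)) ^ 2 + (r * sin (v - t)) ^ 2 = u ^ 2 + 2 * (u * r * cos (v - t)) + r ^ 2 * (sin (v - t) ^ 2 + cos (v - t) ^ 2) := by ring
  rw [h1, sin_sq_add_cos_sq]
  nlinarith [mul_le_mul_of_nonneg_left (cos_le_one (v - t)) (mul_nonneg hu hr)]

lemma norm_cexp_real (y : ℝ) : ‖Complex.exp (Complex.I * (y : ℂ))‖ = 1 := by
  rw [mul_comm]; exact Complex.norm_exp_ofReal_mul_I y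

def tw (n : ℤ) (g : ℝ → ℂ) : ℝ → ℂ := fun t => Complex.exp (Complex.I * ((-(n * t) : ℝ) : ℂ)) * g t

lemma tw_meas {n : ℤ} {g : ℝ → ℂ} (hg : Measurable g) : Measurable (tw n g) := by
  unfold tw; fun_prop

lemma tw_enorm (n : ℤ) (g : ℝ → ℂ) (t : ℝ) : ‖tw n g t‖ₑ = ‖g t‖ₑ := by
  unfold tw
  rw [enorm_mul, ← ofReal_norm, norm_cexp_real]; simp

lemma SJ_le {τ r : ℝ} (hτ : τ ≤ 1 / 4) (hr0 : 0 < r) (hr : r ≤ 4 / 3) {A E : ℝ → ℂ} {c d : ℤ → ℂ}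
    (sc : Summable fun l => ‖c l‖) (sd : Summable fun l => ‖d l‖)
    (hc : ∀ x ∈ Icc (-3:ℝ) 3, HasSum (fun l : ℤ => c l * Complex.exp (Complex.I * ((l * x : ℝ) : ℂ))) (A x))
    (hd : ∀ x ∈ Icc (-3:ℝ) 3, HasSum (fun l : ℤ => d l * Complex.exp (Complex.I * ((l * x : ℝ) : ℂ))) (E x))
    (N : ℤ) {g : ℝ → ℂ} (hg : Integrable g) (hgs : ∀ t, t ∉ Icc (-τ) τ → g t = 0) {x : ℝ × ℝ} (hx : x ∈ Rg τ r) :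
    ‖SJ r N A E g x‖ₑ ≤ ∑' q : ℤ × ℤ, ‖c q.1‖ₑ * ‖d q.2‖ₑ * ‖EJ r ((N + q.1 : ℤ) : ℝ) (tw q.2 g) x‖ₑ := by
  obtain ⟨u, v⟩ := x
  obtain ⟨hu, -, hv⟩ := hx
  dsimp only at hu hv
  set F : ℤ × ℤ → ℝ → ℂ := fun q t => (c q.1 * d q.2 * Complex.exp (Complex.I * ((q.2 * v : ℝ) : ℂ))) *
    (Complex.exp (Complex.I * ((((N + q.1 : ℤ) : ℝ) * PB r u v t : ℝ) : ℂ)) * tw q.2 g t) with hF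
  have Fn : ∀ q t, ‖F q t‖ = ‖c q.1‖ * ‖d q.2‖ * ‖g t‖ := by
    intro q t
    simp only [hF, tw, norm_mul, norm_cexp_real]; ring
  have scd : Summable fun q : ℤ × ℤ => ‖c q.1‖ * ‖d q.2‖ := sc.mul_of_nonneg sd (fun _ => norm_nonneg _) (fun _ => norm_nonneg _)
  have cP : Continuous fun t => PB r u v t := by unfold PB; fun_prop
  have Fi : ∀ q, Integrable (F q) (volume.restrict (Ici v)) := by
    intro q
    refine Integrable.mono' (hg.restrict.norm.const_mul (‖c q.1‖ * ‖d q.2‖)) ?_ (ae_of_all _ fun t => (Fn q t).le)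
    simp only [hF, tw]
    have := hg.restrict (s := Ici v) |>.aestronglyMeasurable
    have c1 : Continuous fun t => Complex.exp (Complex.I * ((((N + q.1 : ℤ) : ℝ) * PB r u v t : ℝ) : ℂ)) := by fun_prop
    have c2 : Continuous fun t : ℝ => Complex.exp (Complex.I * ((-(q.2 * t) : ℝ) : ℂ)) := by fun_prop
    exact (c1.aestronglyMeasurable.mul (c2.aestronglyMeasurable.mul this)).const_mul _
  have Fs : Summable fun q => ∫ t in Ici v, ‖F q t‖ := by
    simp only [Fn]
    simp_rw [integral_const_mul]
    exact scd.mul_right _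
  have pt : ∀ t, A (PB r u v t) * Complex.exp (Complex.I * ((N * PB r u v t : ℝ) : ℂ)) * E (v - t) * g t = ∑' q, F q t := by
    intro t
    by_cases ht : t ∈ Icc (-τ) τ
    · have h1 := hc (PB r u v t) ⟨by linarith [show 0 ≤ PB r u v t from Real.sqrt_nonneg _], by linarith [PB_le (v := v) (t := t) hr0.le hu.1.le, hu.2]⟩
      have h2 := hd (v - t) ⟨by linarith [hv.1, ht.2], by linarith [hv.2, ht.1]⟩
      have h3 := h1.mul h2 (by
        refine Summable.of_norm ?_
        simpa only [norm_mul, norm_cexp_real, mul_one] using scd)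
      have h4 := (h3.mul_right (Complex.exp (Complex.I * ((N * PB r u v t : ℝ) : ℂ)) * g t)).tsum_eq
      rw [show A (PB r u v t) * Complex.exp (Complex.I * ((N * PB r u v t : ℝ) : ℂ)) * E (v - t) * g t =
        A (PB r u v t) * E (v - t) * (Complex.exp (Complex.I * ((N * PB r u v t : ℝ) : ℂ)) * g t) by ring, ← h4]
      refine tsum_congr fun q => ?_
      simp only [hF, tw]
      rw [show Complex.I * ((((N + q.1 : ℤ) : ℝ) * PB r u v t : ℝ) : ℂ) = Complex.I * ((N * PB r u v t : ℝ) : ℂ) + Complex.I * ((q.1 * PB r u v t : ℝ) : ℂ) by push_cast; ring,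
        show Complex.I * ((q.2 * (v - t) : ℝ) : ℂ) = Complex.I * ((q.2 * v : ℝ) : ℂ) + Complex.I * ((-(q.2 * t) : ℝ) : ℂ) by push_cast; ring,
        Complex.exp_add, Complex.exp_add]
      ring
    · simp [hF, tw, hgs t ht]
  have key : SJ r N A E g (u, v) = ∑' q, ∫ t in Ici v, F q t := by
    have := (hasSum_integral_of_summable_integral_norm Fi Fs).tsum_eq
    rw [this]
    unfold SJ
    exact integral_congr_ae (ae_of_all _ fun t => pt t)
  rw [key]
  refine enorm_tsum_le_tsum_enorm.trans (ENNReal.tsum_le_tsum fun q => le_of_eq ?_)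
  simp only [hF]
  rw [integral_const_mul, enorm_mul, enorm_mul, enorm_mul, ← ofReal_norm (Complex.exp _), norm_cexp_real]
  simp [EJ]

lemma summable_inv2 : Summable fun l : ℤ => ((1 + |(l:ℝ)|) ^ 2)⁻¹ := by
  have h2 : Summable fun l : ℤ => |(l:ℝ)| ^ (-(2:ℝ)) := Real.summable_abs_int_rpow (by norm_num)
  refine Summable.of_norm_bounded_eventually h2 ?_
  have : ({0} : Set ℤ)ᶜ ∈ Filter.cofinite := (Set.finite_singleton 0).compl_mem_cofinite
  filter_upwards [this] with l hl
  have hl' : 0 < |(l:ℝ)| := by simpa using hl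
  rw [norm_of_nonneg (by positivity), rpow_neg hl'.le]
  refine inv_anti₀ (by positivity) ?_
  rw [show (2:ℝ) = ((2:ℕ):ℝ) by norm_num, rpow_natCast]
  gcongr
  linarith

lemma shift_le (N : ℕ) (l : ℤ) {s κ : ℕ} (hs : s ≤ 2) (hN : 1 ≤ N) {r : ℝ} (hr : 0 < r) :
    ((1 + |(((N:ℤ) + l : ℤ) : ℝ)|) ^ s * r ^ κ)⁻¹ ≤ (1 + |(l:ℝ)|) ^ 2 * ((N:ℝ) ^ s * r ^ κ)⁻¹ := by
  have h0 : (0:ℝ) < N := by exact_mod_cast hN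
  have h1 : (N:ℝ) ≤ (1 + |(((N:ℤ) + l : ℤ) : ℝ)|) * (1 + |(l:ℝ)|) := by
    push_cast
    have := abs_add_le ((N:ℝ) + l) (-l)
    rw [add_neg_cancel_right, abs_neg, abs_of_pos h0] at this
    nlinarith [abs_nonneg ((N:ℝ) + l), abs_nonneg (l:ℝ)]
  have h2 : (N:ℝ) ^ s ≤ (1 + |(((N:ℤ) + l : ℤ) : ℝ)|) ^ s * (1 + |(l:ℝ)|) ^ 2 := by
    calc (N:ℝ) ^ s ≤ ((1 + |(((N:ℤ) + l : ℤ) : ℝ)|) * (1 + |(l:ℝ)|)) ^ s := by gcongr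
      _ = (1 + |(((N:ℤ) + l : ℤ) : ℝ)|) ^ s * (1 + |(l:ℝ)|) ^ s := mul_pow _ _ _
      _ ≤ _ := by
        gcongr
        linarith [abs_nonneg (l:ℝ)]
  rw [← div_eq_mul_inv, inv_le_comm₀ (by positivity) (by positivity), inv_div, div_le_iff₀ (by positivity)]
  nlinarith [mul_le_mul_of_nonneg_right h2 (pow_pos hr κ).le]

lemma SB {τ p : ℝ} {s κ : ℕ} {C0 : ℝ≥0} (hτ0 : 0 < τ) (hτ : τ ≤ 1 / 4) (hp : 1 < p) (hs : s ≤ 2) (hJ : JB τ p s κ C0)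
    (B1 B2 : ℝ) : ∃ C : ℝ≥0, ∀ A E : ℝ → ℂ, Bd 5 univ A B1 → (∀ r, r ∉ Icc (-2:ℝ) 2 → A r = 0) →
      Bd 5 univ E B2 → (∀ r, r ∉ Icc (-2:ℝ) 2 → E r = 0) → ∀ N : ℕ, 1 ≤ N → ∀ r : ℝ, 0 < r → r ≤ 4 / 3 →
      ∀ g : ℝ → ℂ, Measurable g → (∀ t, t ∉ Icc (-τ) τ → g t = 0) →
      ∫⁻ x in Rg τ r, ‖SJ r N A E g x‖ₑ ^ p * ENNReal.ofReal x.1 ≤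
        C * ENNReal.ofReal (((N:ℝ) ^ s * r ^ κ)⁻¹) * ∫⁻ t, ‖g t‖ₑ ^ p := by
  set w : ℤ × ℤ → ℝ≥0∞ := fun q => ENNReal.ofReal (16 * B1 * ((1 + |(q.1:ℝ)|) ^ 4)⁻¹) * ENNReal.ofReal (16 * B2 * ((1 + |(q.2:ℝ)|) ^ 4)⁻¹) with hw
  set w2 : ℤ × ℤ → ℝ≥0∞ := fun q => w q * ENNReal.ofReal ((1 + |(q.1:ℝ)|) ^ 2) with hw2
  have e1 : ∀ B : ℝ, ∑' l : ℤ, ENNReal.ofReal (16 * B * ((1 + |(l:ℝ)|) ^ 4)⁻¹) ≠ ⊤ := fun B =>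
    (summable_inv4.mul_left (16 * B)).tsum_ofReal_ne_top
  have e2 : ∀ B : ℝ, ∑' l : ℤ, ENNReal.ofReal (16 * B * ((1 + |(l:ℝ)|) ^ 4)⁻¹) * ENNReal.ofReal ((1 + |(l:ℝ)|) ^ 2) ≠ ⊤ := by
    intro B
    convert (summable_inv2.mul_left (16 * B)).tsum_ofReal_ne_top using 4 with l
    rw [← ENNReal.ofReal_mul' (by positivity)]
    congr 1
    field_simp
  have hW : ∑' q, w q ≠ ⊤ := by
    rw [ENNReal.tsum_prod']
    simp only [hw, ENNReal.tsum_mul_left, ENNReal.tsum_mul_right]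
    exact ENNReal.mul_ne_top (e1 _) (e1 _)
  have hW2 : ∑' q, w2 q ≠ ⊤ := by
    rw [ENNReal.tsum_prod']
    have : ∀ a b : ℤ, w2 (a, b) = (ENNReal.ofReal (16 * B1 * ((1 + |(a:ℝ)|) ^ 4)⁻¹) * ENNReal.ofReal ((1 + |(a:ℝ)|) ^ 2)) * ENNReal.ofReal (16 * B2 * ((1 + |(b:ℝ)|) ^ 4)⁻¹) := by
      intro a b; simp only [hw2, hw]; ring
    simp only [this, ENNReal.tsum_mul_left, ENNReal.tsum_mul_right]
    exact ENNReal.mul_ne_top (e2 _) (e1 _)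
  have hWp : (∑' q, w q) ^ (p - 1) ≠ ⊤ := ENNReal.rpow_ne_top_of_nonneg (by linarith) hW
  set C : ℝ≥0 := ((∑' q, w q) ^ (p - 1) * (∑' q, w2 q)).toNNReal * C0 + 1 with hC
  have hC' : (C : ℝ≥0∞) = (∑' q, w q) ^ (p - 1) * (∑' q, w2 q) * C0 + 1 := by
    rw [hC]; push_cast; rw [ENNReal.coe_toNNReal (ENNReal.mul_ne_top hWp hW2)]
  refine ⟨C, fun A E hA hA0 hE hE0 N hN r hr0 hr g hg hgs => ?_⟩
  have hN0 : (0:ℝ) < N := by exact_mod_cast hN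
  by_cases hfin : ∫⁻ t, ‖g t‖ₑ ^ p = ⊤
  · rw [hfin, ENNReal.mul_top]
    · exact le_top
    · refine mul_ne_zero (by rw [hC']; simp) ?_
      rw [Ne, ENNReal.ofReal_eq_zero, not_le]; positivity
  have gi := integrable_of_Lp hg (α := -τ) (ℓ := 2 * τ) (by linarith) (by rwa [show -τ + 2 * τ = τ by ring]) hp hfin
  obtain ⟨c, hc, hcs⟩ := fourier_exp hA hA0
  obtain ⟨d, hd, hds⟩ := fourier_exp hE hE0
  have sc : Summable fun l => ‖c l‖ := Summable.of_nonneg_of_le (fun _ => norm_nonneg _) hc (summable_inv4.mul_left _)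
  have sd : Summable fun l => ‖d l‖ := Summable.of_nonneg_of_le (fun _ => norm_nonneg _) hd (summable_inv4.mul_left _)
  have hcd : ∀ q : ℤ × ℤ, ‖c q.1‖ₑ * ‖d q.2‖ₑ ≤ w q := fun q => by
    rw [← ofReal_norm, ← ofReal_norm]
    exact mul_le_mul' (ENNReal.ofReal_le_ofReal (hc _)) (ENNReal.ofReal_le_ofReal (hd _))
  have pt : ∀ x ∈ Rg τ r, ‖SJ r N A E g x‖ₑ ^ p * ENNReal.ofReal x.1 ≤
      (∑' q, w q) ^ (p - 1) * ∑' q, w q * (‖EJ r (((N:ℤ) + q.1 : ℤ) : ℝ) (tw q.2 g) x‖ₑ ^ p * ENNReal.ofReal x.1) := by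
    intro x hx
    have h1 := SJ_le hτ hr0 hr sc sd hcs hds (N:ℤ) gi hgs hx
    rw [Int.cast_natCast] at h1
    have h2 := (ENNReal.rpow_le_rpow (h1.trans (ENNReal.tsum_le_tsum fun q => mul_le_mul_left (hcd q) _)) (by linarith : 0 ≤ p)).trans
      (jensen_tsum hp w _)
    refine (mul_le_mul_left h2 _).trans (le_of_eq ?_)
    rw [mul_assoc, ← ENNReal.tsum_mul_right]
    congr 1
    exact tsum_congr fun q => by ring
  have em : ∀ q : ℤ × ℤ, Measurable fun x : ℝ × ℝ => ‖EJ r (((N:ℤ) + q.1 : ℤ) : ℝ) (tw q.2 g) x‖ₑ ^ p * ENNReal.ofReal x.1 := fun q =>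
    ((EJ_meas (tw_meas hg)).enorm.pow_const p).mul (by fun_prop)
  calc ∫⁻ x in Rg τ r, ‖SJ r N A E g x‖ₑ ^ p * ENNReal.ofReal x.1
      ≤ ∫⁻ x in Rg τ r, (∑' q, w q) ^ (p - 1) * ∑' q, w q * (‖EJ r (((N:ℤ) + q.1 : ℤ) : ℝ) (tw q.2 g) x‖ₑ ^ p * ENNReal.ofReal x.1) :=
        setLIntegral_mono_ae' (Rg_meas _ _) (ae_of_all _ pt)
    _ = (∑' q, w q) ^ (p - 1) * ∑' q, w q * ∫⁻ x in Rg τ r, ‖EJ r (((N:ℤ) + q.1 : ℤ) : ℝ) (tw q.2 g) x‖ₑ ^ p * ENNReal.ofReal x.1 := by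
        rw [lintegral_const_mul' _ _ hWp, lintegral_tsum fun q => ((em q).const_mul _).aemeasurable]
        congr 1
        exact tsum_congr fun q => lintegral_const_mul _ (em q)
    _ ≤ (∑' q, w q) ^ (p - 1) * ∑' q, w2 q * (C0 * ENNReal.ofReal (((N:ℝ) ^ s * r ^ κ)⁻¹) * ∫⁻ t, ‖g t‖ₑ ^ p) := by
        refine mul_le_mul_right (ENNReal.tsum_le_tsum fun q => ?_) _
        have h1 := hJ r hr0 hr ((N:ℤ) + q.1) (tw q.2 g) (tw_meas hg) (fun t ht => by simp [tw, hgs t ht])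
        simp only [tw_enorm] at h1
        calc _ ≤ w q * (C0 * ENNReal.ofReal ((1 + |(q.1:ℝ)|) ^ 2 * ((N:ℝ) ^ s * r ^ κ)⁻¹) * ∫⁻ t, ‖g t‖ₑ ^ p) := by
              refine mul_le_mul_right (h1.trans (mul_le_mul_left (mul_le_mul_right (ENNReal.ofReal_le_ofReal (shift_le N q.1 hs hN hr0)) _) _)) _
          _ = _ := by
              rw [ENNReal.ofReal_mul (by positivity)]; simp only [hw2]; ring
    _ = (∑' q, w q) ^ (p - 1) * (∑' q, w2 q) * C0 * ENNReal.ofReal (((N:ℝ) ^ s * r ^ κ)⁻¹) * ∫⁻ t, ‖g t‖ₑ ^ p := by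
        rw [ENNReal.tsum_mul_right]; ring
    _ ≤ _ := by
        rw [hC']
        exact mul_le_mul_left (mul_le_mul_left le_self_add _) _


lemma dense_select (X : Set (ℝ × ℝ)) (G : ℝ × ℝ → ℝ → ℂ) (μ : Measure ℝ) [SigmaFinite μ] (hG : ∀ x ∈ X, Integrable (G x) μ) :
    ∃ D : Set (ℝ × ℝ), D.Countable ∧ D ⊆ X ∧ ∀ x ∈ X, ∃ d : ℕ → ℝ × ℝ, (∀ n, d n ∈ D) ∧
      Filter.Tendsto d Filter.atTop (nhds x) ∧
      ∀ᵐ r ∂μ, Filter.Tendsto (fun n => G (d n) r) Filter.atTop (nhds (G x r)) := by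
  have : Fact ((1:ℝ≥0∞) ≠ ⊤) := ⟨by simp⟩
  rcases X.eq_empty_or_nonempty with hX | hX
  · exact ⟨∅, countable_empty, by simp, by simp [hX]⟩
  have : Nonempty X := hX.to_subtype
  let ψ : X → (ℝ × ℝ) × Lp ℂ 1 μ := fun x => (x.1, (memLp_one_iff_integrable.2 (hG x.1 x.2)).toLp (G x.1))
  have hsep : TopologicalSpace.IsSeparable (range ψ) := TopologicalSpace.IsSeparable.of_separableSpace _
  obtain ⟨t, htsub, htc, htd⟩ := hsep.exists_countable_dense_subset
  choose! inv hinv using fun (y : (ℝ × ℝ) × Lp ℂ 1 μ) (hy : y ∈ t) => htsub hy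
  refine ⟨(fun y => (inv y : ℝ × ℝ)) '' t, htc.image _, ?_, ?_⟩
  · rintro _ ⟨y, -, rfl⟩; exact (inv y).2
  · intro x hx
    obtain ⟨y, hy, hyt⟩ := mem_closure_iff_seq_limit.1 (htd (mem_range_self (⟨x, hx⟩ : X)))
    have e : ∀ n, ψ (inv (y n)) = y n := fun n => hinv _ (hy n)
    have h1 : Filter.Tendsto (fun n => (inv (y n) : ℝ × ℝ)) Filter.atTop (nhds x) := by
      have := (continuous_fst.tendsto _).comp hyt
      refine this.congr fun n => ?_
      exact (congrArg Prod.fst (e n)).symm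
    have h2 := (continuous_snd.tendsto _).comp hyt
    have h3 := tendstoInMeasure_of_tendsto_Lp h2
    obtain ⟨ns, hns, h4⟩ := h3.exists_seq_tendsto_ae
    refine ⟨fun n => inv (y (ns n)), fun n => ⟨_, hy _, rfl⟩, h1.comp hns.tendsto_atTop, ?_⟩
    have h5 : ∀ᵐ r ∂μ, ∀ n, ((y (ns n)).2 : ℝ → ℂ) r = G (inv (y (ns n))) r := by
      rw [ae_all_iff]; intro n
      have := (memLp_one_iff_integrable.2 (hG _ (inv (y (ns n))).2)).coeFn_toLp
      have e' : (y (ns n)).2 = (ψ (inv (y (ns n)))).2 := by rw [e]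
      rw [e']
      exact this
    filter_upwards [h4, h5, (memLp_one_iff_integrable.2 (hG x hx)).coeFn_toLp] with r a1 a2 a3
    rw [← a3]
    refine a1.congr fun n => ?_
    exact a2 n

/-- the measurable envelope -/
def env (D : Set (ℝ × ℝ)) (h : ℝ × ℝ → ℝ → ℝ≥0∞) (x : ℝ × ℝ) (r : ℝ) : ℝ≥0∞ :=
  ⨅ n : ℕ, ⨆ d ∈ D, ⨆ _ : dist d x < 1 / ((n:ℝ) + 1), h d r

lemma env_meas {D : Set (ℝ × ℝ)} (hD : D.Countable) {h : ℝ × ℝ → ℝ → ℝ≥0∞} (hh : ∀ d ∈ D, Measurable (h d)) :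
    Measurable fun q : (ℝ × ℝ) × ℝ => env D h q.1 q.2 := by
  unfold env
  refine Measurable.iInf fun n => Measurable.biSup D hD fun d hd => ?_
  have hS : MeasurableSet {q : (ℝ × ℝ) × ℝ | dist d q.1 < 1 / ((n:ℝ) + 1)} := measurableSet_lt (by fun_prop) (by fun_prop)
  have := ((hh d hd).comp measurable_snd : Measurable fun q : (ℝ × ℝ) × ℝ => h d q.2).indicator hS
  convert this using 1
  funext q
  by_cases hq : dist d q.1 < 1 / ((n:ℝ) + 1)
  · rw [iSup_pos hq, indicator_of_mem (show q ∈ {q : (ℝ × ℝ) × ℝ | dist d q.1 < 1 / ((n:ℝ) + 1)} from hq)]; rfl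
  · rw [iSup_neg hq, indicator_of_notMem (show q ∉ {q : (ℝ × ℝ) × ℝ | dist d q.1 < 1 / ((n:ℝ) + 1)} from hq)]; rfl

lemma le_env {D : Set (ℝ × ℝ)} {h : ℝ × ℝ → ℝ → ℝ≥0∞} {x : ℝ × ℝ} {r : ℝ} {d : ℕ → ℝ × ℝ} (hd : ∀ n, d n ∈ D)
    (ht : Filter.Tendsto d Filter.atTop (nhds x)) {v : ℝ≥0∞}
    (hv : Filter.Tendsto (fun n => h (d n) r) Filter.atTop (nhds v)) : v ≤ env D h x r := by
  refine le_iInf fun n => ?_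
  refine le_of_tendsto hv ?_
  filter_upwards [ht (Metric.ball_mem_nhds x (by positivity : (0:ℝ) < 1 / ((n:ℝ) + 1)))] with m hm
  exact le_iSup₂_of_le (d m) (hd m) (le_iSup_of_le (by simpa using hm) le_rfl)

lemma env_le {D : Set (ℝ × ℝ)} {h : ℝ × ℝ → ℝ → ℝ≥0∞} {x : ℝ × ℝ} {r : ℝ} {Φ : ℝ × ℝ → ℝ≥0∞} (hΦ : ContinuousAt Φ x)
    (hd : ∀ d ∈ D, h d r ≤ Φ d) : env D h x r ≤ Φ x := by
  refine le_of_forall_gt_imp_ge_of_dense fun c hc => ?_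
  have := hΦ.eventually_lt_const hc
  obtain ⟨e, he, hb⟩ := Metric.eventually_nhds_iff.1 this
  obtain ⟨n, hn⟩ := exists_nat_one_div_lt he
  refine (iInf_le _ n).trans (iSup₂_le fun d hdD => iSup_le fun hdx => ?_)
  exact (hd d hdD).trans (hb (hdx.trans hn)).le


lemma trunc {D : Set (ℝ × ℝ)} (hD : D.Countable) {k : ℝ × ℝ → ℝ → ℂ} {K : ℝ} (hk : ∀ x θ, ‖k x θ‖ ≤ K)
    (hkm : ∀ x, Measurable (k x)) (hkc : ∀ x, ∀ᵐ θ, ContinuousAt (fun x => k x θ) x) {f : ℝ → ℂ} {ε : ℝ}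
    (hε : 0 < ε) (hf : ∀ θ, f θ ≠ 0 → θ ∈ Ico 0 ε) {p : ℝ} (hp : 1 < p) {I : Set ℝ} (hI : MeasurableSet I)
    (hfin : ∫⁻ θ in I, ‖f θ‖ₑ ^ p ≠ ⊤) :
    ∃ g : ℝ → ℂ, Measurable g ∧ (∀ t, t ∉ Ico 0 ε → g t = 0) ∧ ∫⁻ θ, ‖g θ‖ₑ ^ p ≤ ∫⁻ θ in I, ‖f θ‖ₑ ^ p ∧
      Continuous (fun x => ∫ θ in I, k x θ * g θ) ∧
      ∀ d ∈ D, ‖∫ θ in I, k d θ * f θ‖ₑ ≤ ‖∫ θ in I, k d θ * g θ‖ₑ := by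
  set D' : Set (ℝ × ℝ) := {d ∈ D | Integrable (fun θ => k d θ * f θ) (volume.restrict I)} with hD'
  have cD' : D'.Countable := hD.mono fun d hd => hd.1
  have : Countable D' := cD'.to_subtype
  set B : Set ℝ := ⋃ d : D', ({θ | k d θ ≠ 0} ∩ I) with hB
  have mS : ∀ d, MeasurableSet {θ | k d θ ≠ 0} := fun d => (hkm d (measurableSet_singleton 0).compl)
  have mB : MeasurableSet B := MeasurableSet.iUnion fun d => (mS d).inter hI
  have af : AEMeasurable f (volume.restrict B) := by
    rw [hB, aemeasurable_iUnion_iff]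
    rintro ⟨d, hd⟩
    have h1 : AEMeasurable (fun θ => k d θ * f θ) (volume.restrict ({θ | k d θ ≠ 0} ∩ I)) :=
      hd.2.aestronglyMeasurable.aemeasurable.mono_measure (Measure.restrict_mono inter_subset_right le_rfl)
    have h2 := h1.div (hkm d).aemeasurable
    refine h2.congr ?_
    filter_upwards [ae_restrict_mem ((mS d).inter hI)] with θ hθ
    have : k d θ ≠ 0 := hθ.1
    simp only [Pi.div_apply]
    field_simp
  have af' : AEMeasurable (B.indicator f) volume := (aemeasurable_indicator_iff mB).2 af
  set g : ℝ → ℂ := (Ico 0 ε).indicator (af'.mk _) with hg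
  have gm : Measurable g := af'.measurable_mk.indicator measurableSet_Ico
  have ge : g =ᵐ[volume] B.indicator f := by
    filter_upwards [af'.ae_eq_mk] with θ hθ
    by_cases h : θ ∈ Ico 0 ε
    · rw [hg, indicator_of_mem h, hθ]
    · rw [hg, indicator_of_notMem h]
      by_cases hb : θ ∈ B
      · rw [indicator_of_mem hb]; by_contra h'; exact h (hf θ (Ne.symm h'))
      · rw [indicator_of_notMem hb]
  have gs : ∀ t, t ∉ Ico 0 ε → g t = 0 := fun t ht => indicator_of_notMem ht _
  have gp : ∫⁻ θ, ‖g θ‖ₑ ^ p ≤ ∫⁻ θ in I, ‖f θ‖ₑ ^ p := by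
    rw [← lintegral_indicator hI]
    refine lintegral_mono_ae ?_
    filter_upwards [ge] with θ hθ
    rw [hθ]
    by_cases hb : θ ∈ B
    · have : θ ∈ I := by
        obtain ⟨d, hd⟩ := mem_iUnion.1 hb; exact hd.2
      rw [indicator_of_mem hb, indicator_of_mem this]
    · rw [indicator_of_notMem hb, enorm_zero, ENNReal.zero_rpow_of_pos (by linarith)]; exact zero_le
  have gi : Integrable g := integrable_of_Lp gm (α := 0) (ℓ := ε) hε
    (fun t ht => gs t fun h => ht ⟨h.1, by linarith [h.2]⟩) hp (ne_top_of_le_ne_top hfin gp)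
  refine ⟨g, gm, gs, gp, ?_, ?_⟩
  · rw [continuous_iff_continuousAt]
    intro x
    refine continuousAt_of_dominated (bound := fun θ => K * ‖g θ‖) ?_ ?_ (gi.restrict.norm.const_mul K) ?_
    · exact Filter.Eventually.of_forall fun x => ((hkm x).mul gm).aestronglyMeasurable
    · refine Filter.Eventually.of_forall fun x => ae_of_all _ fun θ => ?_
      rw [norm_mul]; exact mul_le_mul_of_nonneg_right (hk x θ) (norm_nonneg _)
    · filter_upwards [ae_restrict_of_ae (hkc x)] with θ hθ
      exact hθ.mul continuousAt_const
  · intro d hd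
    by_cases hi : Integrable (fun θ => k d θ * f θ) (volume.restrict I)
    · refine le_of_eq ?_
      congr 1
      refine integral_congr_ae ?_
      filter_upwards [ae_restrict_of_ae ge, ae_restrict_mem hI] with θ hθ hθI
      rw [hθ]
      by_cases hk0 : k d θ = 0
      · simp [hk0]
      · rw [indicator_of_mem]
        exact mem_iUnion.2 ⟨⟨d, hd, hi⟩, hk0, hθI⟩
    · rw [integral_undef hi, enorm_zero]; exact zero_le


def Wc (p : ℝ) (κ : ℕ) : ℝ≥0∞ := ∫⁻ r in Ioc (0:ℝ) (4/3), ENNReal.ofReal (r ^ (1 - κ / (p - 1)))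

lemma Wc_ne_top {p : ℝ} {κ : ℕ} (hp : 1 < p) (hκ : (κ:ℝ) < 2 * (p - 1)) : Wc p κ ≠ ⊤ := by
  have h : -1 < 1 - κ / (p - 1) := by
    have : κ / (p - 1) < 2 := by rw [div_lt_iff₀ (by linarith)]; exact hκ
    linarith
  have := (intervalIntegral.intervalIntegrable_rpow' (a := 0) (b := 4/3) h)
  rw [intervalIntegrable_iff_integrableOn_Ioc_of_le (by norm_num)] at this
  exact ne_top_of_lt this.lintegral_lt_top

lemma holder_step {p : ℝ} (hp : 1 < p) (κ : ℕ) {A : ℝ → ℝ≥0∞} (hA : Measurable A) :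
    (∫⁻ r in Ioc (0:ℝ) (4/3), A r) ^ p ≤
      Wc p κ ^ (p - 1) * ∫⁻ r in Ioc (0:ℝ) (4/3), A r ^ p * ENNReal.ofReal (r ^ (κ + 1 - p)) := by
  set α : ℝ := κ / (p - 1) with hα
  have hm : ∀ s : ℝ, Measurable fun r : ℝ => ENNReal.ofReal (r ^ s) := fun s => (measurable_id.pow_const s).ennreal_ofReal
  have mB : Measurable fun r => A r * ENNReal.ofReal (r ^ (α - 1)) := hA.mul (hm _)
  have mB' : Measurable fun r => (A r * ENNReal.ofReal (r ^ (α - 1))) ^ p := mB.pow_const p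
  have h := jensen_lintegral ((volume.restrict (Ioc (0:ℝ) (4/3))).withDensity fun r => ENNReal.ofReal (r ^ (1 - α))) hp
    (f := fun r => A r * ENNReal.ofReal (r ^ (α - 1))) (hA.mul (hm _)).aemeasurable
  rw [lintegral_withDensity_eq_lintegral_mul _ (hm _) mB,
    lintegral_withDensity_eq_lintegral_mul _ (hm _) mB', withDensity_apply _ MeasurableSet.univ, Measure.restrict_univ] at h
  have e1 : ∫⁻ r in Ioc (0:ℝ) (4/3), A r = ∫⁻ r in Ioc (0:ℝ) (4/3), ((fun r => ENNReal.ofReal (r ^ (1 - α))) * fun r => A r * ENNReal.ofReal (r ^ (α - 1))) r := by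
    refine setLIntegral_congr_fun measurableSet_Ioc fun r hr => ?_
    simp only [Pi.mul_apply]
    rw [mul_left_comm, ← ENNReal.ofReal_mul (rpow_nonneg hr.1.le _), ← rpow_add hr.1]
    simp
  have e2 : ∫⁻ r in Ioc (0:ℝ) (4/3), A r ^ p * ENNReal.ofReal (r ^ (κ + 1 - p)) = ∫⁻ r in Ioc (0:ℝ) (4/3), ((fun r => ENNReal.ofReal (r ^ (1 - α))) * fun r => (A r * ENNReal.ofReal (r ^ (α - 1))) ^ p) r := by
    refine setLIntegral_congr_fun measurableSet_Ioc fun r hr => ?_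
    simp only [Pi.mul_apply]
    rw [ENNReal.mul_rpow_of_nonneg _ _ (by linarith), mul_left_comm, ENNReal.ofReal_rpow_of_nonneg (rpow_nonneg hr.1.le _) (by linarith),
      ← ENNReal.ofReal_mul (rpow_nonneg hr.1.le _), ← rpow_mul hr.1.le, ← rpow_add hr.1]
    congr 3
    have : p - 1 ≠ 0 := by linarith
    rw [hα]; field_simp; ring
  rw [e1, e2]
  exact h

lemma tail_bound {p : ℝ} (hp : 1 < p) {κ : ℕ} {I : Set ℝ} {C : ℝ≥0∞} (hC1 : C ≠ ⊤)
    {A : ℝ × ℝ → ℝ → ℝ≥0∞} (mA : Measurable fun q : (ℝ × ℝ) × ℝ => A q.1 q.2) {T : ℝ → ℝ → ℝ≥0∞} {Φ : ℝ → ℝ≥0∞}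
    (s1 : ∀ u ω, 0 < u → T u ω ≤ ∫⁻ r in Ioc (0:ℝ) (4/3), A (u, ω) r)
    (s2 : ∀ᵐ r ∂(volume.restrict (Ioc (0:ℝ) (4/3))), ∫⁻ x in Ioi (0:ℝ) ×ˢ I, A x r ^ p * ENNReal.ofReal x.1 ≤
      C * ENNReal.ofReal ((r ^ κ)⁻¹) * ENNReal.ofReal r ^ p * Φ r) :
    ∫⁻ u in Ioi (0:ℝ), (∫⁻ ω in I, T u ω ^ p) * ENNReal.ofReal u ≤
      Wc p κ ^ (p - 1) * C * ∫⁻ r in Ioi (0:ℝ), Φ r * ENNReal.ofReal r := by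
  have sub : Ioc (0:ℝ) (4/3) ⊆ Ioi 0 := fun r hr => hr.1
  have hm : ∀ s : ℝ, Measurable fun r : ℝ => ENNReal.ofReal (r ^ s) := fun s => (measurable_id.pow_const s).ennreal_ofReal
  set H : (ℝ × ℝ) → ℝ≥0∞ := fun x => ∫⁻ r in Ioc (0:ℝ) (4/3), A x r ^ p * ENNReal.ofReal (r ^ (κ + 1 - p)) with hH
  have mE : Measurable fun q : (ℝ × ℝ) × ℝ => A q.1 q.2 ^ p * ENNReal.ofReal (q.2 ^ (κ + 1 - p)) :=
    (mA.pow_const p).mul ((hm _).comp measurable_snd)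
  have mH : Measurable H := mE.lintegral_prod_right'
  have mHu : Measurable fun x : ℝ × ℝ => H x * ENNReal.ofReal x.1 := mH.mul (by fun_prop)
  have mHi : Measurable fun u : ℝ => ∫⁻ ω in I, H (u, ω) * ENNReal.ofReal u := mHu.lintegral_prod_right'
  calc ∫⁻ u in Ioi (0:ℝ), (∫⁻ ω in I, T u ω ^ p) * ENNReal.ofReal u
      ≤ ∫⁻ u in Ioi (0:ℝ), (∫⁻ ω in I, Wc p κ ^ (p - 1) * H (u, ω)) * ENNReal.ofReal u := by
        refine setLIntegral_mono_ae' measurableSet_Ioi (ae_of_all _ fun u hu => ?_)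
        refine mul_le_mul_left (lintegral_mono fun ω => ?_) _
        exact (ENNReal.rpow_le_rpow (s1 u ω hu) (by linarith)).trans
          (holder_step hp κ (mA.comp (measurable_const.prodMk measurable_id)))
    _ = Wc p κ ^ (p - 1) * ∫⁻ x in Ioi (0:ℝ) ×ˢ I, H x * ENNReal.ofReal x.1 := by
        rw [Measure.volume_eq_prod, ← Measure.prod_restrict, lintegral_prod _ mHu.aemeasurable, ← lintegral_const_mul _ mHi]
        refine lintegral_congr fun u => ?_
        have mHs : Measurable fun ω : ℝ => H (u, ω) := mH.comp (measurable_const.prodMk measurable_id)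
        rw [lintegral_const_mul _ mHs, lintegral_mul_const _ mHs, mul_assoc]
    _ = Wc p κ ^ (p - 1) * ∫⁻ r in Ioc (0:ℝ) (4/3), ENNReal.ofReal (r ^ (κ + 1 - p)) * ∫⁻ x in Ioi (0:ℝ) ×ˢ I, A x r ^ p * ENNReal.ofReal x.1 := by
        congr 1
        have : ∀ x : ℝ × ℝ, H x * ENNReal.ofReal x.1 = ∫⁻ r in Ioc (0:ℝ) (4/3), A x r ^ p * ENNReal.ofReal (r ^ (κ + 1 - p)) * ENNReal.ofReal x.1 := by
          intro x
          rw [lintegral_mul_const' _ _ ENNReal.ofReal_ne_top]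
        simp only [this]
        rw [lintegral_lintegral_swap (mE.mul (by fun_prop)).aemeasurable]
        refine lintegral_congr fun r => ?_
        rw [← lintegral_const_mul' _ _ ENNReal.ofReal_ne_top]
        refine lintegral_congr fun x => ?_
        ring
    _ ≤ Wc p κ ^ (p - 1) * ∫⁻ r in Ioc (0:ℝ) (4/3), C * (Φ r * ENNReal.ofReal r) := by
        refine mul_le_mul_right (lintegral_mono_ae ?_) _
        filter_upwards [s2, ae_restrict_mem measurableSet_Ioc] with r h1 hr
        refine (mul_le_mul_right h1 _).trans (le_of_eq ?_)
        have r0 : 0 < r := hr.1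
        have e : ENNReal.ofReal r = ENNReal.ofReal (r ^ (κ + 1 - p)) * ENNReal.ofReal ((r ^ κ)⁻¹) * ENNReal.ofReal r ^ p := by
          rw [ENNReal.ofReal_rpow_of_pos r0, ← ENNReal.ofReal_mul (by positivity), ← ENNReal.ofReal_mul (by positivity)]
          congr 1
          rw [← rpow_natCast, ← rpow_neg r0.le, ← rpow_add r0, ← rpow_add r0]
          ring_nf
          simp
        calc _ = C * (Φ r * (ENNReal.ofReal (r ^ (κ + 1 - p)) * ENNReal.ofReal ((r ^ κ)⁻¹) * ENNReal.ofReal r ^ p)) := by ring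
          _ = _ := by rw [← e]
    _ = Wc p κ ^ (p - 1) * C * ∫⁻ r in Ioc (0:ℝ) (4/3), Φ r * ENNReal.ofReal r := by
        rw [lintegral_const_mul' _ _ hC1, mul_assoc]
    _ ≤ _ := mul_le_mul_right (lintegral_mono_set sub) _

lemma lemN {k : ℝ × ℝ → ℝ → ℝ → ℂ} {K : ℝ} (hk : ∀ x r θ, ‖k x r θ‖ ≤ K) (hkm : ∀ x r, Measurable (k x r))
    (hkc : ∀ x r, ∀ᵐ θ, ContinuousAt (fun x => k x r θ) x)
    (hkr : ∀ x : ℝ × ℝ, 0 < x.1 → ∀ r θ, 4 / 3 < r → k x r θ = 0) {ε : ℝ} (hε : 0 < ε) {p : ℝ} (hp : 1 < p) {κ : ℕ}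
    {I : Set ℝ} (hI : MeasurableSet I) {C : ℝ≥0∞} (hC0 : C ≠ 0) (hC1 : C ≠ ⊤)
    (hP : ∀ r, 0 < r → r ≤ 4 / 3 → ∀ g : ℝ → ℂ, Measurable g → (∀ t, t ∉ Ico 0 ε → g t = 0) →
      ∫⁻ x in Ioi (0:ℝ) ×ˢ I, ‖∫ θ in I, k x r θ * g θ‖ₑ ^ p * ENNReal.ofReal x.1 ≤
        C * ENNReal.ofReal ((r ^ κ)⁻¹) * ∫⁻ θ, ‖g θ‖ₑ ^ p)
    {f : ℝ → ℝ → ℂ} (hf : ∀ r θ, f r θ ≠ 0 → θ ∈ Ico 0 ε) :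
    ∫⁻ u in Ioi (0:ℝ), (∫⁻ ω in I, ‖∫ r in Ioi (0:ℝ), (∫ θ in I, k (u, ω) r θ * f r θ) * (r:ℂ)‖ₑ ^ p) * ENNReal.ofReal u ≤
      Wc p κ ^ (p - 1) * C * ∫⁻ r in Ioi (0:ℝ), (∫⁻ θ in I, ‖f r θ‖ₑ ^ p) * ENNReal.ofReal r := by
  set G : ℝ × ℝ → ℝ → ℂ := fun x r => (∫ θ in I, k x r θ * f r θ) * (r:ℂ) with hG
  set μ := (volume : Measure ℝ).restrict (Ioi 0) with hμ
  obtain ⟨D, cD, hDX, hdense⟩ := dense_select {x | 0 < x.1 ∧ Integrable (G x) μ} G μ (fun x hx => hx.2)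
  choose! G' hG'm hG'e using fun (d : ℝ × ℝ) (hd : d ∈ D) => (hDX hd).2.aestronglyMeasurable.aemeasurable
  set h : ℝ × ℝ → ℝ → ℝ≥0∞ := fun d r => ‖G' d r‖ₑ with hh
  have hae : ∀ᵐ r ∂μ, ∀ d ∈ D, h d r = ‖G d r‖ₑ := by
    rw [ae_ball_iff cD]
    intro d hd
    filter_upwards [hG'e d hd] with r hr
    simp only [hh]; rw [hr]
  have mA := env_meas cD (h := h) (fun d hd => (hG'm d hd).enorm)
  have sub : Ioc (0:ℝ) (4/3) ⊆ Ioi 0 := fun r hr => hr.1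
  have s1 : ∀ x : ℝ × ℝ, 0 < x.1 → ‖∫ r in Ioi (0:ℝ), G x r‖ₑ ≤ ∫⁻ r in Ioc (0:ℝ) (4/3), env D h x r := by
    intro x hx
    by_cases hi : Integrable (G x) μ
    · refine (enorm_integral_le_lintegral_enorm _).trans ?_
      obtain ⟨d, hdD, hdt, hda⟩ := hdense x ⟨hx, hi⟩
      have e : ∫⁻ r in Ioc (0:ℝ) (4/3), env D h x r = ∫⁻ r in Ioi (0:ℝ), (Ioc (0:ℝ) (4/3)).indicator (env D h x) r := by
        rw [lintegral_indicator measurableSet_Ioc, Measure.restrict_restrict measurableSet_Ioc, inter_eq_left.2 sub]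
      rw [e]
      refine lintegral_mono_ae ?_
      filter_upwards [hda, hae, ae_restrict_mem measurableSet_Ioi] with r h1 h2 h3
      by_cases hr : r ≤ 4/3
      · rw [indicator_of_mem (show r ∈ Ioc (0:ℝ) (4/3) from ⟨h3, hr⟩)]
        refine le_env hdD hdt ?_
        simp only [h2 _ (hdD _)]
        exact h1.enorm
      · have : G x r = 0 := by
          simp only [hG]
          simp [hkr x hx r _ (not_le.1 hr)]
        rw [this, enorm_zero]; exact zero_le
    · rw [integral_undef hi, enorm_zero]; exact zero_le
  have s2 : ∀ᵐ r ∂(volume.restrict (Ioc (0:ℝ) (4/3))), ∫⁻ x in Ioi (0:ℝ) ×ˢ I, env D h x r ^ p * ENNReal.ofReal x.1 ≤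
      C * ENNReal.ofReal ((r ^ κ)⁻¹) * ENNReal.ofReal r ^ p * ∫⁻ θ in I, ‖f r θ‖ₑ ^ p := by
    filter_upwards [ae_restrict_of_ae_restrict_of_subset sub hae, ae_restrict_mem measurableSet_Ioc] with r h1 hr
    have r0 : 0 < r := hr.1
    by_cases hfin : ∫⁻ θ in I, ‖f r θ‖ₑ ^ p = ⊤
    · rw [hfin, ENNReal.mul_top]
      · exact le_top
      · refine mul_ne_zero (mul_ne_zero hC0 ?_) ?_
        · rw [Ne, ENNReal.ofReal_eq_zero, not_le]; positivity
        · rw [ENNReal.ofReal_rpow_of_pos r0, Ne, ENNReal.ofReal_eq_zero, not_le]; positivity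
    obtain ⟨g, gm, gs, gp, gc, gd⟩ := trunc cD (k := fun x θ => k x r θ) (fun x θ => hk x r θ) (fun x => hkm x r) (fun x => hkc x r)
      hε (hf r) hp hI hfin
    have hle : ∀ x, env D h x r ≤ ‖∫ θ in I, k x r θ * g θ‖ₑ * ENNReal.ofReal r := by
      intro x
      refine env_le (Φ := fun x => ‖∫ θ in I, k x r θ * g θ‖ₑ * ENNReal.ofReal r) ?_ ?_
      · exact ((ENNReal.continuous_mul_const ENNReal.ofReal_ne_top).comp gc.enorm).continuousAt
      · intro d hd
        rw [h1 d hd]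
        simp only [hG]
        rw [enorm_mul]
        refine mul_le_mul' (gd d hd) (le_of_eq ?_)
        rw [← ofReal_norm, Complex.norm_real, norm_of_nonneg r0.le]
    calc ∫⁻ x in Ioi (0:ℝ) ×ˢ I, env D h x r ^ p * ENNReal.ofReal x.1
        ≤ ∫⁻ x in Ioi (0:ℝ) ×ˢ I, ENNReal.ofReal r ^ p * (‖∫ θ in I, k x r θ * g θ‖ₑ ^ p * ENNReal.ofReal x.1) := by
          refine lintegral_mono fun x => ?_
          refine (mul_le_mul_left (ENNReal.rpow_le_rpow (hle x) (by linarith)) _).trans (le_of_eq ?_)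
          rw [ENNReal.mul_rpow_of_nonneg _ _ (by linarith)]; ring
      _ = ENNReal.ofReal r ^ p * ∫⁻ x in Ioi (0:ℝ) ×ˢ I, (‖∫ θ in I, k x r θ * g θ‖ₑ ^ p * ENNReal.ofReal x.1) :=
          lintegral_const_mul' _ _ (ENNReal.rpow_ne_top_of_nonneg (by linarith) ENNReal.ofReal_ne_top)
      _ ≤ ENNReal.ofReal r ^ p * (C * ENNReal.ofReal ((r ^ κ)⁻¹) * ∫⁻ θ in I, ‖f r θ‖ₑ ^ p) :=
          mul_le_mul_right ((hP r r0 hr.2 g gm gs).trans (mul_le_mul_right gp _)) _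
      _ = _ := by ring
  exact tail_bound hp hC1 mA (fun u ω hu => s1 (u, ω) hu) s2


def kern (δ : ℝ) (a : ℝ → ℂ) (β η : ℝ → ℝ) (j : ℕ) (x : ℝ × ℝ) (r θ : ℝ) : ℂ :=
  Ktil δ a β j x.1 x.2 r θ * ((η (x.2 - θ) : ℝ) : ℂ)

lemma bfun_supp {δ : ℝ} {a : ℝ → ℂ} {β : ℝ → ℝ} (hβs : Function.support β ⊆ Set.Icc (3 / 8) (4 / 3)) {j : ℕ} {r : ℝ}
    (h : r ∉ Icc (3/8:ℝ) (4/3)) : bfun δ a β j r = 0 := by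
  have : β r = 0 := by by_contra hh; exact h (hβs hh)
  simp [bfun, this]

lemma dG_PB (u r ω θ : ℝ) : dG u r (ω - θ) = PB r u (ω - π) θ := by
  unfold dG PB
  congr 1
  have h1 : cos (ω - π - θ) = - cos (ω - θ) := by rw [show ω - π - θ = ω - θ - π by ring, cos_sub_pi]
  have h2 : sin (ω - π - θ) = - sin (ω - θ) := by rw [show ω - π - θ = ω - θ - π by ring, sin_sub_pi]
  rw [h1, h2]
  have := sin_sq_add_cos_sq (ω - θ)
  linear_combination (-r ^ 2) * this

lemma PB_ge {r u v t : ℝ} (hr : 0 ≤ r) (hu : 0 ≤ u) (hv : |v - t| ≤ 1) : u ≤ PB r u v t ∧ r ≤ PB r u v t := by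
  have hc : 0 ≤ cos (v - t) := cos_nonneg_of_mem_Icc ⟨by linarith [(abs_le.1 hv).1, pi_gt_three], by linarith [(abs_le.1 hv).2, pi_gt_three]⟩
  have h1 : (u + r * cos (v - t)) ^ 2 + (r * sin (v - t)) ^ 2 = u ^ 2 + 2 * (u * r * cos (v - t)) + r ^ 2 * (sin (v - t) ^ 2 + cos (v - t) ^ 2) := by ring
  rw [sin_sq_add_cos_sq] at h1
  have h2 : 0 ≤ u * r * cos (v - t) := by positivity
  unfold PB
  rw [h1]
  exact ⟨Real.le_sqrt_of_sq_le (by nlinarith), Real.le_sqrt_of_sq_le (by nlinarith)⟩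

lemma kern_bound {δ : ℝ} {a : ℝ → ℂ} {β η : ℝ → ℝ} {j : ℕ} {B B' : ℝ} (hA : ∀ r, ‖bfun δ a β j r‖ ≤ B) (hη : ∀ s, ‖((η s : ℝ) : ℂ)‖ ≤ B')
    (x : ℝ × ℝ) (r θ : ℝ) : ‖kern δ a β η j x r θ‖ ≤ (2 : ℝ) ^ (-(j : ℝ) * (3 / 2 + δ)) * B * 1 * 1 * B' := by
  unfold kern Ktil
  rw [norm_mul, norm_mul, norm_mul, norm_mul, norm_cexp_real, Complex.norm_real, norm_of_nonneg (by positivity)]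
  have hB : 0 ≤ B := (norm_nonneg _).trans (hA 0)
  refine mul_le_mul (mul_le_mul (mul_le_mul (mul_le_mul_of_nonneg_left (hA _) (by positivity)) le_rfl (by positivity) (by positivity)) ?_ (by positivity) (by positivity)) (hη _) (norm_nonneg _) (by positivity)
  refine (norm_indicator_le_norm_self _ _).trans (by simp)

lemma kern_meas {δ : ℝ} {a : ℝ → ℂ} {β η : ℝ → ℝ} {j : ℕ} (hA : Continuous (bfun δ a β j)) (hη : Continuous η)
    (x : ℝ × ℝ) (r : ℝ) : Measurable (kern δ a β η j x r) := by
  have c1 : Continuous fun θ => dG x.1 r (x.2 - θ) := by unfold dG; fun_prop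
  have c2 : Continuous fun θ => bfun δ a β j (dG x.1 r (x.2 - θ)) := hA.comp c1
  have c3 : Measurable fun θ => Set.indicator (Set.Icc (0 : ℝ) Real.pi) (fun _ => (1 : ℂ)) |x.2 - θ| :=
    (measurable_const.indicator measurableSet_Icc).comp (by fun_prop)
  unfold kern Ktil
  have c4 : Continuous fun θ => Complex.exp (Complex.I * (((2 : ℝ) ^ (j : ℝ) * dG x.1 r (x.2 - θ) : ℝ) : ℂ)) := by fun_prop
  exact (((c2.measurable.const_mul _).mul c4.measurable).mul c3).mul (by fun_prop)

lemma kern_cont {δ : ℝ} {a : ℝ → ℂ} {β η : ℝ → ℝ} {j : ℕ} (hA : Continuous (bfun δ a β j)) (hη : Continuous η)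
    (x : ℝ × ℝ) (r : ℝ) : ∀ᵐ θ, ContinuousAt (fun x => kern δ a β η j x r θ) x := by
  have fin : ({x.2 - π, x.2 + π} : Set ℝ).Countable := by simp
  filter_upwards [fin.ae_notMem volume] with θ hθ
  have hne : |x.2 - θ| ≠ π := by
    intro h
    apply hθ
    rcases (abs_eq pi_pos.le).1 h with h | h
    · left; linarith
    · right; simp only [mem_singleton_iff]; linarith
  have c1 : Continuous fun x : ℝ × ℝ => dG x.1 r (x.2 - θ) := by unfold dG; fun_prop
  have c2 : Continuous fun x : ℝ × ℝ => bfun δ a β j (dG x.1 r (x.2 - θ)) := hA.comp c1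
  have c4 : Continuous fun x : ℝ × ℝ => Complex.exp (Complex.I * (((2 : ℝ) ^ (j : ℝ) * dG x.1 r (x.2 - θ) : ℝ) : ℂ)) := by fun_prop
  have c0 : Continuous fun x : ℝ × ℝ => |x.2 - θ| := by fun_prop
  have c3 : ContinuousAt (fun x : ℝ × ℝ => Set.indicator (Set.Icc (0 : ℝ) Real.pi) (fun _ => (1 : ℂ)) |x.2 - θ|) x := by
    rcases lt_or_gt_of_ne hne with h | h
    · refine (continuousAt_const (y := (1:ℂ))).congr ?_
      filter_upwards [c0.continuousAt.eventually_lt_const h] with y hy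
      rw [indicator_of_mem]; exact ⟨abs_nonneg _, hy.le⟩
    · refine (continuousAt_const (y := (0:ℂ))).congr ?_
      filter_upwards [c0.continuousAt.eventually_const_lt h] with y hy
      rw [indicator_of_notMem]; exact fun h' => absurd h'.2 (not_le.2 hy)
  have c5 : Continuous fun x : ℝ × ℝ => ((η (x.2 - θ) : ℝ) : ℂ) := by fun_prop
  unfold kern Ktil
  exact (((continuousAt_const.mul c2.continuousAt).mul c4.continuousAt).mul c3).mul c5.continuousAt

lemma eta_supp {η : ℝ → ℝ} {ε s : ℝ} (hs : Function.support η ⊆ Set.Icc (π - 2 * ε) (π + 2 * ε)) (h : η s ≠ 0) :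
    |s - π| ≤ 2 * ε := by
  have := hs h
  rw [abs_le]; constructor <;> linarith [this.1, this.2]

lemma kern_far {δ : ℝ} {a : ℝ → ℂ} {β η : ℝ → ℝ} {j : ℕ} (hβs : Function.support β ⊆ Set.Icc (3 / 8) (4 / 3)) {ε : ℝ} (he : ε ≤ 1 / 12)
    (hs : Function.support η ⊆ Set.Icc (π - 2 * ε) (π + 2 * ε)) (x : ℝ × ℝ) (hx : 0 < x.1) (r θ : ℝ) (hr : 4 / 3 < r) :
    kern δ a β η j x r θ = 0 := by
  unfold kern
  by_cases h : η (x.2 - θ) = 0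
  · simp [h]
  · have h1 := eta_supp hs h
    have h2 := (PB_ge (r := r) (u := x.1) (v := x.2 - π) (t := θ) (by linarith) hx.le (by rw [show x.2 - π - θ = x.2 - θ - π by ring]; linarith)).2
    unfold Ktil
    rw [dG_PB, bfun_supp hβs (fun h => by linarith [h.2])]
    simp

lemma kern_eq {δ : ℝ} {a : ℝ → ℂ} {β η : ℝ → ℝ} {j : ℕ} {ε : ℝ} (he : ε ≤ 1 / 12)
    (hs : Function.support η ⊆ Set.Icc (π - 2 * ε) (π + 2 * ε)) (x : ℝ × ℝ) (r θ : ℝ) :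
    kern δ a β η j x r θ = (((2 : ℝ) ^ (-(j : ℝ) * (3 / 2 + δ)) : ℝ) : ℂ) * (Ici (x.2 - π)).indicator (fun t =>
      bfun δ a β j (PB r x.1 (x.2 - π) t) * Complex.exp (Complex.I * ((((2 ^ j : ℕ) : ℝ) * PB r x.1 (x.2 - π) t : ℝ) : ℂ)) *
        ((η (x.2 - π - t + π) : ℝ) : ℂ)) θ := by
  unfold kern
  have e2 : (2:ℝ) ^ (j:ℝ) = ((2 ^ j : ℕ) : ℝ) := by rw [rpow_natCast]; push_cast; rfl
  by_cases h : η (x.2 - θ) = 0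
  · have : η (x.2 - π - θ + π) = 0 := by rw [show x.2 - π - θ + π = x.2 - θ by ring]; exact h
    rw [h]
    by_cases h' : θ ∈ Ici (x.2 - π)
    · simp [indicator_of_mem h', this]
    · simp [indicator_of_notMem h']
  · have h1 := abs_le.1 (eta_supp hs h)
    unfold Ktil
    rw [dG_PB, e2, abs_of_nonneg (show 0 ≤ x.2 - θ by linarith [h1.1, pi_gt_three])]
    by_cases h' : θ ∈ Ici (x.2 - π)
    · rw [indicator_of_mem h', indicator_of_mem (show x.2 - θ ∈ Icc 0 π from ⟨by linarith [h1.1, pi_gt_three], by linarith [mem_Ici.1 h']⟩),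
        show x.2 - π - θ + π = x.2 - θ by ring]
      ring
    · rw [indicator_of_notMem h', indicator_of_notMem (show x.2 - θ ∉ Icc 0 π from fun h => h' (mem_Ici.2 (by linarith [h.2])))]
      ring

lemma kern_int {δ : ℝ} {a : ℝ → ℂ} {β η : ℝ → ℝ} {j : ℕ} {ε : ℝ} (he : ε ≤ 1 / 12)
    (hs : Function.support η ⊆ Set.Icc (π - 2 * ε) (π + 2 * ε)) (x : ℝ × ℝ) (r : ℝ) {g : ℝ → ℂ} (hg : ∀ t, t ∉ Ico 0 ε → g t = 0) :
    ∫ θ in Ico (0:ℝ) (2 * π), kern δ a β η j x r θ * g θ = (((2 : ℝ) ^ (-(j : ℝ) * (3 / 2 + δ)) : ℝ) : ℂ) *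
      SJ r ((2 ^ j : ℕ) : ℝ) (bfun δ a β j) (fun s => ((η (s + π) : ℝ) : ℂ)) g (x.1, x.2 - π) := by
  have h0 : ∀ t, t ∉ Ico (0:ℝ) (2 * π) → g t = 0 := fun t ht => hg t fun h => ht ⟨h.1, by linarith [h.2, pi_gt_three]⟩
  rw [setIntegral_eq_integral_of_forall_compl_eq_zero (fun t ht => by rw [h0 t ht, mul_zero])]
  unfold SJ
  rw [← integral_indicator measurableSet_Ici, ← integral_const_mul]
  refine integral_congr_ae (ae_of_all _ fun θ => ?_)
  simp only
  rw [kern_eq he hs]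
  by_cases h' : θ ∈ Ici (x.2 - π)
  · rw [indicator_of_mem h', indicator_of_mem h']; ring
  · rw [indicator_of_notMem h', indicator_of_notMem h']; ring

lemma SJ_zero {δ : ℝ} {a : ℝ → ℂ} {β η : ℝ → ℝ} {j : ℕ} (hβs : Function.support β ⊆ Set.Icc (3 / 8) (4 / 3)) {ε τ : ℝ} (he : ε ≤ 1 / 12)
    (heτ : 3 * ε ≤ τ) (he0 : 0 < ε)
    (hs : Function.support η ⊆ Set.Icc (π - 2 * ε) (π + 2 * ε)) {r N u v : ℝ} (hr : 0 < r) (hu : 0 < u) {g : ℝ → ℂ} (hg : ∀ t, t ∉ Ico 0 ε → g t = 0)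
    (hx : (u, v) ∉ Rg τ r) : SJ r N (bfun δ a β j) (fun s => ((η (s + π) : ℝ) : ℂ)) g (u, v) = 0 := by
  unfold SJ
  refine integral_eq_zero_of_ae (ae_of_all _ fun t => ?_)
  simp only [Pi.zero_apply]
  by_contra h
  apply hx
  have g0 : g t ≠ 0 := right_ne_zero_of_mul h
  have h1 := left_ne_zero_of_mul h
  have e0 : η (v - t + π) ≠ 0 := by exact_mod_cast right_ne_zero_of_mul h1
  have b0 := left_ne_zero_of_mul (left_ne_zero_of_mul h1)
  have ht : t ∈ Ico 0 ε := by by_contra h'; exact g0 (hg t h')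
  have hP : PB r u v t ∈ Icc (3/8:ℝ) (4/3) := by by_contra h'; exact b0 (bfun_supp hβs h')
  have hv := eta_supp hs e0
  rw [show v - t + π - π = v - t by ring] at hv
  have hg' := PB_ge (r := r) (u := u) (v := v) (t := t) hr.le hu.le (by linarith)
  have hl := PB_le (r := r) (u := u) (v := v) (t := t) hr.le hu.le
  rw [abs_le] at hv
  exact ⟨⟨hu, by linarith [hg'.1, hP.2]⟩, by linarith [hP.1], by constructor <;> dsimp only <;> linarith [ht.1, ht.2, hv.1, hv.2]⟩


lemma perR {δ : ℝ} {a : ℝ → ℂ} {β η : ℝ → ℝ} {j : ℕ} (hβs : Function.support β ⊆ Set.Icc (3 / 8) (4 / 3)) {ε τ p : ℝ} (hp : 1 < p) (he : ε ≤ 1 / 12)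
    (heτ : 3 * ε ≤ τ) (he0 : 0 < ε)
    (hs : Function.support η ⊆ Set.Icc (π - 2 * ε) (π + 2 * ε)) {r : ℝ} (hr : 0 < r) {g : ℝ → ℂ} (hg : ∀ t, t ∉ Ico 0 ε → g t = 0) :
    ∫⁻ x in Ioi (0:ℝ) ×ˢ Ico (0:ℝ) (2 * π), ‖∫ θ in Ico (0:ℝ) (2 * π), kern δ a β η j x r θ * g θ‖ₑ ^ p * ENNReal.ofReal x.1 ≤
      ENNReal.ofReal ((2 : ℝ) ^ (-(j : ℝ) * (3 / 2 + δ))) ^ p *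
       ∫⁻ x in Rg τ r, ‖SJ r ((2 ^ j : ℕ) : ℝ) (bfun δ a β j) (fun s => ((η (s + π) : ℝ) : ℂ)) g x‖ₑ ^ p * ENNReal.ofReal x.1 := by
  set c := ENNReal.ofReal ((2 : ℝ) ^ (-(j : ℝ) * (3 / 2 + δ))) ^ p with hc
  have hct : c ≠ ⊤ := ENNReal.rpow_ne_top_of_nonneg (by linarith) ENNReal.ofReal_ne_top
  set S := SJ r ((2 ^ j : ℕ) : ℝ) (bfun δ a β j) (fun s => ((η (s + π) : ℝ) : ℂ)) g with hS
  let F : ℝ × ℝ → ℝ≥0∞ := (Rg τ r).indicator (fun x => ‖S x‖ₑ ^ p * ENNReal.ofReal x.1)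
  have hpt : ∀ x : ℝ × ℝ, x ∈ Ioi (0:ℝ) ×ˢ Ico (0:ℝ) (2 * π) →
      ‖∫ θ in Ico (0:ℝ) (2 * π), kern δ a β η j x r θ * g θ‖ₑ ^ p * ENNReal.ofReal x.1 ≤ c * F (x - (0, π)) := by
    intro x hx
    have e : x - (0, π) = (x.1, x.2 - π) := by ext <;> simp
    rw [kern_int he hs x r hg, enorm_mul, ENNReal.mul_rpow_of_nonneg _ _ (by linarith), e, ← hS]
    have e2 : ‖(((2 : ℝ) ^ (-(j : ℝ) * (3 / 2 + δ)) : ℝ) : ℂ)‖ₑ = ENNReal.ofReal ((2 : ℝ) ^ (-(j : ℝ) * (3 / 2 + δ))) := by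
      rw [← ofReal_norm, Complex.norm_real, norm_of_nonneg (by positivity)]
    rw [e2, ← hc, mul_assoc]
    refine mul_le_mul_right ?_ _
    by_cases h : (x.1, x.2 - π) ∈ Rg τ r
    · simp only [F]; rw [indicator_of_mem h]
    · rw [hS, SJ_zero hβs he heτ he0 hs hr hx.1 hg h]
      simp [ENNReal.zero_rpow_of_pos (show 0 < p by linarith)]
  calc _ ≤ ∫⁻ x in Ioi (0:ℝ) ×ˢ Ico (0:ℝ) (2 * π), c * F (x - (0, π)) :=
        setLIntegral_mono_ae' (measurableSet_Ioi.prod measurableSet_Ico) (ae_of_all _ hpt)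
    _ ≤ ∫⁻ x, c * F (x - (0, π)) := setLIntegral_le_lintegral _ _
    _ = ∫⁻ x, c * F x := lintegral_sub_right_eq_self (fun x => c * F x) _
    _ = c * ∫⁻ x, F x := lintegral_const_mul' _ _ hct
    _ = _ := by rw [lintegral_indicator (Rg_meas τ r)]

lemma genP {δ : ℝ} {a : ℝ → ℂ} (ha : IsSymbol0 a) {β η : ℝ → ℝ} (hβ : ContDiff ℝ (⊤ : ℕ∞) β)
    (hβs : Function.support β ⊆ Set.Icc (3 / 8) (4 / 3)) {ε τ p : ℝ} {s κ : ℕ} {C0 : ℝ≥0} (hp : 1 < p)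
    (hτ0 : 0 < τ) (hτ : τ ≤ 1 / 4) (heτ : 3 * ε ≤ τ) (he0 : 0 < ε) (hs2 : s ≤ 2) (hκ : (κ : ℝ) < 2 * (p - 1))
    (hJ : JB τ p s κ C0) (hη : ContDiff ℝ (⊤ : ℕ∞) η)
    (hs : Function.support η ⊆ Set.Icc (π - 2 * ε) (π + 2 * ε)) :
    ∃ C : ℝ≥0, ∀ j : ℕ, ∀ f : ℝ → ℝ → ℂ, (∀ r θ, f r θ ≠ 0 → 0 < r ∧ θ ∈ Set.Ico (0 : ℝ) ε) →
      polarLp p (Ttil δ a β η j f) ≤ (C : ℝ≥0∞) * (2 : ℝ≥0∞) ^ (-(j : ℝ) * (3 / 2 + δ)) *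
                (2 : ℝ≥0∞) ^ (-(s * (j : ℝ)) / p) * polarLp p f := by
  have he : ε ≤ 1 / 12 := by linarith
  obtain ⟨B1, hB1⟩ := bd_amp (δ := δ) ha hβ hβs
  obtain ⟨B2, hB2⟩ := bd_eta hη (by linarith) hs
  obtain ⟨C, hC⟩ := SB hτ0 hτ hp hs2 hJ B1 B2
  have hp0 : 0 < p := by linarith
  have hW : Wc p κ ≠ ⊤ := Wc_ne_top hp hκ
  have hD : (Wc p κ ^ (p - 1) * (C + 1 : ℝ≥0)) ^ (1 / p) ≠ ⊤ := by
    refine ENNReal.rpow_ne_top_of_nonneg (by positivity) (ENNReal.mul_ne_top (ENNReal.rpow_ne_top_of_nonneg (by linarith) hW) ENNReal.coe_ne_top)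
  refine ⟨((Wc p κ ^ (p - 1) * (C + 1 : ℝ≥0)) ^ (1 / p)).toNNReal, fun j f hf => ?_⟩
  rw [ENNReal.coe_toNNReal hD]
  set c : ℝ≥0∞ := (2 : ℝ≥0∞) ^ (-(j : ℝ) * (3 / 2 + δ)) with hc
  have hcr : ENNReal.ofReal ((2 : ℝ) ^ (-(j : ℝ) * (3 / 2 + δ))) = c := by
    rw [hc, ← ENNReal.ofReal_rpow_of_pos (by norm_num)]; norm_num
  have hc0 : c ≠ 0 := by rw [← hcr]; simp; positivity
  have hct : c ≠ ⊤ := by rw [← hcr]; exact ENNReal.ofReal_ne_top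
  set d : ℝ≥0∞ := (2 : ℝ≥0∞) ^ (-(s * (j : ℝ))) with hd
  have hdr : ENNReal.ofReal ((((2 ^ j : ℕ) : ℝ) ^ s)⁻¹) = d := by
    rw [hd, show (2:ℝ≥0∞) = ENNReal.ofReal 2 by norm_num, ENNReal.ofReal_rpow_of_pos (by norm_num)]
    congr 1
    rw [rpow_neg (by norm_num), mul_comm, rpow_mul (by norm_num)]; push_cast; simp [rpow_natCast]
  have hd0 : d ≠ 0 := by rw [← hdr]; simp
  have hdt : d ≠ ⊤ := by rw [← hdr]; exact ENNReal.ofReal_ne_top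
  have key := lemN (k := kern δ a β η j) (f := f) (ε := ε) (p := p) (κ := κ) (I := Ico (0:ℝ) (2 * π)) (C := c ^ p * (C + 1 : ℝ≥0) * d)
    (kern_bound (fun r => (hB1 j).bound r (mem_univ r)) (fun s => by
      have := hB2.bound (s - π) (mem_univ _); simpa using this))
    (kern_meas (hB1 j).continuous hη.continuous) (kern_cont (hB1 j).continuous hη.continuous)
    (kern_far hβs he hs) he0 hp measurableSet_Ico
    (mul_ne_zero (mul_ne_zero (by simp [hc0, hct]) (by simp)) hd0)
    (ENNReal.mul_ne_top (ENNReal.mul_ne_top (ENNReal.rpow_ne_top_of_nonneg hp0.le hct) ENNReal.coe_ne_top) hdt)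
    (by
      intro r hr hr1 g hgm hg
      refine (perR hβs hp he heτ he0 hs hr hg).trans ?_
      rw [hcr]
      have h1 := hC (bfun δ a β j) (fun s => ((η (s + π) : ℝ) : ℂ)) (hB1 j)
        (fun r hr => bfun_supp hβs fun h => hr ⟨by linarith [h.1], by linarith [h.2]⟩) hB2
        (fun r hr => by
          by_contra h
          have h' : η (r + π) ≠ 0 := by exact_mod_cast h
          have := abs_le.1 (eta_supp hs h')
          exact hr ⟨by linarith [this.1], by linarith [this.2]⟩)
        (2 ^ j) Nat.one_le_two_pow r hr hr1 g hgm
        (fun t ht => hg t fun h => ht ⟨by linarith [h.1], by linarith [h.2]⟩)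
      refine (mul_le_mul_right h1 _).trans ?_
      rw [mul_inv, ENNReal.ofReal_mul (by positivity), hdr]
      have : (C : ℝ≥0∞) ≤ (C + 1 : ℝ≥0) := by exact_mod_cast le_self_add
      calc c ^ p * (C * (d * ENNReal.ofReal ((r ^ κ)⁻¹)) * ∫⁻ t, ‖g t‖ₑ ^ p)
          ≤ c ^ p * ((C + 1 : ℝ≥0) * (d * ENNReal.ofReal ((r ^ κ)⁻¹)) * ∫⁻ t, ‖g t‖ₑ ^ p) := by gcongr
        _ = _ := by ring)
    (fun r θ h => (hf r θ h).2)
  have key2 := ENNReal.rpow_le_rpow key (show 0 ≤ 1 / p by positivity)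
  refine key2.trans (le_of_eq ?_)
  have e1 : Wc p κ ^ (p - 1) * (c ^ p * (C + 1 : ℝ≥0) * d) = (Wc p κ ^ (p - 1) * (C + 1 : ℝ≥0)) * c ^ p * d := by ring
  rw [e1, ENNReal.mul_rpow_of_nonneg _ _ (by positivity), ENNReal.mul_rpow_of_nonneg _ _ (by positivity),
    ENNReal.mul_rpow_of_nonneg _ _ (by positivity), ← ENNReal.rpow_mul c, mul_one_div_cancel hp0.ne', ENNReal.rpow_one, hd, ← ENNReal.rpow_mul (2:ℝ≥0∞),
    mul_one_div]
  rfl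

theorem stmt2 (δ : ℝ) (hδ : 0 ≤ δ) (a : ℝ → ℂ) (ha : IsSymbol0 a)
    (β : ℝ → ℝ) (hβ : ContDiff ℝ (⊤ : ℕ∞) β)
    (hβs : Function.support β ⊆ Set.Icc (3 / 8) (4 / 3)) :
    ∃ ε₀ : ℝ, 0 < ε₀ ∧ ∀ ε : ℝ, 0 < ε → ε ≤ ε₀ →
      ∀ η : ℝ → ℝ, ContDiff ℝ (⊤ : ℕ∞) η →
        Function.support η ⊆ Set.Icc (Real.pi - 2 * ε) (Real.pi + 2 * ε) →
        (∀ θ ∈ Set.Icc (Real.pi - ε) (Real.pi + ε), η θ = 1) →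
        (∃ C : ℝ≥0, ∀ (j : ℕ), 1 ≤ j → ∀ f : ℝ → ℝ → ℂ,
            (∀ r θ, f r θ ≠ 0 → 0 < r ∧ θ ∈ Set.Ico (0 : ℝ) ε) →
            polarLp 2 (Ttil δ a β η j f) ≤
              (C : ℝ≥0∞) * (2 : ℝ≥0∞) ^ (-(j : ℝ) * (3 / 2 + δ)) *
                (2 : ℝ≥0∞) ^ (-(j : ℝ) / 2) * polarLp 2 f) ∧
        (∀ p : ℝ, 4 < p → ∃ C : ℝ≥0, ∀ (j : ℕ), 1 ≤ j → ∀ f : ℝ → ℝ → ℂ,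
            (∀ r θ, f r θ ≠ 0 → 0 < r ∧ θ ∈ Set.Ico (0 : ℝ) ε) →
            polarLp p (Ttil δ a β η j f) ≤
              (C : ℝ≥0∞) * (2 : ℝ≥0∞) ^ (-(j : ℝ) * (3 / 2 + δ)) *
                (2 : ℝ≥0∞) ^ (-2 * (j : ℝ) / p) * polarLp p f) := by
  obtain ⟨τ, hτ0, hτ, ⟨C2, h2⟩, h4⟩ := JB_all
  refine ⟨τ / 3, by positivity, fun ε he0 he η hη hs _ => ⟨?_, ?_⟩⟩
  · obtain ⟨C, hC⟩ := genP (δ := δ) ha hβ hβs (by norm_num) hτ0 hτ (by linarith) he0 (by norm_num) (by norm_num) h2 hη hs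
    refine ⟨C, fun j _ f hf => ?_⟩
    have := hC j f hf
    rwa [show -(((1:ℕ):ℝ) * (j:ℝ)) / 2 = -(j:ℝ) / 2 by push_cast; ring] at this
  · intro p hp
    obtain ⟨C4, h4⟩ := h4 p hp
    obtain ⟨C, hC⟩ := genP (δ := δ) ha hβ hβs (by linarith) hτ0 hτ (by linarith) he0 le_rfl (by push_cast; linarith) h4 hη hs
    refine ⟨C, fun j _ f hf => ?_⟩
    have := hC j f hf
    rwa [show -(((2:ℕ):ℝ) * (j:ℝ)) / p = -2 * (j:ℝ) / p by push_cast; ring] at this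

end
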